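/- Let h : K → K be a homeomorphism. Then there exists an integer b such that the homeomorphism g = σ̂^b ∘ h satisfies: g(x̄) = x̄ for every folding point x̄ ∈ F; g maps every composant of K onto itself; g preserves the order along composants; and there exists M > 0 such that for every z̄ ∈ K the points z̄ and g(z̄) lie on a common arc in K of d̄-length at most M. -/

import Mathlib

open Set Filter Topology Function

noncomputable section

/-- The tent map with slope `s`. -/
def tent (s : ℝ) (x : ℝ) : ℝ := min (s * x) (s * (1 - x))

/-- The ω-limit set of `c` under iteration of `f`. -/
def omegaSet (f : ℝ → ℝ) (c : ℝ) : Set ℝ :=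
  {y | ∃ φ : ℕ → ℕ, StrictMono φ ∧ Tendsto (fun k => f^[φ k] c) atTop (𝓝 y)}

/-- The inverse limit space `K = lim←([0,1], T)`, as a subset of `ℕ → ℝ`. -/
def invLim (s : ℝ) : Set (ℕ → ℝ) :=
  {x | (∀ n, x n ∈ Icc (0 : ℝ) 1) ∧ ∀ n, x n = tent s (x (n + 1))}

/-- The `n`-th coordinate projection `π_n : K → [0,1]`. -/
def proj (s : ℝ) (n : ℕ) (x : invLim s) : ℝ := (x : ℕ → ℝ) n

/-- The inverse shift homeomorphism `σ̂⁻¹(x₀,x₁,…) = (x₁,x₂,…)` as a map `K → K`. -/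
def shiftInvFun (s : ℝ) (x : invLim s) : invLim s :=
  ⟨fun n => (x : ℕ → ℝ) (n + 1), fun n => x.2.1 (n + 1), fun n => x.2.2 (n + 1)⟩

/-- The shift homeomorphism `σ̂(x₀,x₁,…) = (T x₀, x₀, x₁, …)` as a map `K → K`. -/
def shiftFwdFun (s : ℝ) (hs1 : Real.sqrt 2 < s) (hs2 : s < 2) (x : invLim s) : invLim s := by
  refine ⟨fun n => Nat.casesOn n (tent s ((x : ℕ → ℝ) 0)) (fun k => (x : ℕ → ℝ) k), ?_, ?_⟩
  · intro n
    cases n with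
    | zero =>
      have hx0 := x.2.1 0
      have hs0 : 0 ≤ s := le_of_lt (lt_of_le_of_lt (Real.sqrt_nonneg 2) hs1)
      constructor
      · exact le_min (mul_nonneg hs0 hx0.1) (mul_nonneg hs0 (by linarith [hx0.2]))
      · rcases le_total ((x : ℕ → ℝ) 0) (1 / 2) with hc | hc
        · exact le_trans (min_le_left _ _) (by nlinarith [hx0.1, hx0.2])
        · exact le_trans (min_le_right _ _) (by nlinarith [hx0.1, hx0.2])
    | succ k => exact x.2.1 k
  · intro n
    cases n with
    | zero => rfl
    | succ k => exact x.2.2 k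

/-- The integer power `σ̂^b` of the shift homeomorphism : for `b ≥ 0` it is the `b`-th iterate
of `σ̂`, and for `b < 0` the `|b|`-th iterate of `σ̂⁻¹`. -/
def shiftZ (s : ℝ) (hs1 : Real.sqrt 2 < s) (hs2 : s < 2) (b : ℤ) : invLim s → invLim s :=
  if 0 ≤ b then (shiftFwdFun s hs1 hs2)^[b.toNat] else (shiftInvFun s)^[(-b).toNat]

/-- The set `F` of folding points of `K`. -/
def foldingPts (s : ℝ) : Set (invLim s) :=
  {x | ∀ n, proj s n x ∈ omegaSet (tent s) (1 / 2)}

/-- The set `E_p` of `p`-points of `K`. -/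
def pPoints (s : ℝ) (p : ℕ) : Set (invLim s) :=
  {x | ∃ n, p < n ∧ proj s n x = 1 / 2}

/-- `A` is an arc with endpoints `a` and `b`. -/
def IsArcWith {X : Type*} [TopologicalSpace X] (A : Set X) (a b : X) : Prop :=
  ∃ f : unitInterval → X, Topology.IsEmbedding f ∧ range f = A ∧ f 0 = a ∧ f 1 = b

/-- `A` is an arc (a homeomorphic copy of `[0,1]`). -/
def IsArc {X : Type*} [TopologicalSpace X] (A : Set X) : Prop :=
  ∃ a b, IsArcWith A a b

/-- `A` is an arc with endpoints `a`, `b`, possibly degenerate (a single point when `a = b`). -/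
def IsArcBtw {X : Type*} [TopologicalSpace X] (A : Set X) (a b : X) : Prop :=
  IsArcWith A a b ∨ (a = b ∧ A = {a})

/-- `A` is an arc, possibly degenerate (i.e. a single point). -/
def IsArcOrPoint {X : Type*} [TopologicalSpace X] (A : Set X) : Prop :=
  IsArc A ∨ ∃ x, A = {x}

/-- The composant of a point `x`: the union of all proper subcontinua containing `x`. -/
def composant {X : Type*} [TopologicalSpace X] (x : X) : Set X :=
  {y | ∃ A : Set X, IsCompact A ∧ IsConnected A ∧ A ≠ univ ∧ x ∈ A ∧ y ∈ A}

/-- `g` preserves the order along composants: for every composant `C` and every continuous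
bijection `φ` from `ℝ` (respectively from `[0,∞)`) onto `C`, the map `φ⁻¹ ∘ g ∘ φ` is strictly
increasing. -/
def PreservesCompOrder {X : Type*} [TopologicalSpace X] (g : X → X) : Prop :=
  ∀ x : X,
    (∀ φ : ℝ → X, Continuous φ → Injective φ → range φ = composant x →
      ∀ t t' u u' : ℝ, g (φ t) = φ u → g (φ t') = φ u' → t < t' → u < u') ∧
    (∀ φ : {r : ℝ // (0 : ℝ) ≤ r} → X, Continuous φ → Injective φ → range φ = composant x →
      ∀ t t' u u', g (φ t) = φ u → g (φ t') = φ u' → t < t' → u < u')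

/-- Two self-maps of `X` are isotopic if there is a continuous `H : X × [0,1] → X` joining them
through homeomorphisms. -/
def Isotopic {X : Type*} [TopologicalSpace X] (f g : X → X) : Prop :=
  ∃ H : X × unitInterval → X, Continuous H ∧ (∀ x, H (x, 0) = f x) ∧ (∀ x, H (x, 1) = g x) ∧
    ∀ t : unitInterval, IsHomeomorph fun x => H (x, t)

/-- The topological limsup of a sequence of subsets. -/
def setLimsup {X : Type*} [TopologicalSpace X] (D : ℕ → Set X) : Set X :=
  {y | ∃ φ : ℕ → ℕ, StrictMono φ ∧ ∃ z : ℕ → X, (∀ k, z k ∈ D (φ k)) ∧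
    Tendsto z atTop (𝓝 y)}

/-- The point `0̄ = (0,0,0,…)` of `K` (an endpoint of `K`). -/
def zeroPt (s : ℝ) (hs1 : Real.sqrt 2 < s) : invLim s := by
  refine ⟨fun _ => 0, fun n => ⟨le_refl 0, zero_le_one⟩, fun n => ?_⟩
  have hs0 : 0 ≤ s := le_of_lt (lt_of_le_of_lt (Real.sqrt_nonneg 2) hs1)
  simp [tent]
  exact hs0

section Basics

lemma tent_abs {s : ℝ} (hs : 1 < s) (x : ℝ) : tent s x = s * (1 / 2 - |x - 1 / 2|) := by
  unfold tent
  rcases le_total x (1 / 2) with h | h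
  · rw [abs_of_nonpos (by linarith), min_eq_left (by nlinarith)]; ring
  · rw [abs_of_nonneg (by linarith), min_eq_right (by nlinarith)]; ring

lemma tent_left {s : ℝ} (hs : 1 < s) {x : ℝ} (hx : x ≤ 1 / 2) : tent s x = s * x := by
  rw [tent_abs hs, abs_of_nonpos (by linarith)]; ring

lemma tent_right {s : ℝ} (hs : 1 < s) {x : ℝ} (hx : 1 / 2 ≤ x) : tent s x = s * (1 - x) := by
  rw [tent_abs hs, abs_of_nonneg (by linarith)]; ring

lemma tent_lip {s : ℝ} (hs : 1 < s) (x y : ℝ) : |tent s x - tent s y| ≤ s * |x - y| := by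
  rw [tent_abs hs, tent_abs hs]
  have h : s * (1 / 2 - |x - 1 / 2|) - s * (1 / 2 - |y - 1 / 2|)
      = s * (|y - 1 / 2| - |x - 1 / 2|) := by ring
  rw [h, abs_mul, abs_of_pos (by linarith : (0 : ℝ) < s)]
  refine mul_le_mul_of_nonneg_left ?_ (by linarith)
  have h2 := abs_abs_sub_abs_le_abs_sub (y - 1 / 2) (x - 1 / 2)
  have h3 : y - 1 / 2 - (x - 1 / 2) = -(x - y) := by ring
  rw [h3, abs_neg] at h2
  exact h2

lemma tent_iter_lip {s : ℝ} (hs : 1 < s) (k : ℕ) (x y : ℝ) :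
    |(tent s)^[k] x - (tent s)^[k] y| ≤ s ^ k * |x - y| := by
  induction k with
  | zero => simp
  | succ k ih =>
    rw [iterate_succ_apply', iterate_succ_apply']
    calc _ ≤ s * |(tent s)^[k] x - (tent s)^[k] y| := tent_lip hs _ _
      _ ≤ s * (s ^ k * |x - y|) := mul_le_mul_of_nonneg_left ih (by linarith)
      _ = _ := by ring

lemma tent_le {s : ℝ} (hs : 1 < s) (x : ℝ) : tent s x ≤ s / 2 := by
  rw [tent_abs hs]
  nlinarith [abs_nonneg (x - 1 / 2)]

lemma tent_nonneg {s : ℝ} (hs : 1 < s) {x : ℝ} (h0 : 0 ≤ x) (h1 : x ≤ 1) : 0 ≤ tent s x := by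
  unfold tent
  exact le_min (by nlinarith) (by nlinarith)

lemma exists_pow_bound {s : ℝ} (hs : 1 < s) (t : ℝ) : ∃ k : ℕ, t ≤ s ^ k * (s / 2) := by
  obtain ⟨k, hk⟩ := pow_unbounded_of_one_lt (2 * |t|) hs
  refine ⟨k, ?_⟩
  have := le_abs_self t
  have h1 : (0 : ℝ) < s ^ k := by positivity
  nlinarith

/-- The height function of the ray through `0`. -/
def ff (s t : ℝ) : ℝ :=
  open Classical in
  if h : ∃ k : ℕ, t ≤ s ^ k * (s / 2) then (tent s)^[Nat.find h] (t / s ^ Nat.find h) else 0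

lemma ff_eq_aux {s : ℝ} (hs : 1 < s) (t : ℝ) (k : ℕ) (hk : t ≤ s ^ k * (s / 2)) (m : ℕ) :
    (tent s)^[k + m] (t / s ^ (k + m)) = (tent s)^[k] (t / s ^ k) := by
  induction m with
  | zero => simp
  | succ m ih =>
    rw [← ih, ← Nat.add_assoc, iterate_succ_apply]
    congr 1
    have hp : (0 : ℝ) < s ^ k := by positivity
    have hp2 : (0 : ℝ) < s ^ (k + m + 1) := by positivity
    rw [tent_left hs]
    · rw [pow_succ]; field_simp
    · rw [div_le_iff₀ hp2]
      have : s ^ k ≤ s ^ (k + m) := pow_le_pow_right₀ hs.le (by omega)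
      rw [pow_succ]
      nlinarith

lemma ff_eq {s : ℝ} (hs : 1 < s) (t : ℝ) (k : ℕ) (hk : t ≤ s ^ k * (s / 2)) :
    ff s t = (tent s)^[k] (t / s ^ k) := by
  classical
  have h : ∃ k : ℕ, t ≤ s ^ k * (s / 2) := ⟨k, hk⟩
  unfold ff
  rw [dif_pos h]
  have h1 := Nat.find_spec h
  have h2 : Nat.find h ≤ k := Nat.find_min' h hk
  obtain ⟨m, hm⟩ := Nat.exists_eq_add_of_le h2
  have h3 := ff_eq_aux hs t (Nat.find h) h1 m
  rw [← hm] at h3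
  rw [h3]

lemma ff_id {s : ℝ} (hs : 1 < s) {t : ℝ} (ht : t ≤ s / 2) : ff s t = t := by
  rw [ff_eq hs t 0 (by simpa using ht)]; simp

lemma ff_mul {s : ℝ} (hs : 1 < s) (t : ℝ) : ff s (s * t) = tent s (ff s t) := by
  obtain ⟨k, hk⟩ := exists_pow_bound hs t
  rw [ff_eq hs t k hk, ff_eq hs (s * t) (k + 1) (by rw [pow_succ]; nlinarith),
    iterate_succ_apply']
  congr 2
  have hp : (0 : ℝ) < s ^ k := by positivity
  rw [pow_succ]; field_simp

lemma ff_div {s : ℝ} (hs : 1 < s) (t : ℝ) : ff s t = tent s (ff s (t / s)) := by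
  rw [← ff_mul hs]; congr 1; field_simp

lemma ff_mul_pow {s : ℝ} (hs : 1 < s) (t : ℝ) (m : ℕ) :
    ff s (s ^ m * t) = (tent s)^[m] (ff s t) := by
  induction m with
  | zero => simp
  | succ m ih => rw [iterate_succ_apply', ← ih, ← ff_mul hs]; congr 1; ring

lemma ff_div_pow {s : ℝ} (hs : 1 < s) (t : ℝ) (m : ℕ) :
    ff s t = (tent s)^[m] (ff s (t / s ^ m)) := by
  rw [← ff_mul_pow hs]; congr 1; field_simp

lemma ff_div_succ {s : ℝ} (hs : 1 < s) (t : ℝ) (m : ℕ) :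
    ff s (t / s ^ m) = tent s (ff s (t / s ^ (m + 1))) := by
  rw [ff_div hs (t / s ^ m)]; congr 2; rw [pow_succ]; field_simp

lemma ff_div_le {s : ℝ} (hs : 1 < s) (t : ℝ) {i m : ℕ} (him : i ≤ m) :
    ff s (t / s ^ i) = (tent s)^[m - i] (ff s (t / s ^ m)) := by
  rw [ff_div_pow hs (t / s ^ i) (m - i)]
  congr 2
  rw [div_div, ← pow_add]; congr 2; omega

lemma ff_lip {s : ℝ} (hs : 1 < s) (a b : ℝ) : |ff s a - ff s b| ≤ |a - b| := by
  obtain ⟨k, hk⟩ := exists_pow_bound hs (max a b)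
  rw [ff_eq hs a k (le_trans (le_max_left _ _) hk), ff_eq hs b k (le_trans (le_max_right _ _) hk)]
  refine (tent_iter_lip hs k _ _).trans ?_
  have hp : (0 : ℝ) < s ^ k := by positivity
  rw [← sub_div, abs_div, abs_of_pos hp]
  apply le_of_eq
  field_simp

lemma ff_continuous {s : ℝ} (hs : 1 < s) : Continuous (ff s) := by
  have : LipschitzWith 1 (ff s) := LipschitzWith.of_dist_le_mul (fun a b => by
    simpa [Real.dist_eq] using ff_lip hs a b)
  exact this.continuous

lemma ff_le {s : ℝ} (hs : 1 < s) (t : ℝ) : ff s t ≤ s / 2 := by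
  rw [ff_div hs]; exact tent_le hs _

lemma ff_nonneg {s : ℝ} (hs : 1 < s) (hs2 : s < 2) {t : ℝ} (ht : 0 ≤ t) : 0 ≤ ff s t := by
  obtain ⟨k, hk⟩ := exists_pow_bound hs t
  have key : ∀ k : ℕ, ∀ t : ℝ, 0 ≤ t → t ≤ s ^ k * (s / 2) → 0 ≤ ff s t := by
    intro k
    induction k with
    | zero => intro t h0 h; rw [ff_id hs (by simpa using h)]; exact h0
    | succ k ih =>
      intro t h0 h
      rw [ff_div hs]
      refine tent_nonneg hs (ih _ (by positivity) ?_) ((ff_le hs _).trans (by linarith))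
      rw [div_le_iff₀ (by linarith)]
      rw [pow_succ] at h; linarith
  exact key k t ht hk

/-- left end of the core -/
def cc (s : ℝ) : ℝ := s * (1 - s / 2)

lemma cc_le_half {s : ℝ} : cc s ≤ 1 / 2 := by
  unfold cc; nlinarith [sq_nonneg (s - 1)]

lemma cc_pos {s : ℝ} (hs : 1 < s) (hs2 : s < 2) : 0 < cc s := by
  unfold cc; apply mul_pos <;> linarith

lemma ff_core {s : ℝ} (hs : 1 < s) (hs2 : s < 2) {t : ℝ} (ht : cc s ≤ t) : cc s ≤ ff s t := by
  obtain ⟨k, hk⟩ := exists_pow_bound hs t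
  have key : ∀ k : ℕ, ∀ t : ℝ, cc s ≤ t → t ≤ s ^ k * (s / 2) → cc s ≤ ff s t := by
    intro k
    induction k with
    | zero => intro t h0 h; rw [ff_id hs (by simpa using h)]; exact h0
    | succ k ih =>
      intro t h0 h
      rcases le_total t (s / 2) with h3 | h3
      · rw [ff_id hs h3]; exact h0
      · rw [ff_div hs]
        have h4 : cc s ≤ t / s := by
          refine cc_le_half.trans ?_
          rw [le_div_iff₀ (by linarith)]; linarith
        have h5 : cc s ≤ ff s (t / s) := by
          refine ih _ h4 ?_
          rw [div_le_iff₀ (by linarith)]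
          rw [pow_succ] at h; linarith
        have h6 := ff_le hs (t / s)
        rcases le_total (ff s (t / s)) (1 / 2) with h7 | h7
        · rw [tent_left hs h7]; nlinarith [cc_pos hs hs2]
        · rw [tent_right hs h7]; unfold cc; nlinarith
  exact key k t ht hk

lemma lt_cc_of_ff {s : ℝ} (hs : 1 < s) (hs2 : s < 2) {t : ℝ} (ht : ff s t < cc s) : t < cc s := by
  by_contra h
  push Not at h
  exact absurd (ff_core hs hs2 h) (not_le.mpr ht)

/-- uniform non-recurrence -/
structure NR (s δ : ℝ) : Prop where
  pos : 0 < δ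
  le : δ ≤ 1 / 4
  sep : ∀ k : ℕ, 1 ≤ k → δ ≤ |(tent s)^[k] (1 / 2) - 1 / 2|

/-- turning points of level `m` -/
def TP (s : ℝ) (m : ℕ) (t : ℝ) : Prop := ff s (t / s ^ m) = 1 / 2

lemma TP.val {s : ℝ} (hs : 1 < s) {m : ℕ} {t : ℝ} (h : TP s m t) {i : ℕ} (hi : i ≤ m) :
    ff s (t / s ^ i) = (tent s)^[m - i] (1 / 2) := by
  rw [ff_div_le hs t hi]; unfold TP at h; rw [h]

lemma TP.val0 {s : ℝ} (hs : 1 < s) {m : ℕ} {t : ℝ} (h : TP s m t) :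
    ff s t = (tent s)^[m] (1 / 2) := by
  simpa using h.val hs (Nat.zero_le m)

lemma TP.lower {s : ℝ} (hs : 1 < s) {m : ℕ} {t : ℝ} (h : TP s m t) : s ^ m / 2 ≤ t := by
  have hp : (0 : ℝ) < s ^ m := by positivity
  by_contra hlt
  push Not at hlt
  have h1 : t / s ^ m < 1 / 2 := by rw [div_lt_iff₀ hp]; linarith
  have h2 := ff_id hs (t := t / s ^ m) (by linarith)
  unfold TP at h
  linarith

lemma half_iter_one {s : ℝ} (hs : 1 < s) : tent s (1 / 2) = s / 2 := by
  rw [tent_left hs le_rfl]; ring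

lemma NR.le_half {s δ : ℝ} (hs : 1 < s) (hN : NR s δ) : δ ≤ (s - 1) / 2 := by
  have := hN.sep 1 le_rfl
  rw [iterate_one, half_iter_one hs, abs_of_pos (by linarith)] at this
  linarith

lemma form_aux {s δ : ℝ} (hs : 1 < s) (hN : NR s δ) : ∀ n : ℕ, ∀ a b : ℝ, a ≤ b → b - a ≤ δ →
    b ≤ s ^ n * (s / 2) → ∃ t0 e σ : ℝ, (σ = 1 ∨ σ = -1) ∧ t0 ∈ Icc a b ∧
      (∀ t ∈ Icc a b, ff s t = e + σ * |t - t0|) ∧ (t0 ∈ Ioo a b → ∃ m, 1 ≤ m ∧ TP s m t0) := by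
  have hs0 : (0 : ℝ) < s := by linarith
  intro n
  induction n with
  | zero =>
    intro a b hab hd hb
    refine ⟨a, a, 1, Or.inl rfl, ⟨le_rfl, hab⟩, ?_, fun h => absurd h.1 (lt_irrefl _)⟩
    intro t ht
    rw [ff_id hs (by simp at hb; linarith [ht.2]), abs_of_nonneg (by linarith [ht.1])]; ring
  | succ n ih =>
    intro a b hab hd hb
    have hab' : a / s ≤ b / s := by gcongr
    have hd1 : b / s - a / s < δ := by
      rw [← sub_div, div_lt_iff₀ hs0]; nlinarith [hN.pos]
    obtain ⟨t0, e, σ, hσ, ht0, hf, hm⟩ := ih (a / s) (b / s) hab' hd1.le (by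
      rw [div_le_iff₀ hs0]; rw [pow_succ] at hb; linarith)
    have hmem : ∀ t ∈ Icc a b, t / s ∈ Icc (a / s) (b / s) := fun t ht =>
      ⟨by have := ht.1; gcongr, by have := ht.2; gcongr⟩
    have hst0 : s * t0 ∈ Icc a b := by
      constructor
      · have := ht0.1; rw [div_le_iff₀ hs0] at this; linarith
      · have := ht0.2; rw [le_div_iff₀ hs0] at this; linarith
    have hinteq : s * t0 ∈ Ioo a b → ∃ m, 1 ≤ m ∧ TP s m (s * t0) := by
      intro h
      obtain ⟨m, hm1, hm2⟩ := hm ⟨by rw [div_lt_iff₀ hs0]; linarith [h.1],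
        by rw [lt_div_iff₀ hs0]; linarith [h.2]⟩
      refine ⟨m + 1, by omega, ?_⟩
      unfold TP at hm2 ⊢
      rw [← hm2]; congr 1; rw [pow_succ]; field_simp
    have habs : ∀ t, |t / s - t0| * s = |t - s * t0| := by
      intro t
      have : t - s * t0 = (t / s - t0) * s := by field_simp
      rw [this, abs_mul, abs_of_pos hs0]
    by_cases hle : ∀ t ∈ Icc a b, ff s (t / s) ≤ 1 / 2
    · refine ⟨s * t0, s * e, σ, hσ, hst0, ?_, hinteq⟩
      intro t ht
      rw [ff_div hs, tent_left hs (hle t ht), hf _ (hmem t ht), ← habs]; ring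
    by_cases hge : ∀ t ∈ Icc a b, 1 / 2 ≤ ff s (t / s)
    · refine ⟨s * t0, s * (1 - e), -σ, by rcases hσ with h | h <;> simp [h], hst0, ?_, hinteq⟩
      intro t ht
      rw [ff_div hs, tent_right hs (hge t ht), hf _ (hmem t ht), ← habs]; ring
    push Not at hle hge
    obtain ⟨t2, ht2, hf2⟩ := hle
    obtain ⟨t1, ht1, hf1⟩ := hge
    have he : ff s t0 = e := by rw [hf t0 ht0]; simp
    have hno : t0 = a / s ∨ t0 = b / s := by
      by_contra hcon
      push Not at hcon
      obtain ⟨m, hm1, hm2⟩ := hm ⟨lt_of_le_of_ne ht0.1 (Ne.symm hcon.1), lt_of_le_of_ne ht0.2 hcon.2⟩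
      have h1 := hN.sep m hm1
      rw [← hm2.val0 hs] at h1
      have hA := ff_lip hs (t1 / s) t0
      have hB := ff_lip hs (t2 / s) t0
      have hA' : |t1 / s - t0| ≤ b / s - a / s := by
        rw [abs_le]; constructor <;> linarith [(hmem t1 ht1).1, (hmem t1 ht1).2, ht0.1, ht0.2]
      have hB' : |t2 / s - t0| ≤ b / s - a / s := by
        rw [abs_le]; constructor <;> linarith [(hmem t2 ht2).1, (hmem t2 ht2).2, ht0.1, ht0.2]
      have hA2 := abs_le.mp (hA.trans hA')
      have hB2 := abs_le.mp (hB.trans hB')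
      have : |ff s t0 - 1 / 2| < δ := by
        rw [abs_lt]; constructor <;> linarith
      linarith
    -- general crossing
    have key : ∀ ρ : ℝ, (ρ = 1 ∨ ρ = -1) →
        (∀ t ∈ Icc a b, ff s (t / s) = e + ρ * (t / s - t0)) →
        ∃ t0 e σ : ℝ, (σ = 1 ∨ σ = -1) ∧ t0 ∈ Icc a b ∧
        (∀ t ∈ Icc a b, ff s t = e + σ * |t - t0|) ∧ (t0 ∈ Ioo a b → ∃ m, 1 ≤ m ∧ TP s m t0) := by
      intro ρ hρ hlin
      have g1 := hlin t1 ht1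
      have g2 := hlin t2 ht2
      have hq : s * (t0 + ρ * (1 / 2 - e)) ∈ Icc a b := by
        have e1 := (hmem t1 ht1)
        have e2 := (hmem t2 ht2)
        have : t0 + ρ * (1 / 2 - e) ∈ Icc (a / s) (b / s) := by
          rcases hρ with h | h <;> rw [h] at g1 g2 ⊢ <;> constructor <;>
            linarith [e1.1, e1.2, e2.1, e2.2]
        constructor
        · have := this.1; rw [div_le_iff₀ hs0] at this; linarith
        · have := this.2; rw [le_div_iff₀ hs0] at this; linarith
      have hρ2 : ρ * ρ = 1 := by rcases hρ with h | h <;> rw [h] <;> norm_num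
      refine ⟨s * (t0 + ρ * (1 / 2 - e)), s / 2, -1, Or.inr rfl, hq, ?_, ?_⟩
      · intro t ht
        rw [ff_div hs, tent_abs hs, hlin t ht]
        have h3 : t - s * (t0 + ρ * (1 / 2 - e)) = s * ρ * (e + ρ * (t / s - t0) - 1 / 2) := by
          have : s * (t / s) = t := by field_simp
          linear_combination (-1 : ℝ) * this - s * (t / s - t0) * hρ2
        have h4 : |s * ρ| = s := by
          rcases hρ with h | h <;> rw [h] <;> simp [abs_of_pos hs0]
        rw [h3, abs_mul, h4]; ring
      · intro _
        refine ⟨1, le_rfl, ?_⟩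
        unfold TP
        rw [pow_one, hlin _ hq]
        have : s * (t0 + ρ * (1 / 2 - e)) / s = t0 + ρ * (1 / 2 - e) := by field_simp
        rw [this]
        linear_combination (1 / 2 - e) * hρ2
    rcases hno with h | h
    · refine key σ hσ fun t ht => ?_
      rw [hf _ (hmem t ht), abs_of_nonneg (by linarith [(hmem t ht).1])]
    · refine key (-σ) (by rcases hσ with h | h <;> simp [h]) fun t ht => ?_
      rw [hf _ (hmem t ht), abs_of_nonpos (by linarith [(hmem t ht).2])]; ring

lemma form {s δ : ℝ} (hs : 1 < s) (hN : NR s δ) (a b : ℝ) (hab : a ≤ b) (hd : b - a ≤ δ) :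
    ∃ t0 e σ : ℝ, (σ = 1 ∨ σ = -1) ∧ t0 ∈ Icc a b ∧
      (∀ t ∈ Icc a b, ff s t = e + σ * |t - t0|) ∧ (t0 ∈ Ioo a b → ∃ m, 1 ≤ m ∧ TP s m t0) := by
  obtain ⟨n, hn⟩ := exists_pow_bound hs b
  exact form_aux hs hN n a b hab hd hn

/-- near height `1/2` the height function is affine -/
lemma window {s δ : ℝ} (hs : 1 < s) (hN : NR s δ) (A : ℝ) (hA : |ff s A - 1 / 2| < δ / 2) :
    ∃ σ : ℝ, (σ = 1 ∨ σ = -1) ∧ ∀ B, |B - A| ≤ δ / 2 → ff s B = ff s A + σ * (B - A) := by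
  have hδ := hN.pos
  obtain ⟨t0, e, σ, hσ, ht0, hf, hm⟩ := form hs hN (A - δ / 2) (A + δ / 2) (by linarith) (by linarith)
  have hAm : A ∈ Icc (A - δ / 2) (A + δ / 2) := ⟨by linarith, by linarith⟩
  have hcase : t0 = A - δ / 2 ∨ t0 = A + δ / 2 := by
    by_contra hcon
    push Not at hcon
    obtain ⟨m, hm1, hm2⟩ := hm ⟨lt_of_le_of_ne ht0.1 (Ne.symm hcon.1), lt_of_le_of_ne ht0.2 hcon.2⟩
    have h1 := hN.sep m hm1
    rw [← hm2.val0 hs] at h1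
    have h2 := ff_lip hs t0 A
    have h3 : |t0 - A| ≤ δ / 2 := by rw [abs_le]; constructor <;> linarith [ht0.1, ht0.2]
    have h4 : |ff s t0 - 1 / 2| ≤ |ff s t0 - ff s A| + |ff s A - 1 / 2| := abs_sub_le _ _ _
    linarith
  rcases hcase with h | h
  · refine ⟨σ, hσ, fun B hB => ?_⟩
    rw [abs_le] at hB
    rw [hf A hAm, hf B ⟨by linarith, by linarith⟩, abs_of_nonneg (by linarith),
      abs_of_nonneg (by linarith)]; ring
  · refine ⟨-σ, by rcases hσ with h | h <;> simp [h], fun B hB => ?_⟩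
    rw [abs_le] at hB
    rw [hf A hAm, hf B ⟨by linarith, by linarith⟩, abs_of_nonpos (by linarith),
      abs_of_nonpos (by linarith)]; ring

/-- iterates of the tent map near the critical point -/
lemma tent_fold {s δ : ℝ} (hs : 1 < s) (hN : NR s δ) (m : ℕ) :
    ∃ σ : ℝ, (σ = 1 ∨ σ = -1) ∧ ∀ v : ℝ, s ^ m * |v| ≤ δ →
      (tent s)^[m + 1] (1 / 2 + v) = (tent s)^[m + 1] (1 / 2) + σ * (s ^ (m + 1) * |v|) := by
  induction m with
  | zero =>
    refine ⟨-1, Or.inr rfl, fun v _ => ?_⟩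
    simp only [zero_add, iterate_one, pow_one]
    rw [tent_abs hs, tent_abs hs]
    simp; ring
  | succ m ih =>
    obtain ⟨σ, hσ, h⟩ := ih
    have hsep := hN.sep (m + 1) (by omega)
    have hp : (0 : ℝ) < s ^ m := by positivity
    have hstep : ∀ v : ℝ, s ^ (m + 1) * |v| ≤ δ → s ^ m * |v| ≤ δ := by
      intro v hv
      refine le_trans ?_ hv
      rw [pow_succ]
      nlinarith [abs_nonneg v, mul_nonneg hp.le (abs_nonneg v)]
    have hσb : ∀ x : ℝ, 0 ≤ x → x ≤ δ → -δ ≤ σ * x ∧ σ * x ≤ δ := by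
      intro x h0 h1
      rcases hσ with h | h <;> rw [h] <;> constructor <;> linarith
    rcases le_total ((tent s)^[m + 1] (1 / 2)) (1 / 2) with hc | hc
    · rw [abs_of_nonpos (by linarith)] at hsep
      refine ⟨σ, hσ, fun v hv => ?_⟩
      have hb := hσb _ (by positivity) hv
      rw [iterate_succ_apply' (tent s) (m + 1), iterate_succ_apply' (tent s) (m + 1),
        h v (hstep v hv), tent_left hs hc, tent_left hs (by linarith [hb.2])]
      ring
    · rw [abs_of_nonneg (by linarith)] at hsep
      refine ⟨-σ, by rcases hσ with h | h <;> simp [h], fun v hv => ?_⟩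
      have hb := hσb _ (by positivity) hv
      rw [iterate_succ_apply' (tent s) (m + 1), iterate_succ_apply' (tent s) (m + 1),
        h v (hstep v hv), tent_right hs hc, tent_right hs (by linarith [hb.1])]
      ring

/-- symmetry at turning points -/
lemma TP.fold {s δ : ℝ} (hs : 1 < s) (hN : NR s δ) {m : ℕ} (hm : 1 ≤ m) {t : ℝ} (h : TP s m t)
    {v : ℝ} (hv : |v| ≤ δ / 2) : ff s (t + v) = ff s (t - v) := by
  have hδ := hN.pos
  have hp : (0 : ℝ) < s ^ m := by positivity
  have hp1 : (1 : ℝ) ≤ s ^ m := one_le_pow₀ hs.le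
  obtain ⟨σ, hσ, hw⟩ := window hs hN (t / s ^ m) (by
    unfold TP at h; rw [h]; simp; linarith)
  obtain ⟨k, rfl⟩ : ∃ k, m = k + 1 := ⟨m - 1, by omega⟩
  obtain ⟨τ, hτ, hf⟩ := tent_fold hs hN k
  have hk1 : (0 : ℝ) < s ^ k := by positivity
  have key : ∀ w : ℝ, |w| ≤ δ / 2 → ff s (t + w)
      = (tent s)^[k + 1] (1 / 2) + τ * (s ^ (k + 1) * (|w| / s ^ (k + 1))) := by
    intro w hw'
    rw [ff_div_pow hs (t + w) (k + 1), hw _ ?_]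
    · unfold TP at h
      rw [h, hf]
      · congr 3
        rw [add_div, add_sub_cancel_left, abs_mul, abs_div, abs_of_pos hp]
        rcases hσ with h | h <;> simp [h]
      · have e : |σ * ((t + w) / s ^ (k + 1) - t / s ^ (k + 1))| = |w| / s ^ (k + 1) := by
          rw [add_div, add_sub_cancel_left, abs_mul, abs_div, abs_of_pos hp]
          rcases hσ with h | h <;> simp [h]
        rw [e]
        have : s ^ k * (|w| / s ^ (k + 1)) = |w| / s := by rw [pow_succ]; field_simp
        rw [this]
        have := div_le_self (abs_nonneg w) hs.le
        linarith
    · rw [add_div, add_sub_cancel_left, abs_div, abs_of_pos hp]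
      have := div_le_self (abs_nonneg w) hp1
      linarith
  rw [key v hv, sub_eq_add_neg, key (-v) (by simpa using hv), abs_neg]

/-- turning points are separated -/
lemma TP.sep_lt {s δ : ℝ} (hs : 1 < s) (hN : NR s δ) {m m' : ℕ} (hmm : m < m') {t t' : ℝ}
    (h : TP s m t) (h' : TP s m' t') : δ ≤ |t - t'| := by
  have hp : (0 : ℝ) < s ^ m := by positivity
  have hp1 : (1 : ℝ) ≤ s ^ m := one_le_pow₀ hs.le
  have h1 := h'.val hs hmm.le
  have h2 := hN.sep (m' - m) (by omega)
  rw [← h1] at h2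
  have h3 := ff_lip hs (t' / s ^ m) (t / s ^ m)
  unfold TP at h
  rw [h, ← sub_div, abs_div, abs_of_pos hp] at h3
  have := div_le_self (abs_nonneg (t' - t)) hp1
  rw [abs_sub_comm]; linarith

lemma TP.eq_of_close {s δ : ℝ} (hs : 1 < s) (hN : NR s δ) {m m' : ℕ} {t t' : ℝ}
    (h : TP s m t) (h' : TP s m' t') (hc : |t - t'| < δ / 2) : t = t' := by
  have hδ := hN.pos
  rcases lt_trichotomy m m' with hlt | heq | hlt
  · linarith [h.sep_lt hs hN hlt h']
  · subst heq
    have hp : (0 : ℝ) < s ^ m := by positivity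
    have hp1 : (1 : ℝ) ≤ s ^ m := one_le_pow₀ hs.le
    unfold TP at h h'
    obtain ⟨σ, hσ, hw⟩ := window hs hN (t / s ^ m) (by rw [h]; simp; linarith)
    have := hw (t' / s ^ m) (by
      rw [← sub_div, abs_div, abs_of_pos hp, abs_sub_comm]
      have := div_le_self (abs_nonneg (t - t')) hp1
      linarith)
    rw [h, h'] at this
    have h5 : σ * (t' / s ^ m - t / s ^ m) = 0 := by linarith
    have h6 : t' / s ^ m - t / s ^ m = 0 := by
      rcases hσ with h | h <;> rw [h] at h5 <;> linarith
    rw [← sub_div, div_eq_zero_iff] at h6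
    rcases h6 with h6 | h6
    · linarith
    · exact absurd h6 hp.ne'
  · have := h'.sep_lt hs hN hlt h
    rw [abs_sub_comm] at this; linarith

end Basics

section Lift

lemma step1 {s δ : ℝ} (hs : 1 < s) (hN : NR s δ) {ε U x : ℝ} (hε : 0 < ε) (hεδ : 2 * ε < δ)
    (hU : 0 ≤ U) {a b : ℝ → ℝ} (hac : ContinuousOn a (Icc 0 U)) (hbc : ContinuousOn b (Icc 0 U))
    (ha0 : a 0 = x) (hb0 : b 0 = x) (hax : ∀ u ∈ Icc 0 U, x ≤ a u) (hbx : ∀ u ∈ Icc 0 U, b u ≤ x)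
    (hf : ∀ u ∈ Icc 0 U, |ff s (a u) - ff s (b u)| ≤ ε) (hab : 2 * ε ≤ a U - b U) :
    ∃ t0, |t0 - x| ≤ 2 * ε ∧ ∃ m, 1 ≤ m ∧ TP s m t0 := by
  have hmem : 2 * ε ∈ Icc ((fun u => a u - b u) 0) ((fun u => a u - b u) U) := by
    constructor
    · simp only [ha0, hb0]; linarith
    · exact hab
  obtain ⟨u, hu, hue⟩ := intermediate_value_Icc hU (hac.sub hbc) hmem
  have hue' : a u - b u = 2 * ε := hue
  obtain ⟨t0, e, σ, hσ, ht0, hform, hTP⟩ := form hs hN (b u) (a u) (by linarith) (by linarith)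
  have h1 := hform (a u) ⟨by linarith, le_rfl⟩
  have h2 := hform (b u) ⟨le_rfl, by linarith⟩
  have h3 := hf u hu
  have hx1 := hax u hu
  have hx2 := hbx u hu
  rw [abs_of_nonneg (by linarith [ht0.2])] at h1
  rw [abs_of_nonpos (by linarith [ht0.1])] at h2
  rw [h1, h2] at h3
  have h4 : |a u + b u - 2 * t0| ≤ ε := by
    have : e + σ * (a u - t0) - (e + σ * -(b u - t0)) = σ * (a u + b u - 2 * t0) := by ring
    rw [this, abs_mul] at h3
    rcases hσ with rfl | rfl <;> simpa using h3
  rw [abs_le] at h4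
  refine ⟨t0, ?_, hTP ⟨?_, ?_⟩⟩
  · rw [abs_le]; constructor <;> linarith [ht0.1, ht0.2]
  · linarith
  · linarith

lemma same_contra {w U e x0 x0' : ℝ} (he : 0 < e) (hwU : w ≤ U) {α β : ℝ → ℝ}
    (hα : ContinuousOn α (Icc w U)) (hβ : ContinuousOn β (Icc w U)) (hα0 : α w = 0) (hβ0 : β w = 0)
    (hαn : MonotoneOn α (Icc w U)) (hβn : MonotoneOn β (Icc w U))
    (h8 : 8 * e ≤ α U + β U)
    (hx1 : x0 ≤ -(1.5 * e)) (hx2 : -(2.5 * e) ≤ x0) (hx3 : 1.5 * e ≤ x0') (hx4 : x0' ≤ 2.5 * e)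
    (hF : ∀ u ∈ Icc w U, α u + β u ≤ 8 * e → |(|x0 + α u| - |x0' + β u|)| ≤ e) : False := by
  have hmem : 8 * e ∈ Icc ((fun u => α u + β u) w) ((fun u => α u + β u) U) := by
    constructor
    · simp only [hα0, hβ0]; linarith
    · exact h8
  obtain ⟨u, hu, hue⟩ := intermediate_value_Icc hwU (hα.add hβ) hmem
  have hue' : α u + β u = 8 * e := hue
  have hwm : w ∈ Icc w U := ⟨le_rfl, hwU⟩
  have ha := hαn hwm hu hu.1
  have hb := hβn hwm hu hu.1
  rw [hα0] at ha
  rw [hβ0] at hb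
  have h1 := hF u hu hue'.le
  have h2 : 0 ≤ x0 + α u := by
    by_contra hc
    push Not at hc
    rw [abs_of_neg hc, abs_of_pos (show 0 < x0' + β u by linarith), abs_le] at h1
    linarith [h1.1]
  have hsub : Icc w u ⊆ Icc w U := Icc_subset_Icc le_rfl hu.2
  obtain ⟨u3, hu3, hu3e⟩ := intermediate_value_Icc hu.1 (hα.mono hsub)
    (show -x0 ∈ Icc (α w) (α u) from ⟨by rw [hα0]; linarith, by linarith⟩)
  have hb3 := hβn hwm (hsub hu3) hu3.1
  have hb4 := hβn (hsub hu3) hu hu3.2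
  have ha4 := hαn (hsub hu3) hu hu3.2
  rw [hβ0] at hb3
  have h5 := hF u3 (hsub hu3) (by linarith)
  rw [hu3e, abs_of_pos (show 0 < x0' + β u3 by linarith)] at h5
  simp only [add_neg_cancel, abs_zero] at h5
  rw [abs_le] at h5
  linarith [h5.1]

lemma lift_core {U e : ℝ} (he : 0 < e) {X Y A B : ℝ → ℝ}
    (hA : MonotoneOn A (Icc 0 U)) (hB : AntitoneOn B (Icc 0 U))
    (hAc : ContinuousOn A (Icc 0 U)) (hBc : ContinuousOn B (Icc 0 U))
    (hXc : ContinuousOn X (Icc 0 U)) (hYc : ContinuousOn Y (Icc 0 U))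
    (hF1 : ∀ u ∈ Icc 0 U, A u ≤ A U - 20 * e → |(|X u| - |Y u|)| ≤ 4 * e)
    (hF2 : ∀ u ∈ Icc 0 U, |X u| ≤ 20 * e → |Y u| ≤ 20 * e → |(|X u| - |Y u|)| ≤ e)
    (h0 : |X 0 - Y 0| ≤ 4 * e)
    (hW : ∀ w ∈ Icc 0 U, |X w| ≤ 3 * e → |Y w| ≤ 3 * e → ∃ σ σ' : ℝ,
      (σ = 1 ∨ σ = -1) ∧ (σ' = 1 ∨ σ' = -1) ∧
      (∀ u ∈ Icc 0 U, |A u - A w| ≤ 100 * e → X u = X w + σ * (A u - A w)) ∧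
      (∀ u ∈ Icc 0 U, |B u - B w| ≤ 100 * e → Y u = Y w + σ' * (B w - B u)) ∧
      (12 * e ≤ A w - A 0 + (B 0 - B w) ∨ σ = σ')) :
    ∀ u ∈ Icc 0 U, A u ≤ A U - 20 * e → |X u - Y u| ≤ 4 * e := by
  intro u1 hu1 hu1N
  by_contra hcon
  push Not at hcon
  have hU : 0 ≤ U := hu1.1.trans hu1.2
  set D : ℝ → ℝ := fun u => |X u - Y u| with hD
  have hDc : ContinuousOn D (Icc 0 U) := (hXc.sub hYc).abs
  set V : Set ℝ := {u | u ∈ Icc 0 u1 ∧ 4 * e < D u} with hV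
  have hVne : V.Nonempty := ⟨u1, ⟨hu1.1, le_rfl⟩, hcon⟩
  have hVbd : BddBelow V := ⟨0, fun u hu => hu.1.1⟩
  set w := sInf V with hw
  have hw0 : 0 ≤ w := le_csInf hVne (fun u hu => hu.1.1)
  have hwu1 : w ≤ u1 := csInf_le hVbd ⟨⟨hu1.1, le_rfl⟩, hcon⟩
  have hwU : w ≤ U := hwu1.trans hu1.2
  have hwI : w ∈ Icc 0 U := ⟨hw0, hwU⟩
  have hbefore : ∀ u ∈ Icc 0 U, u < w → D u ≤ 4 * e := by
    intro u hu huw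
    by_contra hc
    push Not at hc
    have := csInf_le hVbd (show u ∈ V from ⟨⟨hu.1, by linarith⟩, hc⟩)
    linarith
  have hVsub : V ⊆ Icc 0 U := fun u hu => ⟨hu.1.1, hu.1.2.trans hu1.2⟩
  have hwcl : w ∈ closure V := csInf_mem_closure hVne hVbd
  haveI : (𝓝[V] w).NeBot := mem_closure_iff_nhdsWithin_neBot.mp hwcl
  have hXY : ∀ u ∈ V, X u * Y u ≤ 0 := by
    intro u hu
    by_contra hc
    push Not at hc
    have h1 := hF1 u (hVsub hu) ((hA (hVsub hu) hu1 hu.1.2).trans hu1N)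
    have h2 : 4 * e < |X u - Y u| := hu.2
    rcases pos_and_pos_or_neg_and_neg_of_mul_pos hc with ⟨p, q⟩ | ⟨p, q⟩
    · rw [abs_of_pos p, abs_of_pos q] at h1; linarith
    · rw [abs_of_neg p, abs_of_neg q] at h1
      have : |(-X u) - (-Y u)| = |X u - Y u| := by
        rw [← abs_neg]; congr 1; ring
      linarith
  have hXw : Tendsto X (𝓝[V] w) (𝓝 (X w)) := (hXc w hwI).mono_left (nhdsWithin_mono _ hVsub)
  have hYw : Tendsto Y (𝓝[V] w) (𝓝 (Y w)) := (hYc w hwI).mono_left (nhdsWithin_mono _ hVsub)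
  have hAw : Tendsto A (𝓝[V] w) (𝓝 (A w)) := (hAc w hwI).mono_left (nhdsWithin_mono _ hVsub)
  have hBw : Tendsto B (𝓝[V] w) (𝓝 (B w)) := (hBc w hwI).mono_left (nhdsWithin_mono _ hVsub)
  have hXYw : X w * Y w ≤ 0 := le_of_tendsto (hXw.mul hYw)
    (eventually_mem_nhdsWithin.mono hXY)
  have hDge : 4 * e ≤ |X w - Y w| := ge_of_tendsto ((hXw.sub hYw).abs)
    (eventually_mem_nhdsWithin.mono (fun u hu => (le_of_lt hu.2)))
  have hDle : |X w - Y w| ≤ 4 * e := by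
    rcases hw0.eq_or_lt with h | h
    · rw [← h]; exact h0
    · have hcl : w ∈ closure (Ico 0 w) := by
        rw [closure_Ico h.ne]; exact ⟨hw0, le_rfl⟩
      haveI : (𝓝[Ico 0 w] w).NeBot := mem_closure_iff_nhdsWithin_neBot.mp hcl
      have hsub : Ico 0 w ⊆ Icc 0 U := fun u hu => ⟨hu.1, hu.2.le.trans hwU⟩
      have : Tendsto D (𝓝[Ico 0 w] w) (𝓝 (D w)) := (hDc w hwI).mono_left (nhdsWithin_mono _ hsub)
      exact le_of_tendsto this
        (eventually_mem_nhdsWithin.mono (fun u hu => hbefore u (hsub hu) hu.2))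
  have hDe : |X w - Y w| = 4 * e := le_antisymm hDle hDge
  have hsum : |X w| + |Y w| = 4 * e := by
    rw [← hDe]
    rcases le_total 0 (X w) with p | p <;> rcases le_total 0 (Y w) with q | q
    · rcases mul_eq_zero.mp (le_antisymm hXYw (mul_nonneg p q)) with h | h <;> rw [h] <;> simp
    · rw [abs_of_nonneg p, abs_of_nonpos q, abs_of_nonneg (by linarith)]; ring
    · rw [abs_of_nonpos p, abs_of_nonneg q, abs_of_nonpos (by linarith)]; ring
    · rcases mul_eq_zero.mp (le_antisymm hXYw (mul_nonneg_of_nonpos_of_nonpos p q)) with h | h <;> rw [h] <;> simp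
  have hab1 := abs_nonneg (X w)
  have hab2 := abs_nonneg (Y w)
  have hdiff := hF2 w hwI (by linarith) (by linarith)
  rw [abs_le] at hdiff
  have hX1 : 1.5 * e ≤ |X w| := by linarith
  have hX2 : |X w| ≤ 2.5 * e := by linarith
  have hY1 : 1.5 * e ≤ |Y w| := by linarith
  have hY2 : |Y w| ≤ 2.5 * e := by linarith
  obtain ⟨σ, σ', hσ, hσ', hWX, hWY, hcase⟩ := hW w hwI (by linarith) (by linarith)
  have hwN : A w ≤ A U - 20 * e := (hA hwI hu1 hwu1).trans hu1N
  have hUI : U ∈ Icc 0 U := ⟨hU, le_rfl⟩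
  have hsubw : Icc w U ⊆ Icc 0 U := Icc_subset_Icc hw0 le_rfl
  have hαc : ContinuousOn (fun u => A u - A w) (Icc w U) := (hAc.mono hsubw).sub continuousOn_const
  have hβc : ContinuousOn (fun u => B w - B u) (Icc w U) := continuousOn_const.sub (hBc.mono hsubw)
  have hαm : MonotoneOn (fun u => A u - A w) (Icc w U) := fun u hu v hv huv => by
    have := hA (hsubw hu) (hsubw hv) huv
    simp only; linarith
  have hβm : MonotoneOn (fun u => B w - B u) (Icc w U) := fun u hu v hv huv => by
    have := hB (hsubw hu) (hsubw hv) huv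
    simp only; linarith
  by_cases hss : σ = σ'
  · -- same direction
    have hBU := hB hwI hUI hwU
    have key : ∀ u ∈ Icc w U, (A u - A w) + (B w - B u) ≤ 8 * e →
        |(|σ * X w + (A u - A w)| - |σ * Y w + (B w - B u)|)| ≤ e := by
      intro u hu hle
      have p1 := hA hwI (hsubw hu) hu.1
      have p2 := hB hwI (hsubw hu) hu.1
      have q1 := hWX u (hsubw hu) (by rw [abs_le]; constructor <;> linarith)
      have q2 := hWY u (hsubw hu) (by rw [abs_le]; constructor <;> linarith)
      rw [← hss] at q2
      have r1 : |X u| = |σ * X w + (A u - A w)| := by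
        rw [q1]
        rcases hσ with h | h
        · rw [h]; simp
        · rw [h, ← abs_neg]; congr 1; ring
      have r2 : |Y u| = |σ * Y w + (B w - B u)| := by
        rw [q2]
        rcases hσ with h | h
        · rw [h]; simp
        · rw [h, ← abs_neg]; congr 1; ring
      rw [← r1, ← r2]
      have hsx : |σ| = 1 := by rcases hσ with h | h <;> rw [h] <;> simp
      have z1 : |X u| ≤ |X w| + |A u - A w| := by
        rw [q1]; refine (abs_add_le _ _).trans ?_; rw [abs_mul, hsx, one_mul]
      have z2 : |Y u| ≤ |Y w| + |B w - B u| := by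
        rw [q2]; refine (abs_add_le _ _).trans ?_; rw [abs_mul, hsx, one_mul]
      rw [abs_of_nonneg (by linarith : 0 ≤ A u - A w)] at z1
      rw [abs_of_nonneg (by linarith : 0 ≤ B w - B u)] at z2
      exact hF2 u (hsubw hu) (by linarith) (by linarith)
    have hsXa : |σ * X w| = |X w| := by
      rw [abs_mul]; rcases hσ with h | h <;> rw [h] <;> simp
    have hsYa : |σ * Y w| = |Y w| := by
      rw [abs_mul]; rcases hσ with h | h <;> rw [h] <;> simp
    have hprod : (σ * X w) * (σ * Y w) ≤ 0 := by
      have : (σ * X w) * (σ * Y w) = σ * σ * (X w * Y w) := by ring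
      rw [this]; rcases hσ with h | h <;> rw [h] <;> linarith
    rw [← hsXa] at hX1 hX2
    rw [← hsYa] at hY1 hY2
    generalize σ * X w = x0 at *
    generalize σ * Y w = x0' at *
    rcases le_total 0 x0 with p | p
    · have q : x0' ≤ 0 := by
        by_contra hc; push Not at hc
        rw [abs_of_nonneg p] at hX1
        nlinarith
      rw [abs_of_nonneg p] at hX1 hX2
      rw [abs_of_nonpos q] at hY1 hY2
      refine same_contra he hwU hβc hαc (by simp) (by simp) hβm hαm ?_ (x0 := x0') (x0' := x0)
        (by linarith) (by linarith) hX1 hX2 ?_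
      · linarith
      · intro u hu hle
        rw [abs_sub_comm]
        exact key u hu (by linarith)
    · have q : 0 ≤ x0' := by
        by_contra hc; push Not at hc
        rw [abs_of_nonpos p] at hX1
        nlinarith
      rw [abs_of_nonpos p] at hX1 hX2
      rw [abs_of_nonneg q] at hY1 hY2
      refine same_contra he hwU hαc hβc (by simp) (by simp) hαm hβm ?_ (x0 := x0) (x0' := x0')
        (by linarith) (by linarith) hY1 hY2 ?_
      · linarith
      · intro u hu hle
        exact key u hu (by linarith)
  · -- opposite direction
    have hσ'e : σ' = -σ := by
      rcases hσ with h | h <;> rcases hσ' with h' | h'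
      · exact absurd (h.trans h'.symm) hss
      · rw [h, h']
      · rw [h, h']; ring
      · exact absurd (h.trans h'.symm) hss
    have hdir : ∀ u ∈ Icc 0 U, |A u - A w| ≤ 100 * e → |B u - B w| ≤ 100 * e →
        X u - Y u = X w - Y w + σ * ((A u - A w) + (B w - B u)) := by
      intro u hu h1 h2
      rw [hWX u hu h1, hWY u hu h2, hσ'e]; ring
    have h4 : X w - Y w = σ * (4 * e) ∨ X w - Y w = -(σ * (4 * e)) := by
      rcases abs_choice (X w - Y w) with h | h <;> rcases hσ with g | g <;> rw [g] <;>
        rw [hDe] at h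
      · left; linarith
      · right; linarith
      · right; linarith
      · left; linarith
    rcases h4 with h4 | h4
    · -- go backwards
      have h12 : 12 * e ≤ A w - A 0 + (B 0 - B w) := by
        rcases hcase with h | h
        · exact h
        · exact absurd h hss
      have hsub0 : Icc 0 w ⊆ Icc 0 U := Icc_subset_Icc le_rfl hwU
      have hcont : ContinuousOn (fun u => (A u - A w) + (B w - B u)) (Icc 0 w) :=
        ((hAc.mono hsub0).sub continuousOn_const).add (continuousOn_const.sub (hBc.mono hsub0))
      obtain ⟨u, hu, hue⟩ := intermediate_value_Icc hw0 hcont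
        (show -(12 * e) ∈ Icc _ _ from ⟨by linarith, by linarith⟩)
      simp only at hue
      have p1 := hA (hsub0 hu) hwI hu.2
      have p2 := hB (hsub0 hu) hwI hu.2
      have hd := hdir u (hsub0 hu) (by rw [abs_le]; constructor <;> linarith)
        (by rw [abs_le]; constructor <;> linarith)
      have huw : u < w := by
        rcases hu.2.eq_or_lt with h | h
        · rw [h] at hue; linarith
        · exact h
      have hb := hbefore u (hsub0 hu) huw
      simp only [hD] at hb
      rw [hd, h4, hue, abs_le] at hb
      rcases hσ with g | g <;> rw [g] at hb <;> linarith [hb.1, hb.2]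
    · have hev : ∀ᶠ u in 𝓝[V] w, |A u - A w| < e ∧ |B u - B w| < e := by
        have h1 := (tendsto_iff_norm_sub_tendsto_zero.mp hAw).eventually (gt_mem_nhds he)
        have h2 := (tendsto_iff_norm_sub_tendsto_zero.mp hBw).eventually (gt_mem_nhds he)
        exact h1.and h2
      obtain ⟨u, ⟨h1, h2⟩, huV⟩ := (hev.and eventually_mem_nhdsWithin).exists
      have hwu : w ≤ u := csInf_le hVbd huV
      have hd := hdir u (hVsub huV) (by linarith) (by linarith)
      have hb : 4 * e < |X u - Y u| := huV.2
      have p1 := hA hwI (hVsub huV) hwu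
      have p2 := hB hwI (hVsub huV) hwu
      rw [abs_lt] at h1 h2
      rw [hd, h4] at hb
      have : |(-(σ * (4 * e)) + σ * (A u - A w + (B w - B u)))| ≤ 4 * e := by
        rw [abs_le]
        rcases hσ with g | g <;> rw [g] <;> constructor <;> linarith
      linarith

lemma window_agree {s d A1 A2 σ1 σ2 : ℝ} (hd : 0 < d) (hc : |A1 - A2| ≤ d / 2)
    (h1 : ∀ B, |B - A1| ≤ d → ff s B = ff s A1 + σ1 * (B - A1))
    (h2 : ∀ B, |B - A2| ≤ d → ff s B = ff s A2 + σ2 * (B - A2)) : σ1 = σ2 := by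
  have e1 := h1 (A1 + d / 2) (by rw [add_sub_cancel_left, abs_of_pos] <;> linarith)
  have e2 := h2 (A1 + d / 2) (by
    rw [abs_le] at *; constructor <;> linarith)
  have e3 := h2 A1 (by linarith)
  rw [e1, e3] at e2
  have : (σ1 - σ2) * (d / 2) = 0 := by linarith
  rcases mul_eq_zero.mp this with h | h <;> linarith

theorem lift {s δ : ℝ} (hs : 1 < s) (hN : NR s δ) {ε U y : ℝ} {j : ℕ} (hε : 0 < ε)
    (hεδ : 200 * ε ≤ δ) {a b : ℝ → ℝ}
    (ha : MonotoneOn a (Icc 0 U)) (hb : AntitoneOn b (Icc 0 U))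
    (hac : ContinuousOn a (Icc 0 U)) (hbc : ContinuousOn b (Icc 0 U))
    (hab : a 0 = b 0) (hay : |a 0 - y| ≤ 2 * ε) (hj : 1 ≤ j) (hy : TP s j y)
    (hf : ∀ u ∈ Icc 0 U, |ff s (a u) - ff s (b u)| ≤ ε) :
    ∀ u ∈ Icc 0 U, a u ≤ a U - 20 * ε →
      (∀ m, m < j → |ff s (a u / s ^ m) - ff s (b u / s ^ m)| ≤ 4 * (ε / s ^ m)) ∧
      |ff s (a u / s ^ j) + ff s (b u / s ^ j) - 1| ≤ 4 * (ε / s ^ j) := by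
  have hs0 : 0 < s := by linarith
  -- key step
  have key : ∀ m, 1 ≤ m → m ≤ j → ∀ η : ℝ, (m < j ∧ η = 1 ∨ m = j ∧ η = -1) →
      (∀ u ∈ Icc 0 U, a u ≤ a U - 20 * ε →
        |ff s (a u / s ^ (m-1)) - ff s (b u / s ^ (m-1))| ≤ 4 * (ε / s ^ (m-1))) →
      ∀ u ∈ Icc 0 U, a u ≤ a U - 20 * ε →
        |(ff s (a u / s ^ m) - 1 / 2) - η * (ff s (b u / s ^ m) - 1 / 2)| ≤ 4 * (ε / s ^ m) := by
    intro m hm hmj η hη ih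
    obtain ⟨m, rfl⟩ : ∃ n, m = n + 1 := ⟨m - 1, by omega⟩
    simp only [Nat.add_sub_cancel] at ih
    set S := s ^ (m + 1) with hS
    have hSpos : 0 < S := pow_pos hs0 _
    have hS1 : 1 ≤ S := one_le_pow₀ hs.le
    set e := ε / S with he
    have hepos : 0 < e := div_pos hε hSpos
    have heε : e ≤ ε := div_le_self hε.le hS1
    have hηabs : |η| = 1 := by rcases hη with ⟨_, h⟩ | ⟨_, h⟩ <;> rw [h] <;> simp
    have hYabs : ∀ z : ℝ, |η * z| = |z| := fun z => by rw [abs_mul, hηabs, one_mul]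
    have hAc : ContinuousOn (fun u => a u / S) (Icc 0 U) := hac.div_const S
    have hBc : ContinuousOn (fun u => b u / S) (Icc 0 U) := hbc.div_const S
    have hmain := lift_core (U := U) (e := e) hepos
      (X := fun u => ff s (a u / S) - 1 / 2) (Y := fun u => η * (ff s (b u / S) - 1 / 2))
      (A := fun u => a u / S) (B := fun u => b u / S)
      (fun u hu v hv huv => by
        have := ha hu hv huv
        simp only; gcongr)
      (fun u hu v hv huv => by
        have := hb hu hv huv
        simp only; gcongr)
      hAc hBc (((ff_continuous hs).comp_continuousOn hAc).sub continuousOn_const)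
      ((((ff_continuous hs).comp_continuousOn hBc).sub continuousOn_const).const_smul η)
      ?_ ?_ ?_ ?_
    · intro u hu huN
      refine hmain u hu ?_
      have h1 : a u / S ≤ (a U - 20 * ε) / S := by gcongr
      have h2 : (a U - 20 * ε) / S = a U / S - 20 * e := by rw [he]; field_simp
      linarith
    · intro u hu huN
      have huN' : a u ≤ a U - 20 * ε := by
        simp only [he] at huN
        have : a u / S ≤ (a U - 20 * ε) / S := by
          have h2 : (a U - 20 * ε) / S = a U / S - 20 * (ε / S) := by field_simp
          rw [h2]; exact huN
        exact (div_le_div_iff_of_pos_right hSpos).mp this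
      have h1 := ih u hu huN'
      simp only [hYabs]
      rw [ff_div_succ hs, ff_div_succ hs (b u), tent_abs hs, tent_abs hs] at h1
      have h2 : s * (1 / 2 - |ff s (a u / s ^ (m + 1)) - 1 / 2|) -
        s * (1 / 2 - |ff s (b u / s ^ (m + 1)) - 1 / 2|) = -(s * (|ff s (a u / S) - 1 / 2| - |ff s (b u / S) - 1 / 2|)) := by
        rw [hS]; ring
      rw [h2, abs_neg, abs_mul, abs_of_pos hs0] at h1
      have h3 : 4 * (ε / s ^ m) = s * (4 * e) := by rw [he, hS, pow_succ]; field_simp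
      rw [h3] at h1
      exact le_of_mul_le_mul_left h1 hs0
    · intro u hu hx hy'
      simp only [hYabs] at hy' ⊢
      obtain ⟨ν, hν, hfold⟩ := tent_fold hs hN m
      have hSm : s ^ m ≤ S := by rw [hS]; exact pow_le_pow_right₀ hs.le (by omega)
      have hsz : ∀ v : ℝ, |v| ≤ 20 * e → s ^ m * |v| ≤ δ := by
        intro v hv
        calc s ^ m * |v| ≤ S * (20 * e) := by gcongr
          _ = 20 * ε := by rw [he]; field_simp
          _ ≤ δ := by linarith
      have h1 := hfold _ (hsz _ hx)
      have h2 := hfold _ (hsz _ hy')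
      rw [add_sub_cancel, ← ff_div_pow hs (a u) (m+1)] at h1
      rw [add_sub_cancel, ← ff_div_pow hs (b u) (m+1)] at h2
      have h3 := hf u hu
      rw [h1, h2] at h3
      have h4 : ∀ p q r : ℝ, r + ν * (S * p) - (r + ν * (S * q)) = ν * (S * (p - q)) := by
        intros; ring
      rw [h4, abs_mul, abs_mul, abs_of_pos hSpos,
        show |ν| = 1 by rcases hν with h | h <;> rw [h] <;> simp, one_mul] at h3
      rw [he, le_div_iff₀ hSpos, mul_comm]
      exact h3
    · rw [← hab]
      rcases hη with ⟨_, h⟩ | ⟨h', h⟩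
      · rw [h]; simp; linarith
      · rw [h]
        have h1 : |ff s (a 0 / S) - 1 / 2| ≤ 2 * e := by
          have h2 : ff s (y / S) = 1 / 2 := by rw [hS, h']; exact hy
          rw [← h2]
          refine (ff_lip hs _ _).trans ?_
          rw [← sub_div, abs_div, abs_of_pos hSpos, he, ← mul_div_assoc]
          gcongr
        have h3 : ff s (a 0 / S) - 1 / 2 - -1 * (ff s (a 0 / S) - 1 / 2) = 2 * (ff s (a 0 / S) - 1 / 2) := by ring
        rw [h3, abs_mul, abs_two]; linarith
    · intro w hw hx hy'
      simp only [hYabs] at hy'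
      have hxx : |ff s (a w / S) - 1 / 2| < δ / 2 := by linarith
      have hyy : |ff s (b w / S) - 1 / 2| < δ / 2 := by linarith
      obtain ⟨σ, hσ, hwin⟩ := window hs hN _ hxx
      obtain ⟨τ, hτ, hwin'⟩ := window hs hN _ hyy
      refine ⟨σ, -(η * τ), hσ, ?_, ?_, ?_, ?_⟩
      · rcases hη with ⟨_, h⟩ | ⟨_, h⟩ <;> rcases hτ with g | g <;> rw [h, g] <;> simp
      · intro u hu h1
        have := hwin _ (h1.trans (by linarith))
        rw [this]; ring
      · intro u hu h1
        have := hwin' _ (h1.trans (by linarith))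
        rw [this]; ring
      · by_contra hcon
        push Not at hcon
        obtain ⟨hc1, hc2⟩ := hcon
        have h0I : (0:ℝ) ∈ Icc 0 U := ⟨le_rfl, hw.1.trans hw.2⟩
        have m1 : a 0 / S ≤ a w / S := by have := ha h0I hw hw.1; gcongr
        have m2 : b w / S ≤ b 0 / S := by have := hb h0I hw hw.1; gcongr
        have m3 : |a 0 / S - y / S| ≤ 2 * e := by
          rw [← sub_div, abs_div, abs_of_pos hSpos, he, ← mul_div_assoc]; gcongr
        have m4 : a 0 / S = b 0 / S := by rw [hab]
        have n1 : |a w / S - y / S| ≤ 14 * e := by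
          rw [abs_le] at *; constructor <;> linarith
        have n2 : |b w / S - y / S| ≤ 14 * e := by
          rw [abs_le] at *; constructor <;> linarith
        rcases hη with ⟨h', h⟩ | ⟨h', h⟩
        · have v := hy.val hs (i := m + 1) (by omega)
          have v2 := hN.sep (j - (m + 1)) (by omega)
          rw [← v] at v2
          have l := ff_lip hs (y / s ^ (m + 1)) (a w / S)
          rw [abs_sub_comm (y / s ^ (m+1))] at l
          have : |ff s (y / s ^ (m + 1)) - 1 / 2| ≤ |ff s (y / s ^ (m + 1)) - ff s (a w / S)| + |ff s (a w / S) - 1 / 2| := abs_sub_le _ _ _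
          linarith
        · have hyS : ff s (y / S) = 1 / 2 := by rw [hS, h']; exact hy
          obtain ⟨ρ, hρ, hwy⟩ := window hs hN (y / S) (by rw [hyS]; simp; linarith [hN.pos])
          have g1 := window_agree (by linarith [hN.pos]) (n1.trans (by linarith)) hwin hwy
          have g2 := window_agree (by linarith [hN.pos]) (n2.trans (by linarith)) hwin' hwy
          apply hc2
          rw [h, g1, g2]; ring
  have hlow : ∀ m, m < j → ∀ u ∈ Icc 0 U, a u ≤ a U - 20 * ε →
      |ff s (a u / s ^ m) - ff s (b u / s ^ m)| ≤ 4 * (ε / s ^ m) := by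
    intro m
    induction m with
    | zero => intro _ u hu _; have := hf u hu; simp; linarith
    | succ m ih =>
      intro hmj u hu huN
      have := key (m + 1) (by omega) hmj.le 1 (Or.inl ⟨hmj, rfl⟩) (by simpa using ih (by omega)) u hu huN
      rw [one_mul] at this
      convert this using 2; ring
  intro u hu huN
  refine ⟨fun m hm => hlow m hm u hu huN, ?_⟩
  have := key j hj le_rfl (-1) (Or.inr ⟨rfl, rfl⟩) (hlow (j-1) (by omega)) u hu huN
  convert this using 2; ring

end Lift

section MainReal

/-- salient points -/
def sk (s : ℝ) (k : ℕ) : ℝ := s ^ k / 2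

lemma sk_pos {s : ℝ} (hs : 1 < s) (k : ℕ) : 0 < sk s k := by
  unfold sk; have := pow_pos (by linarith : 0 < s) k; linarith

lemma sk_succ {s : ℝ} (k : ℕ) : sk s (k + 1) = s * sk s k := by
  unfold sk; rw [pow_succ]; ring

lemma sk_ge {s : ℝ} (hs : 1 < s) (k : ℕ) : 1 / 2 ≤ sk s k := by
  unfold sk; have := one_le_pow₀ hs.le (n := k); linarith

lemma sk_mono {s : ℝ} (hs : 1 < s) : Monotone (sk s) := by
  intro k l hkl
  unfold sk; have := pow_le_pow_right₀ hs.le hkl; linarith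

lemma sk_TP {s : ℝ} (hs : 1 < s) (k : ℕ) : TP s k (sk s k) := by
  unfold TP sk
  have : s ^ k / 2 / s ^ k = 1 / 2 := by
    have := pow_pos (by linarith : 0 < s) k; field_simp
  rw [this, ff_id hs (by linarith)]

lemma sk_unbounded {s : ℝ} (hs : 1 < s) (t : ℝ) : ∃ k, 1 ≤ k ∧ t ≤ sk s k := by
  obtain ⟨k, hk⟩ := exists_pow_bound hs t
  refine ⟨k + 1, by omega, ?_⟩
  unfold sk; rw [pow_succ]; linarith

/-- reflection about a salient point -/
lemma reflect {s : ℝ} (hs : 1 < s) {k i : ℕ} (hik : i < k) {v : ℝ} (hv0 : 0 ≤ v)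
    (hv : v ≤ (s - 1) * sk s k) : ff s ((sk s k + v) / s ^ i) = ff s ((sk s k - v) / s ^ i) := by
  have hp : 0 < s ^ k := pow_pos (by linarith) k
  have h1 : ∀ x, (x / s ^ k ≤ s / 2) → ff s (x / s ^ (k - 1)) = s * (1 / 2 - |x / s ^ k - 1 / 2|) := by
    intro x hx
    have := ff_div_succ hs x (k - 1)
    rw [Nat.sub_add_cancel (by omega)] at this
    rw [this, ff_id hs hx, tent_abs hs]
  have h3 : sk s k / s ^ k = 1 / 2 := by unfold sk; field_simp
  have h4 : v / s ^ k ≤ (s - 1) / 2 := by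
    calc v / s ^ k ≤ (s - 1) * sk s k / s ^ k := by gcongr
      _ = (s - 1) / 2 := by rw [mul_div_assoc, h3]; ring
  have h5 : 0 ≤ v / s ^ k := by positivity
  have h2 : ff s ((sk s k + v) / s ^ (k - 1)) = ff s ((sk s k - v) / s ^ (k - 1)) := by
    rw [h1 _ (by rw [add_div, h3]; linarith), h1 _ (by rw [sub_div, h3]; linarith), add_div, sub_div, h3]
    rw [show 1 / 2 - v / s ^ k - 1 / 2 = -(1 / 2 + v / s ^ k - 1 / 2) by ring, abs_neg]
  rw [ff_div_le hs _ (show i ≤ k - 1 by omega), h2, ← ff_div_le hs _ (show i ≤ k - 1 by omega)]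

/-- data of the main real theorem -/
structure MD (s δ κ L : ℝ) (H : ℝ → ℝ) : Prop where
  mono : StrictMono H
  cont : Continuous H
  zero : H 0 = 0
  surj : ∀ z, 0 ≤ z → ∃ t, 0 ≤ t ∧ H t = z
  kpos : 0 < κ
  D1 : ∀ t t', 0 ≤ t → 0 ≤ t' → |H t - H t'| ≤ κ → |t - t'| < δ / 4
  D2 : ∀ t m, 0 ≤ t → 1 ≤ m → TP s m (H t) → ∃ τ m', 1 ≤ m' ∧ TP s m' τ ∧ |t - τ| ≤ δ / 4
  D3 : ∀ ε > 0, ∃ q : ℕ, ∀ t t', 0 ≤ t → 0 ≤ t' → ff s (t / s ^ q) = ff s (t' / s ^ q) →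
    |ff s (H t) - ff s (H t')| ≤ ε
  Lpos : 0 < L
  D4 : ∀ t t', 0 ≤ t → 0 ≤ t' → |H t - H t'| ≤ L * (|t - t'| + 1)

/-- fixed epsilon -/
structure ME (s δ κ L : ℝ) (H : ℝ → ℝ) (ε : ℝ) (q : ℕ) : Prop extends MD s δ κ L H where
  epos : 0 < ε
  ek : 100 * ε ≤ κ
  ed : 200 * ε ≤ δ
  es : 100 * ε ≤ (s - 1) * (2 - s)
  hq : ∀ t t', 0 ≤ t → 0 ≤ t' → ff s (t / s ^ q) = ff s (t' / s ^ q) →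
    |ff s (H t) - ff s (H t')| ≤ ε

lemma MD.far {s δ κ L : ℝ} {H : ℝ → ℝ} (hM : MD s δ κ L H) {t t' : ℝ} (h0 : 0 ≤ t)
    (htt : t + δ / 4 ≤ t') (hd : 0 < δ) : H t + κ < H t' := by
  by_contra hc
  push Not at hc
  have h1 := hM.mono (show t < t' by linarith)
  have := hM.D1 t t' h0 (by linarith) (by rw [abs_le]; constructor <;> linarith)
  rw [abs_lt] at this
  linarith [this.1]

lemma ME.mt1 {s δ κ L : ℝ} {H : ℝ → ℝ} {ε : ℝ} {q : ℕ} (hs : 1 < s) (hN : NR s δ)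
    (hM : ME s δ κ L H ε q) {m : ℕ} {τ : ℝ} (hm : q + 1 ≤ m) (hτ : TP s m τ) :
    ∃ y, |y - H τ| ≤ 2 * ε ∧ ∃ n, 1 ≤ n ∧ TP s n y := by
  have hδ := hN.pos
  have hδ4 := hN.le
  have hε := hM.epos
  have hed := hM.ed
  have hτ1 : 1 / 2 ≤ τ := by
    have := hτ.lower hs
    have := one_le_pow₀ hs.le (n := m); linarith
  have hfold : ∀ v ∈ Icc 0 (δ / 2), ff s ((τ + v) / s ^ q) = ff s ((τ - v) / s ^ q) := by
    intro v hv
    have hp : 0 < s ^ q := pow_pos (by linarith) q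
    have h1 : TP s (m - q) (τ / s ^ q) := by
      unfold TP at *
      rw [div_div, ← pow_add, show q + (m - q) = m by omega]; exact hτ
    rw [add_div, sub_div]
    apply h1.fold hs hN (by omega)
    rw [abs_of_nonneg (by have := hv.1; positivity)]
    exact (div_le_self hv.1 (one_le_pow₀ hs.le)).trans hv.2
  refine step1 hs hN (U := δ / 2) (x := H τ) hε (by linarith) (by linarith)
    (a := fun v => H (τ + v)) (b := fun v => H (τ - v)) ?_ ?_ (by simp) (by simp) ?_ ?_ ?_ ?_
  · exact (hM.cont.comp (continuous_const.add continuous_id)).continuousOn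
  · exact (hM.cont.comp (continuous_const.sub continuous_id)).continuousOn
  · intro u hu; exact hM.mono.monotone (by linarith [hu.1])
  · intro u hu; exact hM.mono.monotone (by linarith [hu.1])
  · intro u hu
    exact hM.hq _ _ (by linarith [hu.1]) (by linarith [hu.2]) (hfold u hu)
  · have := hM.far (t := τ - δ / 2) (t' := τ + δ / 2) (by linarith) (by linarith) hδ
    have := hM.ek
    linarith

/-- LIFT at a salient point -/
lemma ME.liftk {s δ κ L : ℝ} {H : ℝ → ℝ} {ε : ℝ} {q : ℕ} (hs : 1 < s) (hs2 : s < 2) (hN : NR s δ)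
    (hM : ME s δ κ L H ε q) {k j : ℕ} {y : ℝ} (hk : q + 1 ≤ k) (hj : 1 ≤ j) (hy : TP s j y)
    (hyH : |y - H (sk s k)| ≤ 2 * ε) :
    ∀ u ∈ Icc 0 ((s - 1) * sk s k), H (sk s k + u) ≤ H (sk s (k + 1)) - 20 * ε →
      (∀ m, m < j → |ff s (H (sk s k + u) / s ^ m) - ff s (H (sk s k - u) / s ^ m)| ≤ 4 * (ε / s ^ m)) ∧
      |ff s (H (sk s k + u) / s ^ j) + ff s (H (sk s k - u) / s ^ j) - 1| ≤ 4 * (ε / s ^ j) := by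
  have hsk := sk_pos hs k
  have hU : sk s k + (s - 1) * sk s k = sk s (k + 1) := by rw [sk_succ]; ring
  have hmain := lift hs hN (U := (s - 1) * sk s k) hM.epos hM.ed
    (a := fun v => H (sk s k + v)) (b := fun v => H (sk s k - v)) (y := y) (j := j)
    (fun u _ v _ huv => hM.mono.monotone (by linarith))
    (fun u _ v _ huv => hM.mono.monotone (by linarith))
    (hM.cont.comp (continuous_const.add continuous_id)).continuousOn
    (hM.cont.comp (continuous_const.sub continuous_id)).continuousOn
    (by simp) (by simp only [add_zero]; rw [abs_sub_comm]; exact hyH) hj hy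
    (fun u hu => hM.hq _ _ (by linarith [hu.1]) (by nlinarith [hu.2]) (reflect hs (by omega) hu.1 hu.2))
  simp only [hU] at hmain
  exact hmain

lemma reflect_far {s δ : ℝ} (hs : 1 < s) (hN : NR s δ) {k m : ℕ} (hm : 1 ≤ m)
    {τ : ℝ} (hτ : TP s m τ) : δ ≤ |τ - (2 - s) * sk s k| := by
  have hδh := hN.le_half hs
  have hsk := sk_ge hs k
  rcases lt_or_ge m k with hmk | hmk
  · have h1 := reflect hs hmk (v := (s - 1) * sk s k) (by nlinarith) le_rfl
    rw [show sk s k + (s - 1) * sk s k = sk s (k + 1) by rw [sk_succ]; ring,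
      show sk s k - (s - 1) * sk s k = (2 - s) * sk s k by ring,
      (sk_TP hs (k + 1)).val hs (show m ≤ k + 1 by omega)] at h1
    have h2 := hN.sep (k + 1 - m) (by omega)
    rw [h1, ← show ff s (τ / s ^ m) = 1 / 2 from hτ] at h2
    refine h2.trans ((ff_lip hs _ _).trans ?_)
    have hp : 1 ≤ s ^ m := one_le_pow₀ hs.le
    rw [← sub_div, abs_div, abs_of_pos (by linarith : 0 < s ^ m), abs_sub_comm]
    exact div_le_self (abs_nonneg _) hp
  · have h1 := hτ.lower hs
    have h2 : sk s k ≤ sk s m := sk_mono hs hmk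
    have h3 : sk s m = s ^ m / 2 := rfl
    refine le_trans ?_ (le_abs_self _)
    nlinarith

/-- existence of the near end parameter -/
lemma ME.near_end {s δ κ L : ℝ} {H : ℝ → ℝ} {ε : ℝ} {q : ℕ} (hs : 1 < s) (hN : NR s δ)
    (hM : ME s δ κ L H ε q) (k : ℕ) : ∃ u ∈ Icc 0 ((s - 1) * sk s k),
      H (sk s k + u) = H (sk s (k + 1)) - 20 * ε := by
  have hδ := hN.pos
  have hδh := hN.le_half hs
  have hsk := sk_ge hs k
  have hek := hM.ek
  have hU : sk s k + (s - 1) * sk s k = sk s (k + 1) := by rw [sk_succ]; ring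
  have hfar := hM.far (t := sk s k) (t' := sk s (k + 1)) (by linarith) (by nlinarith) hδ
  have hε := hM.epos
  have := intermediate_value_Icc (a := 0) (b := (s - 1) * sk s k) (by nlinarith)
    (f := fun u => H (sk s k + u)) (hM.cont.comp (continuous_const.add continuous_id)).continuousOn
  obtain ⟨u, hu, h⟩ := this (show H (sk s (k + 1)) - 20 * ε ∈ Icc _ _ from
    ⟨by simp only [add_zero]; linarith, by simp only [hU]; linarith⟩)
  exact ⟨u, hu, h⟩

lemma div_pow_abs {s : ℝ} (hs : 1 < s) (m : ℕ) {x y c : ℝ} (h : |x - y| ≤ c) :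
    |ff s (x / s ^ m) - ff s (y / s ^ m)| ≤ c / s ^ m := by
  have hp : 0 < s ^ m := pow_pos (by linarith) m
  refine (ff_lip hs _ _).trans ?_
  rw [← sub_div, abs_div, abs_of_pos hp]
  gcongr

lemma TP.pred {s : ℝ} (hs : 1 < s) {m : ℕ} {t : ℝ} (h : TP s (m + 1) t) :
    ff s (t / s ^ m) = s / 2 := by
  rw [h.val hs (by omega), show m + 1 - m = 1 by omega]
  simp [half_iter_one hs, ← one_div]

lemma ME.level_lt {s δ κ L : ℝ} {H : ℝ → ℝ} {ε : ℝ} {q : ℕ} (hs : 1 < s) (hs2 : s < 2) (hN : NR s δ)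
    (hM : ME s δ κ L H ε q) {k j j' : ℕ} {y y' : ℝ} (hk : q + 1 ≤ k) (hj : 1 ≤ j) (hy : TP s j y)
    (hyH : |y - H (sk s k)| ≤ 2 * ε) (hj' : 1 ≤ j') (hy' : TP s j' y')
    (hyH' : |y' - H (sk s (k + 1))| ≤ 2 * ε) : j < j' := by
  by_contra hcon
  push Not at hcon
  obtain ⟨m, rfl⟩ : ∃ m, j' = m + 1 := ⟨j' - 1, by omega⟩
  have hδ := hN.pos
  have hδh := hN.le_half hs
  have hε := hM.epos
  have hek := hM.ek
  have hed := hM.ed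
  have hskp := sk_pos hs k
  obtain ⟨u, hu, hue⟩ := hM.near_end hs hN k
  have hl := (hM.liftk hs hs2 hN hk hj hy hyH u hu hue.le).1 m (by omega)
  have hp : 0 < s ^ m := pow_pos (by linarith) m
  have hp' : 0 < s ^ (m + 1) := pow_pos (by linarith) _
  have h1 : |H (sk s k + u) - y'| ≤ 22 * ε := by
    rw [abs_le] at *; constructor <;> linarith
  have h2 := div_pow_abs hs m h1
  rw [hy'.pred hs] at h2
  have h3 : s / 2 - 26 * (ε / s ^ m) ≤ ff s (H (sk s k - u) / s ^ m) := by
    rw [abs_le] at h2 hl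
    rw [mul_div_assoc] at h2
    linarith [h2.1, hl.2]
  rw [ff_div_succ hs, tent_abs hs] at h3
  have hw : |ff s (H (sk s k - u) / s ^ (m + 1)) - 1 / 2| ≤ 26 * (ε / s ^ (m + 1)) := by
    have h4 : s * |ff s (H (sk s k - u) / s ^ (m + 1)) - 1 / 2| ≤ s * (26 * (ε / s ^ (m + 1))) := by
      have : s * (26 * (ε / s ^ (m + 1))) = 26 * (ε / s ^ m) := by rw [pow_succ]; field_simp
      rw [this]; linarith
    exact le_of_mul_le_mul_left h4 (by linarith)
  have hee : ε / s ^ (m + 1) ≤ ε := div_le_self hε.le (one_le_pow₀ hs.le)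
  set b := H (sk s k - u) with hb
  obtain ⟨σ, hσ, hwin⟩ := window hs hN (b / s ^ (m + 1)) (by linarith)
  set w := ff s (b / s ^ (m + 1)) - 1 / 2 with hwdef
  have hσσ : σ * σ = 1 := by rcases hσ with h | h <;> rw [h] <;> norm_num
  have hσa : |σ| = 1 := by rcases hσ with h | h <;> rw [h] <;> norm_num
  -- the turning point near b
  have hz : TP s (m + 1) (b - σ * w * s ^ (m + 1)) := by
    unfold TP
    have e1 : (b - σ * w * s ^ (m + 1)) / s ^ (m + 1) = b / s ^ (m + 1) - σ * w := by field_simp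
    rw [e1, hwin (b / s ^ (m + 1) - σ * w) (by
      rw [show b / s ^ (m + 1) - σ * w - b / s ^ (m + 1) = -(σ * w) by ring, abs_neg, abs_mul, hσa]
      linarith)]
    have : σ * (b / s ^ (m + 1) - σ * w - b / s ^ (m + 1)) = - (σ * σ * w) := by ring
    rw [this, hσσ, hwdef]; ring
  set z := b - σ * w * s ^ (m + 1) with hzdef
  have hzb : |z - b| ≤ 26 * ε := by
    rw [hzdef, show b - σ * w * s ^ (m + 1) - b = -(σ * w * s ^ (m + 1)) by ring, abs_neg, abs_mul,
      abs_mul, hσa, abs_of_pos hp', one_mul]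
    calc |w| * s ^ (m + 1) ≤ 26 * (ε / s ^ (m + 1)) * s ^ (m + 1) := by gcongr
      _ = 26 * ε := by field_simp
  have hz0 : 0 ≤ z := by
    have := hz.lower hs; linarith
  obtain ⟨t, ht0, htz⟩ := hM.surj z hz0
  have hsu : 0 ≤ sk s k - u := by nlinarith [hu.2]
  have d1 := hM.D1 t (sk s k - u) ht0 hsu (by rw [htz]; linarith)
  rw [← htz] at hz
  obtain ⟨τ, m', hm', hτ, hτt⟩ := hM.D2 t _ ht0 (by omega) hz
  have d2 := hM.D1 (sk s k + u) (sk s (k + 1)) (by linarith [hu.1]) (sk_pos hs _).le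
    (by rw [hue, abs_le]; constructor <;> linarith)
  have d3 := reflect_far hs hN (k := k) hm' hτ
  rw [sk_succ] at d2
  have d4 : |τ - (2 - s) * sk s k| < δ := by
    rw [abs_lt] at *
    rw [abs_le] at hτt
    constructor <;> linarith
  linarith

lemma ME.salient {s δ κ L : ℝ} {H : ℝ → ℝ} {ε : ℝ} {q : ℕ} (hs : 1 < s) (hs2 : s < 2) (hN : NR s δ)
    (hM : ME s δ κ L H ε q) {k j : ℕ} {y y' : ℝ} (hk : q + 1 ≤ k) (hj : 1 ≤ j) (hy : TP s j y)
    (hyH : |y - H (sk s k)| ≤ 2 * ε) (hy' : TP s (j + 1) y')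
    (hyH' : |y' - H (sk s (k + 1))| ≤ 2 * ε) : y = sk s j := by
  have hδ := hN.pos
  have hδh := hN.le_half hs
  have hε := hM.epos
  have hek := hM.ek
  have hed := hM.ed
  have hes := hM.es
  have hskp := sk_pos hs k
  have hp : 0 < s ^ j := pow_pos (by linarith) j
  have hee : ε / s ^ j ≤ ε := div_le_self hε.le (one_le_pow₀ hs.le)
  have hep : 0 < ε / s ^ j := by positivity
  obtain ⟨u, hu, hue⟩ := hM.near_end hs hN k
  have hl := (hM.liftk hs hs2 hN hk hj hy hyH u hu hue.le).2
  have h1 : |H (sk s k + u) - y'| ≤ 22 * ε := by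
    rw [abs_le] at *; constructor <;> linarith
  have h2 := div_pow_abs hs j h1
  rw [hy'.pred hs, mul_div_assoc] at h2
  have hcc : cc s - (1 - s / 2) = (s - 1) * (2 - s) / 2 := by unfold cc; ring
  have hb : H (sk s k - u) / s ^ j < cc s := by
    apply lt_cc_of_ff hs hs2
    rw [abs_le] at hl h2
    linarith [hl.2, h2.1]
  rcases le_or_gt (y / s ^ j) (s / 2) with hY | hY
  · have : ff s (y / s ^ j) = 1 / 2 := hy
    rw [ff_id hs hY] at this
    unfold sk
    rw [div_eq_iff hp.ne'] at this
    rw [this]; ring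
  · exfalso
    have h3 := ff_lip hs (s / 2) (y / s ^ j)
    rw [show ff s (y / s ^ j) = 1 / 2 from hy, ff_id hs le_rfl, abs_sub_comm (s / 2) (y / s ^ j),
      abs_of_pos (by linarith : 0 < s / 2 - 1 / 2), abs_of_pos (by linarith : 0 < y / s ^ j - s / 2)] at h3
    have hb0 : s / 2 ≤ H (sk s k) / s ^ j := by
      have : |y / s ^ j - H (sk s k) / s ^ j| ≤ 2 * ε / s ^ j := by
        rw [← sub_div, abs_div, abs_of_pos hp]; gcongr
      rw [mul_div_assoc, abs_le] at this
      linarith [this.2]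
    have hcch : cc s ≤ 1 / 2 := cc_le_half
    have hcont : ContinuousOn (fun v => H (sk s k - v) / s ^ j) (Icc 0 u) :=
      ((hM.cont.comp (continuous_const.sub continuous_id)).div_const _).continuousOn
    obtain ⟨v, hv, hve⟩ := intermediate_value_Icc' hu.1 hcont
      (show s / 2 ∈ Icc _ _ from ⟨by linarith, by simpa using hb0⟩)
    simp only at hve
    have hvN : H (sk s k + v) ≤ H (sk s (k + 1)) - 20 * ε := by
      rw [← hue]; exact hM.mono.monotone (by linarith [hv.2])
    have hl' := (hM.liftk hs hs2 hN hk hj hy hyH v ⟨hv.1, hv.2.trans hu.2⟩ hvN).2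
    rw [hve, ff_id hs le_rfl] at hl'
    have h5 : H (sk s k + v) / s ^ j < cc s := by
      apply lt_cc_of_ff hs hs2
      rw [abs_le] at hl'
      linarith [hl'.2]
    have h6 : H (sk s k) / s ^ j ≤ H (sk s k + v) / s ^ j := by
      have := hM.mono.monotone (show sk s k ≤ sk s k + v by linarith [hv.1])
      gcongr
    linarith

lemma evconst (n : ℕ → ℤ) (hm : Monotone n) (C : ℤ) (hC : ∀ k, n k ≤ C) :
    ∃ k1 R, ∀ k, k1 ≤ k → n k = R := by
  obtain ⟨R, ⟨k1, hk1⟩, hmax⟩ := Int.exists_greatest_of_bdd (P := fun z => ∃ k, n k = z)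
    ⟨C, by rintro z ⟨k, rfl⟩; exact hC k⟩ ⟨n 0, 0, rfl⟩
  refine ⟨k1, R, fun k hk => le_antisymm (hmax _ ⟨k, rfl⟩) ?_⟩
  rw [← hk1]; exact hm hk

/-- salient points go to salient points -/
lemma ME.salient_shift {s δ κ L : ℝ} {H : ℝ → ℝ} {ε : ℝ} {q : ℕ} (hs : 1 < s) (hs2 : s < 2)
    (hN : NR s δ) (hM : ME s δ κ L H ε q) : ∃ n : ℕ, ∃ R : ℤ, q + 1 ≤ n ∧ ∀ k, n ≤ k →
      ∃ j : ℕ, 1 ≤ j ∧ (j : ℤ) = k + R ∧ |H (sk s k) - sk s j| ≤ 2 * ε := by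
  have hex : ∀ k, ∃ y j, q + 1 ≤ k → (1 ≤ j ∧ TP s j y ∧ |y - H (sk s k)| ≤ 2 * ε) := by
    intro k
    by_cases hk : q + 1 ≤ k
    · obtain ⟨y, hy, j, hj, hT⟩ := hM.mt1 hs hN hk (sk_TP hs k)
      exact ⟨y, j, fun _ => ⟨hj, hT, hy⟩⟩
    · exact ⟨0, 0, fun h => absurd h hk⟩
  choose y j hyj using hex
  have hε := hM.epos
  have hed := hM.ed
  have hδ4 := hN.le
  have hL := hM.Lpos
  obtain ⟨C, hC⟩ := pow_unbounded_of_one_lt (3 * L + 1) hs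
  have hbd : ∀ k, q + 1 ≤ k → j k ≤ k + C := by
    intro k hk
    obtain ⟨h1, h2, h3⟩ := hyj k hk
    have h4 := h2.lower hs
    have h5 := hM.D4 (sk s k) 0 (sk_pos hs k).le le_rfl
    rw [hM.zero, sub_zero, sub_zero, abs_of_pos (sk_pos hs k)] at h5
    have h6 := sk_ge hs k
    have h7 : y k ≤ L * (sk s k + 1) + 2 * ε := by
      rw [abs_le] at h3
      linarith [h3.2, le_abs_self (H (sk s k))]
    have h8 : s ^ (j k) / 2 < s ^ (k + C) / 2 := by
      have : s ^ (k + C) / 2 = s ^ C * sk s k := by unfold sk; rw [pow_add]; ring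
      rw [this]
      have h9 : (3 * L + 1) * sk s k < s ^ C * sk s k := by
        have := sk_pos hs k; gcongr
      nlinarith
    have h9 : s ^ (j k) < s ^ (k + C) := by linarith
    exact ((pow_lt_pow_iff_right₀ hs).mp h9).le
  have hlt : ∀ k, q + 1 ≤ k → j k < j (k + 1) := by
    intro k hk
    obtain ⟨h1, h2, h3⟩ := hyj k hk
    obtain ⟨h1', h2', h3'⟩ := hyj (k + 1) (by omega)
    exact hM.level_lt hs hs2 hN hk h1 h2 h3 h1' h2' h3'
  obtain ⟨k1, R, hR⟩ := evconst (fun i => (j (i + (q + 1)) : ℤ) - (i + (q + 1) : ℕ))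
    (monotone_nat_of_le_succ (fun i => by
      have := hlt (i + (q + 1)) (by omega)
      rw [show i + 1 + (q + 1) = i + (q + 1) + 1 by ring]
      push_cast; omega)) C (fun i => by
      have := hbd (i + (q + 1)) (by omega)
      omega)
  have hR' : ∀ k, k1 + (q + 1) ≤ k → (j k : ℤ) = k + R := by
    intro k hk
    have := hR (k - (q + 1)) (by omega)
    rw [show k - (q + 1) + (q + 1) = k by omega] at this
    omega
  refine ⟨k1 + (q + 1), R, by omega, fun k hk => ⟨j k, ?_, hR' k hk, ?_⟩⟩
  · exact (hyj k (by omega)).1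
  · obtain ⟨h1, h2, h3⟩ := hyj k (by omega)
    obtain ⟨h1', h2', h3'⟩ := hyj (k + 1) (by omega)
    have e1 := hR' k hk
    have e2 := hR' (k + 1) (by omega)
    have e3 : j (k + 1) = j k + 1 := by push_cast at e2; omega
    rw [e3] at h2'
    have := hM.salient hs hs2 hN (by omega) h1 h2 h3 h2' h3'
    rw [← this, abs_sub_comm]; exact h3

/-- turning points go to turning points -/
lemma ME.turning {s δ κ L : ℝ} {H : ℝ → ℝ} {ε : ℝ} {q : ℕ} (hs : 1 < s) (hs2 : s < 2)
    (hN : NR s δ) (hM : ME s δ κ L H ε q) {n : ℕ} {R : ℤ} (hn : q + 1 ≤ n)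
    (hR : ∀ k, n ≤ k → ∃ j : ℕ, 1 ≤ j ∧ (j : ℤ) = k + R ∧ |H (sk s k) - sk s j| ≤ 2 * ε) :
    ∀ k, n ≤ k → ∀ τ m, n ≤ m → TP s m τ → τ ≤ sk s k → |H τ - s ^ R * τ| ≤ 2 * ε := by
  have hs0 : 0 < s := by linarith
  have hε := hM.epos
  have hδ := hN.pos
  have hed := hM.ed
  have hek := hM.ek
  have hskj : ∀ (k j : ℕ), (j : ℤ) = k + R → sk s j = s ^ R * sk s k := by
    intro k j hj
    unfold sk
    rw [← zpow_natCast s j, hj, add_comm, zpow_add₀ hs0.ne', zpow_natCast]; ring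
  have hsal : ∀ k, n ≤ k → |H (sk s k) - s ^ R * sk s k| ≤ 2 * ε := by
    intro k hk
    obtain ⟨j, _, h2, h3⟩ := hR k hk
    rw [← hskj k j h2]; exact h3
  intro k hk
  induction k, hk using Nat.le_induction with
  | base =>
    intro τ m hm hτ hle
    have h1 := hτ.lower hs
    have h2 : sk s n ≤ sk s m := sk_mono hs hm
    have h3 : sk s m = s ^ m / 2 := rfl
    have : τ = sk s n := by linarith
    rw [this]; exact hsal n le_rfl
  | succ k hk ih =>
    intro τ m hm hτ hle
    rcases le_or_gt τ (sk s k) with h | hgt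
    · exact ih τ m hm hτ h
    rcases hle.eq_or_lt with h | hlt
    · rw [h]; exact hsal _ (by omega)
    have hlow := hτ.lower hs
    have hskm : sk s m = s ^ m / 2 := rfl
    have hpk : 0 < s ^ k := pow_pos hs0 k
    have hmk : m < k := by
      by_contra hc
      push Not at hc
      rcases hc.eq_or_lt with h | h
      · subst h
        have h1 : ff s (τ / s ^ k) = 1 / 2 := hτ
        rw [ff_id hs (by
          rw [div_le_iff₀ hpk]
          have : sk s (k + 1) = s / 2 * s ^ k := by unfold sk; rw [pow_succ]; ring
          linarith)] at h1
        rw [div_eq_iff hpk.ne'] at h1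
        unfold sk at hgt; linarith
      · have : sk s (k + 1) ≤ sk s m := sk_mono hs h
        linarith
    have hu1 : τ - sk s k ≤ (s - 1) * sk s k := by rw [sk_succ] at hlt; linarith
    have hrefl := reflect hs hmk (v := τ - sk s k) (by linarith) hu1
    rw [show sk s k + (τ - sk s k) = τ by ring] at hrefl
    have hτ' : TP s m (sk s k - (τ - sk s k)) := by
      unfold TP at *; rw [← hrefl]; exact hτ
    have hIH := ih _ m hm hτ' (by linarith)
    obtain ⟨j, hj1, hj2, hj3⟩ := hR k hk
    have hfar : τ + δ / 2 ≤ sk s (k + 1) := by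
      by_contra hc
      push Not at hc
      have := hτ.eq_of_close hs hN (sk_TP hs (k + 1)) (by rw [abs_lt]; constructor <;> linarith)
      linarith
    have hfar2 := hM.far (t := τ) (t' := sk s (k + 1)) (by linarith [sk_pos hs k]) (by linarith) hδ
    have hl := (hM.liftk hs hs2 hN (k := k) (by omega) hj1 (sk_TP hs j) (by rw [abs_sub_comm]; exact hj3)
      (τ - sk s k) ⟨by linarith, hu1⟩ (by
        rw [show sk s k + (τ - sk s k) = τ by ring]; linarith)).2
    rw [show sk s k + (τ - sk s k) = τ by ring] at hl
    have hp : 0 < s ^ j := pow_pos hs0 j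
    have hsk1 := hsal (k + 1) (by omega)
    have hjj : s ^ R * sk s (k + 1) = s / 2 * s ^ j := by
      rw [sk_succ]
      have := hskj k j hj2
      have h2 : sk s j = s ^ j / 2 := rfl
      rw [h2] at this
      calc s ^ R * (s * sk s k) = s * (s ^ R * sk s k) := by ring
        _ = s / 2 * s ^ j := by rw [← this]; ring
    have hτle : H τ / s ^ j ≤ s / 2 := by
      rw [div_le_iff₀ hp]
      rw [hjj, abs_le] at hsk1
      linarith [hsk1.2]
    have hτle2 : H (sk s k - (τ - sk s k)) / s ^ j ≤ s / 2 := by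
      refine le_trans ?_ hτle
      have := hM.mono.monotone (show sk s k - (τ - sk s k) ≤ τ by linarith)
      gcongr
    rw [ff_id hs hτle, ff_id hs hτle2] at hl
    have hl2 : |H τ + H (sk s k - (τ - sk s k)) - s ^ j| ≤ 4 * ε := by
      have e1 : H τ / s ^ j + H (sk s k - (τ - sk s k)) / s ^ j - 1 =
        (H τ + H (sk s k - (τ - sk s k)) - s ^ j) / s ^ j := by field_simp
      rw [e1, abs_div, abs_of_pos hp, ← mul_div_assoc, div_le_div_iff_of_pos_right hp] at hl
      exact hl
    have hsj : s ^ j = 2 * (s ^ R * sk s k) := by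
      rw [← hskj k j hj2]; unfold sk; ring
    have h6 : |H τ - s ^ R * τ| ≤ 6 * ε := by
      rw [hsj] at hl2
      rw [abs_le] at *
      have : s ^ R * (sk s k - (τ - sk s k)) = 2 * (s ^ R * sk s k) - s ^ R * τ := by ring
      constructor <;> linarith [hl2.1, hl2.2, hIH.1, hIH.2]
    obtain ⟨y, hy, i, hi, hTy⟩ := hM.mt1 hs hN (by omega) hτ
    have hTR : TP s (m + R).toNat (s ^ R * τ) := by
      obtain ⟨jn, a1, a2, _⟩ := hR n le_rfl
      have hnn : 0 ≤ (m : ℤ) + R := by omega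
      unfold TP at *
      have : s ^ R * τ / s ^ ((m : ℤ) + R).toNat = τ / s ^ m := by
        rw [← zpow_natCast s ((m : ℤ) + R).toNat, Int.toNat_of_nonneg hnn, zpow_add₀ hs0.ne', zpow_natCast]
        have := zpow_pos hs0 R
        field_simp
      rw [this]; exact hτ
    have hclose := hTy.eq_of_close hs hN hTR (by
      rw [abs_lt]; rw [abs_le] at *; constructor <;> linarith)
    rw [← hclose, abs_sub_comm]; exact hy

lemma dense_turn {s : ℝ} (hs : 1 < s) (hs2 : s < 2) : ∀ k, 1 ≤ k → ∀ t, 0 ≤ t → t ≤ sk s k →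
    ∃ τ m, 1 ≤ m ∧ TP s m τ ∧ |t - τ| ≤ s / 2 := by
  intro k hk
  induction k, hk using Nat.le_induction with
  | base =>
    intro t h0 h1
    refine ⟨sk s 1, 1, le_rfl, sk_TP hs 1, ?_⟩
    have : sk s 1 = s / 2 := by unfold sk; simp
    rw [abs_le]; constructor <;> linarith
  | succ k hk ih =>
    intro t h0 h1
    rcases le_or_gt t (sk s k) with h | hgt
    · exact ih t h0 h
    have hskp := sk_pos hs k
    rw [sk_succ] at h1
    obtain ⟨τ, m, hm, hτ, hd⟩ := ih (2 * sk s k - t) (by nlinarith) (by linarith)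
    rw [abs_le] at hd
    rcases le_or_gt (sk s k) τ with h | h
    · refine ⟨sk s k, k, hk, sk_TP hs k, ?_⟩
      rw [abs_le]; constructor <;> linarith
    have hmk : m < k := by
      by_contra hc
      push Not at hc
      have h1 := hτ.lower hs
      have h2 : sk s k ≤ sk s m := sk_mono hs hc
      have h3 : sk s m = s ^ m / 2 := rfl
      linarith
    rcases le_or_gt ((2 - s) * sk s k) τ with h' | h'
    · have hr := reflect hs hmk (v := sk s k - τ) (by linarith) (by linarith)
      refine ⟨sk s k + (sk s k - τ), m, hm, ?_, ?_⟩
      · unfold TP at *; rw [hr, ← hτ]; congr 2; ring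
      · rw [abs_le]; constructor <;> linarith
    · refine ⟨sk s (k + 1), k + 1, by omega, sk_TP hs _, ?_⟩
      rw [sk_succ, abs_le]; constructor <;> nlinarith

lemma dense_turn_n {s : ℝ} (hs : 1 < s) (hs2 : s < 2) (n : ℕ) {t : ℝ} (h0 : 0 ≤ t) :
    ∃ τ m, n ≤ m ∧ TP s m τ ∧ |t - τ| ≤ s ^ n * (s / 2) := by
  have hp : 0 < s ^ n := pow_pos (by linarith) n
  obtain ⟨k, hk, hle⟩ := sk_unbounded hs (t / s ^ n)
  obtain ⟨τ, m, hm, hτ, hd⟩ := dense_turn hs hs2 k hk (t / s ^ n) (by positivity) hle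
  refine ⟨s ^ n * τ, m + n, by omega, ?_, ?_⟩
  · unfold TP at *
    rw [← hτ]; congr 1; rw [pow_add]; field_simp
  · have : t - s ^ n * τ = s ^ n * (t / s ^ n - τ) := by field_simp
    rw [this, abs_mul, abs_of_pos hp]; gcongr

lemma ME.final {s δ κ L : ℝ} {H : ℝ → ℝ} {ε : ℝ} {q : ℕ} (hs : 1 < s) (hs2 : s < 2)
    (hN : NR s δ) (hM : ME s δ κ L H ε q) : ∃ R : ℤ, (∃ M, ∀ t, 0 ≤ t → |H t - s ^ R * t| ≤ M) ∧
      ∃ n : ℕ, ∀ k, n ≤ k → |H (sk s k) - s ^ R * sk s k| ≤ 2 * ε := by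
  obtain ⟨n, R, hn, hR⟩ := hM.salient_shift hs hs2 hN
  have hT := hM.turning hs hs2 hN hn hR
  have hRp : 0 < s ^ R := zpow_pos (by linarith) R
  refine ⟨R, ⟨L * (s ^ n * (s / 2) + 1) + 2 * ε + s ^ R * (s ^ n * (s / 2)), ?_⟩, n, ?_⟩
  · intro t ht
    obtain ⟨τ, m, hm, hτ, hd⟩ := dense_turn_n hs hs2 n ht
    obtain ⟨k, hk, hle⟩ := sk_unbounded hs τ
    have h1 := hT (max k n) (le_max_right _ _) τ m hm hτ (hle.trans (sk_mono hs (le_max_left _ _)))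
    have hτ0 : 0 ≤ τ := by
      have := hτ.lower hs
      have := pow_pos (by linarith : 0 < s) m
      linarith
    have h2 := hM.D4 t τ ht hτ0
    have hL := hM.Lpos
    have h3 : |H t - H τ| ≤ L * (s ^ n * (s / 2) + 1) := h2.trans (by gcongr)
    have h4 : |s ^ R * τ - s ^ R * t| ≤ s ^ R * (s ^ n * (s / 2)) := by
      rw [← mul_sub, abs_mul, abs_of_pos hRp, abs_sub_comm]; gcongr
    have : H t - s ^ R * t = (H t - H τ) + (H τ - s ^ R * τ) + (s ^ R * τ - s ^ R * t) := by ring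
    rw [this]
    exact (abs_add_three _ _ _).trans (by linarith)
  · intro k hk
    exact hT k hk _ k hk (sk_TP hs k) le_rfl

theorem MD.main {s δ κ L : ℝ} {H : ℝ → ℝ} (hs : 1 < s) (hs2 : s < 2)
    (hN : NR s δ) (hM : MD s δ κ L H) : ∃ R : ℤ, (∃ M, ∀ t, 0 ≤ t → |H t - s ^ R * t| ≤ M) ∧
      ∀ ε > 0, ∃ n : ℕ, ∀ k, n ≤ k → |H (sk s k) - s ^ R * sk s k| ≤ ε := by
  have hex : ∀ ε > 0, ∃ R : ℤ, (∃ M, ∀ t, 0 ≤ t → |H t - s ^ R * t| ≤ M) ∧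
      ∃ n : ℕ, ∀ k, n ≤ k → |H (sk s k) - s ^ R * sk s k| ≤ ε := by
    intro ε hε
    have hk := hM.kpos
    have hd := hN.pos
    have hss : 0 < (s - 1) * (2 - s) := mul_pos (by linarith) (by linarith)
    set e := min (min (κ / 100) (δ / 200)) (min ((s - 1) * (2 - s) / 100) (ε / 2)) with he
    have he0 : 0 < e := by
      rw [he]; refine lt_min (lt_min ?_ ?_) (lt_min ?_ ?_) <;> positivity
    have h1 : e ≤ κ / 100 := (min_le_left _ _).trans (min_le_left _ _)
    have h2 : e ≤ δ / 200 := (min_le_left _ _).trans (min_le_right _ _)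
    have h3 : e ≤ (s - 1) * (2 - s) / 100 := (min_le_right _ _).trans (min_le_left _ _)
    have h4 : e ≤ ε / 2 := (min_le_right _ _).trans (min_le_right _ _)
    obtain ⟨q, hq⟩ := hM.D3 e he0
    have hE : ME s δ κ L H e q := { toMD := hM, epos := he0, ek := by linarith, ed := by linarith, es := by linarith, hq := hq }
    obtain ⟨R, a, n, hn⟩ := hE.final hs hs2 hN
    exact ⟨R, a, n, fun k hk => (hn k hk).trans (by linarith)⟩
  obtain ⟨R, ⟨M, hRM⟩, _⟩ := hex 1 one_pos
  refine ⟨R, ⟨M, hRM⟩, fun ε hε => ?_⟩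
  obtain ⟨R', ⟨M', hRM'⟩, n, hn⟩ := hex ε hε
  have heq : s ^ R = s ^ R' := by
    by_contra hne
    have hd : 0 < |s ^ R - s ^ R'| := abs_pos.mpr (sub_ne_zero.mpr hne)
    set t := (|M| + |M'| + 1) / |s ^ R - s ^ R'| with ht
    have ht0 : 0 ≤ t := by positivity
    have h1 := hRM t ht0
    have h2 := hRM' t ht0
    have h3 : |s ^ R - s ^ R'| * t = |M| + |M'| + 1 := by rw [ht]; field_simp
    have h4 : |s ^ R - s ^ R'| * t = |(H t - s ^ R' * t) - (H t - s ^ R * t)| := by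
      rw [← abs_of_nonneg ht0, ← abs_mul, abs_of_nonneg ht0]; congr 1; ring
    have h5 := abs_sub (H t - s ^ R' * t) (H t - s ^ R * t)
    have := le_abs_self M
    have := le_abs_self M'
    linarith
  refine ⟨n, fun k hk => ?_⟩
  rw [heq]; exact hn k hk

end MainReal

section KBasics

variable {s : ℝ}

lemma K_nonneg (x : invLim s) (n : ℕ) : 0 ≤ x.1 n := (x.2.1 n).1
lemma K_le_one (x : invLim s) (n : ℕ) : x.1 n ≤ 1 := (x.2.1 n).2
lemma K_rel (x : invLim s) (n : ℕ) : x.1 n = tent s (x.1 (n + 1)) := x.2.2 n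
lemma K_le (hs : 1 < s) (x : invLim s) (n : ℕ) : x.1 n ≤ s / 2 := by
  rw [K_rel]; exact tent_le hs _

lemma K_iter (x : invLim s) (n k : ℕ) : x.1 n = (tent s)^[k] (x.1 (n + k)) := by
  induction k with
  | zero => rfl
  | succ k ih => rw [ih, K_rel x (n + k), ← Function.iterate_succ_apply]; rfl

lemma K_agree {x y : invLim s} {n : ℕ} (h : x.1 n = y.1 n) {i : ℕ} (hi : i ≤ n) :
    x.1 i = y.1 i := by
  obtain ⟨k, rfl⟩ := Nat.exists_eq_add_of_le hi
  rw [K_iter x i k, K_iter y i k, h]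

lemma K_ext {x y : invLim s} (h : ∀ N, ∃ n, N ≤ n ∧ x.1 n = y.1 n) : x = y := by
  apply Subtype.ext
  funext i
  obtain ⟨n, hn, he⟩ := h i
  exact K_agree he hn

lemma K_coord_cont (n : ℕ) : Continuous (fun x : invLim s => x.1 n) :=
  (continuous_apply n).comp continuous_subtype_val

lemma K_tendsto {ι : Type*} {l : Filter ι} {u : ι → invLim s} {x : invLim s}
    (h : ∀ n, Tendsto (fun i => (u i).1 n) l (𝓝 (x.1 n))) : Tendsto u l (𝓝 x) := by
  rw [tendsto_subtype_rng, tendsto_pi_nhds]; exact h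

lemma tent_cont : Continuous (tent s) := by
  unfold tent; fun_prop

lemma K_compact : IsCompact (invLim s) := by
  have h1 : IsCompact (Set.pi univ (fun _ : ℕ => Icc (0 : ℝ) 1)) :=
    isCompact_univ_pi (fun _ => isCompact_Icc)
  refine h1.of_isClosed_subset ?_ (fun x hx n _ => hx.1 n)
  have : invLim s = (⋂ n, {x : ℕ → ℝ | x n ∈ Icc (0 : ℝ) 1}) ∩ ⋂ n, {x | x n = tent s (x (n + 1))} := by
    ext x; simp [invLim]
  rw [this]
  refine (isClosed_iInter fun n => isClosed_Icc.preimage (continuous_apply n)).inter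
    (isClosed_iInter fun n => isClosed_eq (continuous_apply n) (tent_cont.comp (continuous_apply _)))

instance K_compactSpace : CompactSpace (invLim s) := isCompact_iff_compactSpace.mp K_compact

lemma K_succ (hs : 1 < s) {x : invLim s} {n : ℕ} (h : x.1 n < cc s) : x.1 (n + 1) = x.1 n / s := by
  have h1 := K_rel x n
  have h2 := K_le hs x (n + 1)
  rcases le_or_gt (x.1 (n + 1)) (1 / 2) with h3 | h3
  · rw [tent_left hs h3] at h1
    rw [h1]; field_simp
  · rw [tent_right hs h3.le] at h1
    unfold cc at h
    nlinarith

lemma K_succ_lt (hs : 1 < s) (hs2 : s < 2) {x : invLim s} {n : ℕ} (h : x.1 n < cc s) (k : ℕ) :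
    x.1 (n + k) = x.1 n / s ^ k ∧ x.1 (n + k) < cc s := by
  induction k with
  | zero => simp [h]
  | succ k ih =>
    have h1 := K_succ hs ih.2
    rw [← add_assoc, h1, ih.1, div_div, ← pow_succ]
    refine ⟨rfl, ?_⟩
    refine lt_of_le_of_lt (div_le_self (K_nonneg x n) (one_le_pow₀ hs.le)) h

/-- the ray -/
def gam (hs : 1 < s) (hs2 : s < 2) (t : ℝ) : invLim s :=
  ⟨fun n => ff s (max t 0 / s ^ n), fun n => ⟨ff_nonneg hs hs2 (by
      have := pow_pos (by linarith : 0 < s) n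
      have := le_max_right t 0
      positivity), (ff_le hs _).trans (by linarith)⟩,
    fun n => ff_div_succ hs _ n⟩

lemma gam_coord (hs : 1 < s) (hs2 : s < 2) {t : ℝ} (ht : 0 ≤ t) (n : ℕ) :
    (gam hs hs2 t).1 n = ff s (t / s ^ n) := by
  simp [gam, max_eq_left ht]

lemma gam_neg (hs : 1 < s) (hs2 : s < 2) {t : ℝ} (ht : t ≤ 0) : gam hs hs2 t = gam hs hs2 0 := by
  simp [gam, max_eq_right ht]

lemma gam_cont (hs : 1 < s) (hs2 : s < 2) : Continuous (gam hs hs2) := by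
  apply Continuous.subtype_mk
  apply continuous_pi
  intro n
  exact (ff_continuous hs).comp ((continuous_id.max continuous_const).div_const _)

lemma gam_large (hs : 1 < s) (hs2 : s < 2) {t : ℝ} (ht : 0 ≤ t) : ∃ n : ℕ, t / s ^ n < cc s := by
  have hc := cc_pos hs hs2
  obtain ⟨n, hn⟩ := pow_unbounded_of_one_lt (t / cc s) hs
  refine ⟨n, ?_⟩
  have hp : 0 < s ^ n := pow_pos (by linarith) n
  rw [div_lt_iff₀ hc] at hn
  rw [div_lt_iff₀ hp]; linarith

def C0 (s : ℝ) : Set (invLim s) := {x | ∃ n, x.1 n < cc s}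

lemma cc_le_half_s (hs : 1 < s) : cc s ≤ s / 2 := by
  have := cc_le_half (s := s); linarith

lemma gam_mem (hs : 1 < s) (hs2 : s < 2) (t : ℝ) : gam hs hs2 t ∈ C0 s := by
  have key : ∀ t, 0 ≤ t → gam hs hs2 t ∈ C0 s := by
    intro t ht
    obtain ⟨n, hn⟩ := gam_large hs hs2 ht
    refine ⟨n, ?_⟩
    rw [gam_coord hs hs2 ht, ff_id hs (hn.le.trans (cc_le_half_s hs))]; exact hn
  rcases le_total 0 t with h | h
  · exact key t h
  · rw [gam_neg hs hs2 h]; exact key 0 le_rfl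

lemma eq_gam (hs : 1 < s) (hs2 : s < 2) {x : invLim s} {n : ℕ} (h : x.1 n < cc s) :
    x = gam hs hs2 (s ^ n * x.1 n) := by
  have hp : ∀ k, 0 < s ^ k := fun k => pow_pos (by linarith) k
  have h0 : 0 ≤ s ^ n * x.1 n := mul_nonneg (hp n).le (K_nonneg x n)
  apply K_ext
  intro N
  refine ⟨n + N, by omega, ?_⟩
  obtain ⟨h1, h2⟩ := K_succ_lt hs hs2 h N
  rw [gam_coord hs hs2 h0]
  have h3 : s ^ n * x.1 n / s ^ (n + N) = x.1 (n + N) := by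
    rw [h1, pow_add]
    have := hp n; have := hp N
    field_simp
  rw [h3, ff_id hs (h2.le.trans (cc_le_half_s hs))]

lemma gam_inj (hs : 1 < s) (hs2 : s < 2) {t t' : ℝ} (ht : 0 ≤ t) (ht' : 0 ≤ t')
    (h : gam hs hs2 t = gam hs hs2 t') : t = t' := by
  obtain ⟨n, hn⟩ := gam_large hs hs2 (ht.trans (le_max_left t t'))
  have hp : 0 < s ^ n := pow_pos (by linarith) n
  have h1 : t / s ^ n ≤ s / 2 := by
    have : t / s ^ n ≤ max t t' / s ^ n := by gcongr; exact le_max_left _ _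
    linarith [cc_le_half_s hs]
  have h2 : t' / s ^ n ≤ s / 2 := by
    have : t' / s ^ n ≤ max t t' / s ^ n := by gcongr; exact le_max_right _ _
    linarith [cc_le_half_s hs]
  have h3 : (gam hs hs2 t).1 n = (gam hs hs2 t').1 n := by rw [h]
  rw [gam_coord hs hs2 ht, gam_coord hs hs2 ht', ff_id hs h1, ff_id hs h2] at h3
  exact (div_left_inj' hp.ne').mp h3

lemma C0_exists (hs : 1 < s) (hs2 : s < 2) {x : invLim s} (hx : x ∈ C0 s) :
    ∃ t, 0 ≤ t ∧ gam hs hs2 t = x := by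
  obtain ⟨n, hn⟩ := hx
  exact ⟨s ^ n * x.1 n, mul_nonneg (pow_pos (by linarith) n).le (K_nonneg x n), (eq_gam hs hs2 hn).symm⟩

/-- inverse of the ray parametrization -/
def gi (hs : 1 < s) (hs2 : s < 2) (x : invLim s) : ℝ :=
  open Classical in if h : x ∈ C0 s then (C0_exists hs hs2 h).choose else 0

lemma gi_nonneg (hs : 1 < s) (hs2 : s < 2) (x : invLim s) : 0 ≤ gi hs hs2 x := by
  unfold gi; split_ifs with h
  · exact (C0_exists hs hs2 h).choose_spec.1
  · exact le_rfl

lemma gam_gi (hs : 1 < s) (hs2 : s < 2) {x : invLim s} (hx : x ∈ C0 s) :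
    gam hs hs2 (gi hs hs2 x) = x := by
  unfold gi; rw [dif_pos hx]; exact (C0_exists hs hs2 hx).choose_spec.2

lemma gi_gam (hs : 1 < s) (hs2 : s < 2) {t : ℝ} (ht : 0 ≤ t) : gi hs hs2 (gam hs hs2 t) = t :=
  gam_inj hs hs2 (gi_nonneg hs hs2 _) ht (gam_gi hs hs2 (gam_mem hs hs2 t))

lemma gi_eq (hs : 1 < s) (hs2 : s < 2) {x : invLim s} {n : ℕ} (h : x.1 n < cc s) :
    gi hs hs2 x = s ^ n * x.1 n := by
  conv_lhs => rw [eq_gam hs hs2 h]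
  exact gi_gam hs hs2 (mul_nonneg (pow_pos (by linarith) n).le (K_nonneg x n))

lemma C0_open : IsOpen (C0 s) := by
  have : C0 s = ⋃ n, {x : invLim s | x.1 n < cc s} := by ext x; simp [C0]
  rw [this]
  exact isOpen_iUnion fun n => isOpen_lt (K_coord_cont n) continuous_const

lemma gi_cont (hs : 1 < s) (hs2 : s < 2) {x : invLim s} (hx : x ∈ C0 s) :
    ContinuousAt (gi hs hs2) x := by
  obtain ⟨n, hn⟩ := hx
  have h1 : ∀ᶠ y in 𝓝 x, y.1 n < cc s :=
    (isOpen_lt (K_coord_cont n) continuous_const).mem_nhds hn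
  have h2 : ContinuousAt (fun y : invLim s => s ^ n * y.1 n) x :=
    (continuous_const.mul (K_coord_cont n)).continuousAt
  exact h2.congr (h1.mono fun y hy => (gi_eq hs hs2 hy).symm)

/-- approximation of points outside of `C0` by the tail of the ray -/
lemma approx (hs : 1 < s) (hs2 : s < 2) {x : invLim s} (hx : x ∉ C0 s) :
    ∃ t : ℕ → ℝ, (∀ N, s ^ N * (s / 2) ≤ t N) ∧ (∀ N n, n ≤ N → (gam hs hs2 (t N)).1 n = x.1 n) := by
  have hx' : ∀ n, cc s ≤ x.1 n := by
    intro n; by_contra hc; push Not at hc; exact hx ⟨n, hc⟩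
  have key : ∀ N, ∃ r, s / 2 ≤ r ∧ ff s r = x.1 N := by
    intro N
    have hle : s / 2 ≤ s * (s / 2) := by nlinarith
    have h1 : ff s (s * (s / 2)) = cc s := by
      rw [ff_mul hs, ff_id hs le_rfl, tent_right hs (by linarith)]; rfl
    obtain ⟨r, hr, hre⟩ := intermediate_value_Icc' hle (ff_continuous hs).continuousOn
      (show x.1 N ∈ Icc (ff s (s * (s / 2))) (ff s (s / 2)) from
        ⟨by rw [h1]; exact hx' N, by rw [ff_id hs le_rfl]; exact K_le hs x N⟩)
    exact ⟨r, hr.1, hre⟩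
  choose r hr hre using key
  have hp : ∀ k, 0 < s ^ k := fun k => pow_pos (by linarith) k
  refine ⟨fun N => s ^ N * r N, fun N => mul_le_mul_of_nonneg_left (hr N) (hp N).le, ?_⟩
  intro N n hn
  refine K_agree ?_ hn
  have h0 : 0 ≤ s ^ N * r N := mul_nonneg (hp N).le (by linarith [hr N])
  rw [gam_coord hs hs2 h0, mul_div_cancel_left₀ _ (hp N).ne', hre]

lemma approx_tendsto {u : ℕ → invLim s} {x : invLim s} (h : ∀ N n, n ≤ N → (u N).1 n = x.1 n) :
    Tendsto u atTop (𝓝 x) := by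
  apply K_tendsto
  intro n
  apply tendsto_const_nhds.congr'
  filter_upwards [eventually_ge_atTop n] with N hN
  exact (h N n hN).symm

lemma pow_half_tendsto (hs : 1 < s) {t : ℕ → ℝ} (h : ∀ N, s ^ N * (s / 2) ≤ t N) :
    Tendsto t atTop atTop := by
  refine tendsto_atTop_mono h ?_
  exact (tendsto_pow_atTop_atTop_of_one_lt hs).atTop_mul_const (by linarith)

/-- approximation of all points -/
lemma approx_all (hs : 1 < s) (hs2 : s < 2) (x : invLim s) :
    ∃ t : ℕ → ℝ, (∀ N, 0 ≤ t N) ∧ Tendsto (fun N => gam hs hs2 (t N)) atTop (𝓝 x) := by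
  by_cases hx : x ∈ C0 s
  · obtain ⟨t, ht, he⟩ := C0_exists hs hs2 hx
    exact ⟨fun _ => t, fun _ => ht, by simp only [he]; exact tendsto_const_nhds⟩
  · obtain ⟨t, h1, h2⟩ := approx hs hs2 hx
    refine ⟨t, fun N => le_trans ?_ (h1 N), approx_tendsto h2⟩
    have := pow_pos (by linarith : 0 < s) N
    positivity

/-- two points outside `C0` -/
lemma two_points (hs : 1 < s) (hs2 : s < 2) : ∃ x y : invLim s, x ∉ C0 s ∧ y ∉ C0 s ∧ x ≠ y := by
  have hd : 0 < 1 + s ^ 2 := by positivity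
  set p := s / (1 + s ^ 2) with hp
  set q := s ^ 2 / (1 + s ^ 2) with hq
  have hp0 : 0 < p := by positivity
  have hq0 : 0 < q := by positivity
  have hp1 : p ≤ 1 / 2 := by
    rw [hp, div_le_iff₀ hd]; nlinarith [sq_nonneg (s - 1)]
  have hq1 : 1 / 2 < q := by rw [hq, lt_div_iff₀ hd]; nlinarith
  have hq2 : q ≤ 1 := by rw [hq, div_le_iff₀ hd]; linarith
  have tp : tent s p = q := by rw [tent_left hs hp1, hp, hq]; ring
  have tq : tent s q = p := by
    rw [tent_right hs hq1.le, hp, hq]; field_simp; ring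
  have hev : ∀ n, Even n ↔ ¬ Even (n + 1) := fun n => by rw [Nat.even_add_one]; simp
  let x : invLim s := ⟨fun n => if Even n then p else q, fun n => by
    dsimp only; split_ifs <;> constructor <;> linarith, fun n => by
    by_cases h : Even n
    · have h' := (hev n).mp h
      simp only [h, h', if_true, if_false]; exact tq.symm
    · have h' : Even (n + 1) := by by_contra hc; exact h ((hev n).mpr hc)
      simp only [h, h', if_true, if_false]; exact tp.symm⟩
  let y : invLim s := ⟨fun n => if Even n then q else p, fun n => by
    dsimp only; split_ifs <;> constructor <;> linarith, fun n => by
    by_cases h : Even n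
    · have h' := (hev n).mp h
      simp only [h, h', if_true, if_false]; exact tp.symm
    · have h' : Even (n + 1) := by by_contra hc; exact h ((hev n).mpr hc)
      simp only [h, h', if_true, if_false]; exact tq.symm⟩
  have gen : ∀ z : invLim s, (∀ n, z.1 (n + 2) = z.1 n) → (∀ n, 0 < z.1 n) → z ∉ C0 s := by
    rintro z hz hz0 ⟨n, hn⟩
    have h1 := (K_succ_lt hs hs2 hn 2).1
    rw [hz n] at h1
    have h2 := hz0 n
    have h3 : z.1 n * s ^ 2 = z.1 n := by
      rw [eq_div_iff (by positivity)] at h1; exact h1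
    have : 0 < z.1 n * (s^2-1) := mul_pos h2 (by nlinarith)
    linarith
  refine ⟨x, y, gen x ?_ ?_, gen y ?_ ?_, ?_⟩
  · intro n; by_cases h : Even n <;> simp [x, h, Nat.even_add]
  · intro n; simp only [x]; split_ifs <;> assumption
  · intro n; by_cases h : Even n <;> simp [y, h, Nat.even_add]
  · intro n; simp only [y]; split_ifs <;> assumption
  · intro h
    have : x.1 0 = y.1 0 := by rw [h]
    simp [x, y] at this
    linarith

lemma gam_zero_coord (hs : 1 < s) (hs2 : s < 2) (n : ℕ) : (gam hs hs2 0).1 n = 0 := by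
  rw [gam_coord hs hs2 le_rfl, zero_div, ff_id hs (by linarith)]

/-- a subcontinuum through the endpoint which leaves `C0` is everything -/
lemma cont_zero (hs : 1 < s) (hs2 : s < 2) {A : Set (invLim s)} (hAc : IsCompact A)
    (hAp : IsConnected A) (h0 : gam hs hs2 0 ∈ A) {y : invLim s} (hyA : y ∈ A) (hy : y ∉ C0 s) :
    A = univ := by
  have hy' : ∀ n, cc s ≤ y.1 n := by
    intro n; by_contra hc; push Not at hc; exact hy ⟨n, hc⟩
  have hinf : ∀ N, ∃ n, N ≤ n ∧ 1 / 2 < y.1 n := by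
    intro N
    by_contra hc
    push Not at hc
    have h1 : ∀ k, y.1 (N + k) = y.1 N / s ^ k := by
      intro k
      induction k with
      | zero => simp
      | succ k ih =>
        have h2 := K_rel y (N + k)
        rw [tent_left hs (hc _ (by omega)), ih] at h2
        rw [pow_succ, ← div_div, h2]
        field_simp; rfl
    obtain ⟨k, hk⟩ := gam_large hs hs2 (K_nonneg y N)
    rw [← h1 k] at hk
    linarith [hy' (N + k)]
  have hsub : ∀ n v, v ∈ Icc 0 (y.1 n) → ∃ a ∈ A, a.1 n = v := by
    intro n v hv
    have hc := hAp.isPreconnected.image (fun x : invLim s => x.1 n) (K_coord_cont n).continuousOn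
    have := hc.Icc_subset (mem_image_of_mem _ h0) (mem_image_of_mem _ hyA)
    rw [gam_zero_coord] at this
    obtain ⟨a, ha, hav⟩ := this hv
    exact ⟨a, ha, hav⟩
  have hfull : ∀ k m, (∀ v ∈ Icc 0 (s / 2), ∃ a ∈ A, a.1 (m + k) = v) →
      ∀ v ∈ Icc 0 (s / 2), ∃ a ∈ A, a.1 m = v := by
    intro k
    induction k with
    | zero => intro m h; exact h
    | succ k ih =>
      intro m h
      apply ih
      intro v hv
      obtain ⟨a, ha, hav⟩ := h (v / s) ⟨div_nonneg hv.1 (by linarith), by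
        rw [div_le_iff₀ (by linarith)]; nlinarith [hv.2]⟩
      refine ⟨a, ha, ?_⟩
      rw [K_rel a, show m + k + 1 = m + (k + 1) by ring, hav, tent_left hs (by
        rw [div_le_iff₀ (by linarith)]; linarith [hv.2])]
      field_simp
  have hall : ∀ m, ∀ v ∈ Icc 0 (s / 2), ∃ a ∈ A, a.1 m = v := by
    intro m
    obtain ⟨n, hn, hny⟩ := hinf (m + 1)
    obtain ⟨k, rfl⟩ := Nat.exists_eq_add_of_le hn
    apply hfull k m
    intro v hv
    obtain ⟨a, ha, hav⟩ := hsub (m + 1 + k) (v / s) ⟨div_nonneg hv.1 (by linarith), by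
        refine le_trans ?_ hny.le
        rw [div_le_iff₀ (by linarith)]; nlinarith [hv.2]⟩
    refine ⟨a, ha, ?_⟩
    rw [K_rel a, show m + k + 1 = m + 1 + k by ring, hav, tent_left hs (by
        rw [div_le_iff₀ (by linarith)]; linarith [hv.2])]
    field_simp
  apply eq_univ_of_forall
  intro x
  have hch : ∀ m, ∃ a ∈ A, a.1 m = x.1 m := fun m => hall m _ ⟨K_nonneg x m, K_le hs x m⟩
  choose a ha hax using hch
  have : Tendsto a atTop (𝓝 x) := approx_tendsto (fun N n hn => K_agree (hax N) hn)
  exact hAc.isClosed.mem_of_tendsto this (Eventually.of_forall ha)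

lemma comp_zero (hs : 1 < s) (hs2 : s < 2) : composant (gam hs hs2 0) = C0 s := by
  obtain ⟨p, _, hp, _, _⟩ := two_points hs hs2
  ext y
  constructor
  · rintro ⟨A, h1, h2, h3, h4, h5⟩
    by_contra hy
    exact h3 (cont_zero hs hs2 h1 h2 h4 h5 hy)
  · intro hy
    obtain ⟨t, ht, rfl⟩ := C0_exists hs hs2 hy
    refine ⟨gam hs hs2 '' Icc 0 t, isCompact_Icc.image (gam_cont hs hs2),
      (isConnected_Icc ht).image _ (gam_cont hs hs2).continuousOn, ?_,
      mem_image_of_mem _ ⟨le_rfl, ht⟩, mem_image_of_mem _ ⟨ht, le_rfl⟩⟩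
    intro he
    have : p ∈ gam hs hs2 '' Icc 0 t := by rw [he]; trivial
    obtain ⟨r, _, hr⟩ := this
    exact hp (hr ▸ gam_mem hs hs2 r)

lemma comp_symm {X : Type*} [TopologicalSpace X] {x y : X} (h : y ∈ composant x) : x ∈ composant y := by
  obtain ⟨A, h1, h2, h3, h4, h5⟩ := h
  exact ⟨A, h1, h2, h3, h5, h4⟩

lemma comp_nonzero (hs : 1 < s) (hs2 : s < 2) {x y : invLim s} (hx : x ≠ gam hs hs2 0)
    (hy : y ≠ gam hs hs2 0) : y ∈ composant x := by
  have key : ∀ x : invLim s, x ≠ gam hs hs2 0 → ∃ T > 0, ∀ T' > 0, T' ≤ T →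
      x ∈ closure (gam hs hs2 '' Ici T') := by
    intro x hx
    by_cases hxC : x ∈ C0 s
    · obtain ⟨t, ht, rfl⟩ := C0_exists hs hs2 hxC
      refine ⟨t, ht.lt_of_ne (fun h => hx (by rw [← h])), fun T' _ hT' => ?_⟩
      exact subset_closure (mem_image_of_mem _ hT')
    · refine ⟨1, one_pos, fun T' _ _ => ?_⟩
      obtain ⟨t, h1, h2⟩ := approx hs hs2 hxC
      refine mem_closure_of_tendsto (approx_tendsto h2) ?_
      filter_upwards [(pow_half_tendsto hs h1).eventually_ge_atTop T'] with N hN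
      exact mem_image_of_mem _ hN
  obtain ⟨T1, hT1, k1⟩ := key x hx
  obtain ⟨T2, hT2, k2⟩ := key y hy
  set T := min T1 T2 with hT
  have hTp : 0 < T := lt_min hT1 hT2
  refine ⟨closure (gam hs hs2 '' Ici T), isClosed_closure.isCompact, ?_, ?_,
    k1 T hTp (min_le_left _ _), k2 T hTp (min_le_right _ _)⟩
  · exact (isConnected_Ici.image _ (gam_cont hs hs2).continuousOn).closure
  · intro he
    have hc := cc_pos hs hs2
    have hsub : closure (gam hs hs2 '' Ici T) ⊆ {x : invLim s | min T (cc s) ≤ x.1 0} := by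
      apply closure_minimal
      · rintro _ ⟨t, ht, rfl⟩
        have ht' : T ≤ t := ht
        simp only [mem_setOf_eq]
        rw [gam_coord hs hs2 (by linarith)]
        simp only [pow_zero, div_one]
        rcases le_total t (s / 2) with h | h
        · rw [ff_id hs h]; exact (min_le_left _ _).trans ht'
        · exact (min_le_right _ _).trans (ff_core hs hs2 ((cc_le_half_s hs).trans h))
      · exact isClosed_le continuous_const (K_coord_cont 0)
    have : gam hs hs2 0 ∈ {x : invLim s | min T (cc s) ≤ x.1 0} := hsub (by rw [he]; trivial)
    simp only [mem_setOf_eq, gam_zero_coord] at this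
    linarith [lt_min hTp hc]

lemma comp_of_C0 (hs : 1 < s) (hs2 : s < 2) {x : invLim s} (hx : x ≠ gam hs hs2 0) (hxC : x ∈ C0 s) :
    composant x = univ := by
  apply eq_univ_of_forall
  intro y
  by_cases hy : y = gam hs hs2 0
  · rw [hy]; apply comp_symm; rw [comp_zero]; exact hxC
  · exact comp_nonzero hs hs2 hx hy

lemma comp_of_not_C0 (hs : 1 < s) (hs2 : s < 2) {x : invLim s} (hxC : x ∉ C0 s) :
    composant x = {gam hs hs2 0}ᶜ := by
  have hx : x ≠ gam hs hs2 0 := fun h => hxC (h ▸ gam_mem hs hs2 0)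
  ext y
  by_cases hy : y = gam hs hs2 0
  · simp only [hy, mem_compl_iff, mem_singleton_iff, not_true, iff_false]
    intro h
    have := comp_symm h
    rw [comp_zero] at this
    exact hxC this
  · simp only [mem_compl_iff, mem_singleton_iff, hy, not_false_iff, iff_true]
    exact comp_nonzero hs hs2 hx hy

lemma comp_image {X : Type*} [TopologicalSpace X] (g : X ≃ₜ X) (x : X) :
    g '' composant x = composant (g x) := by
  have key : ∀ (g : X ≃ₜ X) x y, y ∈ composant x → g y ∈ composant (g x) := by
    rintro g x y ⟨A, h1, h2, h3, h4, h5⟩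
    refine ⟨g '' A, h1.image g.continuous, h2.image _ g.continuous.continuousOn, ?_,
      mem_image_of_mem _ h4, mem_image_of_mem _ h5⟩
    intro he
    apply h3
    rw [← g.injective.preimage_image A, he, preimage_univ]
  ext z
  constructor
  · rintro ⟨y, hy, rfl⟩; exact key g x y hy
  · intro hz
    refine ⟨g.symm z, ?_, by simp⟩
    have := key g.symm _ _ hz
    simpa using this

lemma homeo_zero (hs : 1 < s) (hs2 : s < 2) (g : invLim s ≃ₜ invLim s) :
    g (gam hs hs2 0) = gam hs hs2 0 := by
  by_contra hne
  obtain ⟨x, y, hx, hy, hxy⟩ := two_points hs hs2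
  have h1 := comp_image g (gam hs hs2 0)
  rw [comp_zero] at h1
  have key : ∀ z, z ∉ C0 s → g z = gam hs hs2 0 := by
    intro z hz
    by_contra hc
    have := comp_nonzero hs hs2 hne hc
    rw [← h1] at this
    obtain ⟨w, hw, hwz⟩ := this
    exact hz (g.injective hwz ▸ hw)
  exact hxy (g.injective ((key x hx).trans (key y hy).symm))

lemma homeo_C0 (hs : 1 < s) (hs2 : s < 2) (g : invLim s ≃ₜ invLim s) (x : invLim s) :
    g x ∈ C0 s ↔ x ∈ C0 s := by
  have h1 := comp_image g (gam hs hs2 0)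
  rw [homeo_zero, comp_zero] at h1
  constructor
  · intro h
    rw [← h1] at h
    obtain ⟨w, hw, hwz⟩ := h
    exact g.injective hwz ▸ hw
  · intro h
    rw [← h1]; exact mem_image_of_mem _ h

lemma homeo_comp (hs : 1 < s) (hs2 : s < 2) (g : invLim s ≃ₜ invLim s) (x : invLim s) :
    g '' composant x = composant x := by
  rw [comp_image]
  by_cases hx : x = gam hs hs2 0
  · rw [hx, homeo_zero]
  by_cases hC : x ∈ C0 s
  · rw [comp_of_C0 hs hs2 hx hC, comp_of_C0 hs hs2 _ ((homeo_C0 hs hs2 g x).mpr hC)]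
    intro h
    exact hx (g.injective (h.trans (homeo_zero hs hs2 g).symm))
  · rw [comp_of_not_C0 hs hs2 hC, comp_of_not_C0 hs hs2 (fun h => hC ((homeo_C0 hs hs2 g x).mp h))]

end KBasics
section Paths
variable {s : ℝ}

lemma no_path_lt (hs : 1 < s) (hs2 : s < 2) {P : ℝ → invLim s} (hP : Continuous P) {a b : ℝ}
    (hab : a < b) (ha : P a ∈ C0 s) (hb : P b ∉ C0 s) : False := by
  set S := P ⁻¹' (C0 s)ᶜ ∩ Icc a b with hS
  have hSc : IsCompact S := isCompact_Icc.inter_left (C0_open.isClosed_compl.preimage hP)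
  have hSn : S.Nonempty := ⟨b, hb, hab.le, le_rfl⟩
  have hb' := hSc.sInf_mem hSn
  set b' := sInf S with hb'd
  have hlow : ∀ t, a ≤ t → t < b' → P t ∈ C0 s := by
    intro t h1 h2
    by_contra hc
    have : b' ≤ t := csInf_le hSc.bddBelow ⟨hc, h1, le_trans h2.le hb'.2.2⟩
    linarith
  have hab' : a < b' := lt_of_le_of_ne hb'.2.1 (fun h => hb'.1 (by rw [← h]; exact ha))
  have hPb : P b' ∉ C0 s := hb'.1
  have hunb : ∀ M, ∃ c, c < b' ∧ ∀ t, c < t → t < b' → P t ∉ gam hs hs2 '' Icc 0 M := by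
    intro M
    have hcl : IsClosed (gam hs hs2 '' Icc 0 M) :=
      (isCompact_Icc.image (gam_cont hs hs2)).isClosed
    have hn : P b' ∈ (gam hs hs2 '' Icc 0 M)ᶜ := by
      rintro ⟨u, -, hu⟩; exact hPb (by rw [← hu]; exact gam_mem hs hs2 u)
    have hm := hP.continuousAt.preimage_mem_nhds (hcl.isOpen_compl.mem_nhds hn)
    obtain ⟨c, hc, hc'⟩ := exists_Ioc_subset_of_mem_nhds hm ⟨a, hab'⟩
    exact ⟨c, hc, fun t h1 h2 => hc' ⟨h1, h2.le⟩⟩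
  have hx : ∃ x, x ∉ C0 s ∧ x ≠ P b' := by
    obtain ⟨x, y, h1, h2, h3⟩ := two_points hs hs2
    by_cases h : x = P b'
    · exact ⟨y, h2, fun h' => h3 (h.trans h'.symm)⟩
    · exact ⟨x, h1, h⟩
  obtain ⟨x, hxC, hxne⟩ := hx
  obtain ⟨τ, hτ, hτ'⟩ := approx hs hs2 hxC
  have hl1 := approx_tendsto hτ'
  have hl2 := pow_half_tendsto hs hτ
  obtain ⟨U, V, hU, hV, hxU, hV', hd⟩ := t2_separation hxne
  obtain ⟨c, hc, hc'⟩ := exists_Ioc_subset_of_mem_nhds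
    (hP.continuousAt.preimage_mem_nhds (hV.mem_nhds hV')) ⟨a, hab'⟩
  obtain ⟨t1, ht1, ht1'⟩ := exists_between (max_lt hc hab')
  obtain ⟨N, hN1, hN2⟩ := ((hl1.eventually (hU.mem_nhds hxU)).and
    (hl2.eventually (eventually_ge_atTop (gi hs hs2 (P t1))))).exists
  obtain ⟨c2, hc2, hc2'⟩ := hunb (τ N)
  obtain ⟨t2, ht2, ht2'⟩ := exists_between (max_lt hc2 ht1')
  have ha1 : a < t1 := lt_of_le_of_lt (le_max_right _ _) ht1
  have hcc1 : c < t1 := lt_of_le_of_lt (le_max_left _ _) ht1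
  have h12 : t1 < t2 := lt_of_le_of_lt (le_max_right _ _) ht2
  have hφ : ContinuousOn (fun t => gi hs hs2 (P t)) (Icc t1 t2) := by
    intro t ht
    exact (ContinuousAt.comp (f := P) (gi_cont hs hs2 (hlow t (by linarith [ht.1]) (by linarith [ht.2])))
      hP.continuousAt).continuousWithinAt
  have hle : τ N ≤ gi hs hs2 (P t2) := by
    by_contra h; push Not at h
    refine hc2' t2 (lt_of_le_of_lt (le_max_left _ _) ht2) ht2' ⟨_, ⟨gi_nonneg hs hs2 _, h.le⟩,
      gam_gi hs hs2 (hlow t2 (by linarith) ht2')⟩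
  obtain ⟨t, ht, hte⟩ := intermediate_value_Icc h12.le hφ ⟨hN2, hle⟩
  have h1 : P t ∈ V := hc' ⟨by linarith [ht.1], by linarith [ht.2]⟩
  have h2 : P t = gam hs hs2 (τ N) := by
    rw [← hte]; exact (gam_gi hs hs2 (hlow t (by linarith [ht.1]) (by linarith [ht.2]))).symm
  rw [h2] at h1
  exact hd.le_bot ⟨hN1, h1⟩

lemma no_path (hs : 1 < s) (hs2 : s < 2) {P : ℝ → invLim s} (hP : Continuous P) {a b : ℝ}
    (ha : P a ∈ C0 s) (hb : P b ∉ C0 s) : False := by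
  rcases lt_trichotomy a b with h | h | h
  · exact no_path_lt hs hs2 hP h ha hb
  · rw [h] at ha; exact hb ha
  · exact no_path_lt hs hs2 (P := fun t => P (-t)) (hP.comp continuous_neg) (neg_lt_neg h)
      (by simpa using ha) (by simpa using hb)

/-- the induced map on the half line -/
def HH (hs : 1 < s) (hs2 : s < 2) (e : invLim s → invLim s) (t : ℝ) : ℝ :=
  gi hs hs2 (e (gam hs hs2 t)) + min t 0

lemma HH_pos (hs : 1 < s) (hs2 : s < 2) (e : invLim s → invLim s) {t : ℝ} (ht : 0 ≤ t) :
    HH hs hs2 e t = gi hs hs2 (e (gam hs hs2 t)) := by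
  rw [HH, min_eq_right ht, add_zero]

lemma HH_nonneg (hs : 1 < s) (hs2 : s < 2) (e : invLim s → invLim s) {t : ℝ} (ht : 0 ≤ t) :
    0 ≤ HH hs hs2 e t := by
  rw [HH_pos hs hs2 e ht]; exact gi_nonneg _ _ _

lemma gi_zero (hs : 1 < s) (hs2 : s < 2) : gi hs hs2 (gam hs hs2 0) = 0 := gi_gam hs hs2 le_rfl

lemma HH_neg (hs : 1 < s) (hs2 : s < 2) (e : invLim s ≃ₜ invLim s) {t : ℝ} (ht : t ≤ 0) :
    HH hs hs2 e t = t := by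
  rw [HH, min_eq_left ht, gam_neg hs hs2 ht, homeo_zero, gi_zero, zero_add]

lemma gam_HH (hs : 1 < s) (hs2 : s < 2) (e : invLim s ≃ₜ invLim s) {t : ℝ} (ht : 0 ≤ t) :
    gam hs hs2 (HH hs hs2 e t) = e (gam hs hs2 t) := by
  rw [HH_pos hs hs2 e ht]
  exact gam_gi hs hs2 ((homeo_C0 hs hs2 e _).mpr (gam_mem hs hs2 t))

lemma HH_symm (hs : 1 < s) (hs2 : s < 2) (e : invLim s ≃ₜ invLim s) {t : ℝ} (ht : 0 ≤ t) :
    HH hs hs2 e.symm (HH hs hs2 e t) = t := by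
  rw [HH_pos hs hs2 e.symm (HH_nonneg hs hs2 e ht), gam_HH hs hs2 e ht, e.symm_apply_apply,
    gi_gam hs hs2 ht]

lemma HH_cont (hs : 1 < s) (hs2 : s < 2) (e : invLim s ≃ₜ invLim s) : Continuous (HH hs hs2 e) := by
  refine Continuous.add ?_ (continuous_id.min continuous_const)
  rw [continuous_iff_continuousAt]
  intro t
  exact ContinuousAt.comp (f := fun t => e (gam hs hs2 t))
    (gi_cont hs hs2 ((homeo_C0 hs hs2 e _).mpr (gam_mem hs hs2 t)))
    (e.continuous.comp (gam_cont hs hs2)).continuousAt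

lemma mono_of_half {f : ℝ → ℝ} (hc : Continuous f) (hn : ∀ t, t ≤ 0 → f t = t)
    (hp : ∀ t, 0 ≤ t → 0 ≤ f t) (hi : ∀ t t', 0 ≤ t → 0 ≤ t' → f t = f t' → t = t') :
    StrictMono f := by
  have hinj : Injective f := by
    intro t t' h
    rcases le_total 0 t with h1 | h1 <;> rcases le_total 0 t' with h2 | h2
    · exact hi t t' h1 h2 h
    · have := hp t h1
      have h3 : t' = 0 := by rw [h, hn t' h2] at this; linarith
      subst h3; exact hi t 0 h1 le_rfl h
    · have := hp t' h2
      have h3 : t = 0 := by rw [← h, hn t h1] at this; linarith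
      subst h3; exact hi 0 t' le_rfl h2 h
    · rw [hn t h1, hn t' h2] at h; exact h
  rcases hc.strictMono_of_inj hinj with h | h
  · exact h
  · have := h (show (-1 : ℝ) < 0 by norm_num)
    rw [hn 0 le_rfl, hn (-1) (by norm_num)] at this; linarith

lemma HH_mono (hs : 1 < s) (hs2 : s < 2) (e : invLim s ≃ₜ invLim s) : StrictMono (HH hs hs2 e) := by
  apply mono_of_half (HH_cont hs hs2 e) (fun t ht => HH_neg hs hs2 e ht)
    (fun t ht => HH_nonneg hs hs2 e ht)
  intro t t' h1 h2 h
  have := congrArg (HH hs hs2 e.symm) h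
  rwa [HH_symm hs hs2 e h1, HH_symm hs hs2 e h2] at this

lemma pco (hs : 1 < s) (hs2 : s < 2) (g : invLim s ≃ₜ invLim s) : PreservesCompOrder g := by
  intro x
  have hC : composant x = C0 s ∨ ((∃ y ∈ composant x, y ∈ C0 s) ∧ ∃ y ∈ composant x, y ∉ C0 s) := by
    obtain ⟨p, q, hp, hq, hpq⟩ := two_points hs hs2
    by_cases hx0 : x = gam hs hs2 0
    · left; rw [hx0]; exact comp_zero hs hs2
    right
    have h1 : gam hs hs2 1 ≠ gam hs hs2 0 := fun h => by
      have := gam_inj hs hs2 (by norm_num) le_rfl h; norm_num at this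
    have h2 : p ≠ gam hs hs2 0 := fun h => hp (by rw [h]; exact gam_mem hs hs2 0)
    exact ⟨⟨_, comp_nonzero hs hs2 hx0 h1, gam_mem hs hs2 1⟩, ⟨_, comp_nonzero hs hs2 hx0 h2, hp⟩⟩
  constructor
  · intro φ hφ hi hr
    exfalso
    rcases hC with hC | ⟨⟨y, hy, hy'⟩, z, hz, hz'⟩
    · have hm : ∀ t, φ t ∈ C0 s := fun t => by rw [← hC, ← hr]; exact mem_range_self t
      have hc : Continuous (fun t => gi hs hs2 (φ t)) := by
        rw [continuous_iff_continuousAt]; intro t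
        exact ContinuousAt.comp (f := φ) (gi_cont hs hs2 (hm t)) hφ.continuousAt
      have hinj : Injective (fun t => gi hs hs2 (φ t)) := by
        intro t t' h
        apply hi
        rw [← gam_gi hs hs2 (hm t), ← gam_gi hs hs2 (hm t')]
        exact congrArg _ h
      have h0 : gam hs hs2 0 ∈ range φ := by rw [hr, hC]; exact gam_mem hs hs2 0
      obtain ⟨t0, ht0⟩ := h0
      have e0 : gi hs hs2 (φ t0) = 0 := by rw [ht0, gi_zero]
      rcases hc.strictMono_of_inj hinj with h | h
      · have := h (show t0 - 1 < t0 by linarith)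
        simp only [e0] at this
        linarith [gi_nonneg hs hs2 (φ (t0 - 1))]
      · have := h (show t0 < t0 + 1 by linarith)
        simp only [e0] at this
        linarith [gi_nonneg hs hs2 (φ (t0 + 1))]
    · rw [← hr] at hy hz
      obtain ⟨a, rfl⟩ := hy
      obtain ⟨b, rfl⟩ := hz
      exact no_path hs hs2 hφ hy' hz'
  · intro φ hφ hi hr
    set ψ : ℝ → invLim s := fun t => φ ⟨max t 0, le_max_right _ _⟩ with hψ
    have hψc : Continuous ψ := hφ.comp (Continuous.subtype_mk (continuous_id.max continuous_const) _)
    have hψφ : ∀ r : {r : ℝ // (0 : ℝ) ≤ r}, ψ r.1 = φ r := by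
      intro r; simp only [hψ]; congr 1; exact Subtype.ext (max_eq_left r.2)
    rcases hC with hC | ⟨⟨y, hy, hy'⟩, z, hz, hz'⟩
    · have hm : ∀ t, φ t ∈ C0 s := fun t => by rw [← hC, ← hr]; exact mem_range_self t
      have hinj0 : ∀ t t', gi hs hs2 (φ t) = gi hs hs2 (φ t') → t = t' := by
        intro t t' h
        apply hi
        rw [← gam_gi hs hs2 (hm t), ← gam_gi hs hs2 (hm t')]
        exact congrArg _ h
      -- value at zero
      have hF : StrictMono (fun r : {r : ℝ // (0 : ℝ) ≤ r} => gi hs hs2 (φ r)) := by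
        set f : ℝ → ℝ := fun t => gi hs hs2 (ψ t) + min t 0 with hf
        have hfc0 : Continuous (fun t => gi hs hs2 (ψ t)) := by
          rw [continuous_iff_continuousAt]; intro t
          exact ContinuousAt.comp (f := ψ) (gi_cont hs hs2 (hm _)) hψc.continuousAt
        have h0 : gam hs hs2 0 ∈ range φ := by rw [hr, hC]; exact gam_mem hs hs2 0
        obtain ⟨t0, ht0⟩ := h0
        have e0 : gi hs hs2 (φ t0) = 0 := by rw [ht0, gi_zero]
        have t00 : t0.1 = 0 := by
          by_contra hne
          have hpos : 0 < t0.1 := lt_of_le_of_ne t0.2 (Ne.symm hne)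
          -- points around t0
          have hA : 0 < gi hs hs2 (ψ 0) := by
            refine lt_of_le_of_ne (gi_nonneg _ _ _) (fun h => ?_)
            have := hinj0 t0 ⟨max 0 0, le_max_right _ _⟩ (by rw [e0]; exact h)
            rw [this] at hpos; simp at hpos
          have hB : 0 < gi hs hs2 (ψ (t0.1 + 1)) := by
            refine lt_of_le_of_ne (gi_nonneg _ _ _) (fun h => ?_)
            have := hinj0 t0 ⟨max (t0.1 + 1) 0, le_max_right _ _⟩ (by rw [e0]; exact h)
            have := congrArg Subtype.val this
            simp only at this
            rw [max_eq_left (by linarith)] at this; linarith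
          set v := min (gi hs hs2 (ψ 0)) (gi hs hs2 (ψ (t0.1 + 1))) with hv
          have hv0 : 0 < v := lt_min hA hB
          have e0' : gi hs hs2 (ψ t0.1) = 0 := by rw [hψφ, e0]
          obtain ⟨a, ha, hae⟩ := intermediate_value_Icc' hpos.le hfc0.continuousOn
            (show v ∈ Icc _ _ from ⟨by simp only [e0']; exact hv0.le, min_le_left _ _⟩)
          obtain ⟨b, hb, hbe⟩ := intermediate_value_Icc (show t0.1 ≤ t0.1 + 1 by linarith)
            hfc0.continuousOn
            (show v ∈ Icc _ _ from ⟨by simp only [e0']; exact hv0.le, min_le_right _ _⟩)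
          have hab := hinj0 _ _ (hae.trans hbe.symm)
          have hab := congrArg Subtype.val hab
          simp only at hab
          rw [max_eq_left ha.1, max_eq_left (by linarith [hb.1])] at hab
          have : a = t0.1 := le_antisymm ha.2 (hab ▸ hb.1)
          simp only [this, e0'] at hae
          linarith
        have e00 : gi hs hs2 (ψ 0) = 0 := by
          have := hψφ t0
          rw [t00] at this; rw [this, e0]
        have hfm : StrictMono f := by
          apply mono_of_half (f := f) (hfc0.add (continuous_id.min continuous_const))
          · intro t ht
            have : ψ t = ψ 0 := by
              simp only [hψ]; congr 1; exact Subtype.ext (by simpa using ht)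
            simp only [hf, this, e00, min_eq_left ht, zero_add]
          · intro t ht
            simp only [hf, min_eq_right ht, add_zero]; exact gi_nonneg _ _ _
          · intro t t' h1 h2 h
            simp only [hf, min_eq_right h1, min_eq_right h2, add_zero] at h
            have : max t 0 = max t' 0 := congrArg Subtype.val (hinj0 _ _ h)
            rwa [max_eq_left h1, max_eq_left h2] at this
        intro r r' hrr
        have := hfm (show r.1 < r'.1 from hrr)
        simp only [hf, min_eq_right r.2, min_eq_right r'.2, add_zero, hψφ] at this
        exact this
      intro t t' u u' hu hu' htt
      rw [← hF.lt_iff_lt, ← hu, ← hu']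
      have h1 := HH_mono hs hs2 g (hF htt)
      simp only at h1
      rwa [HH_pos hs hs2 g (gi_nonneg _ _ _), HH_pos hs hs2 g (gi_nonneg _ _ _),
        gam_gi hs hs2 (hm t), gam_gi hs hs2 (hm t')] at h1
    · exfalso
      rw [← hr] at hy hz
      obtain ⟨a, rfl⟩ := hy
      obtain ⟨b, rfl⟩ := hz
      rw [← hψφ] at hy' hz'
      exact no_path hs hs2 hψc hy' hz'

/-- uniform continuity in coordinates -/
lemma UC (hs : 1 < s) (e : invLim s → invLim s) (he : Continuous e) (p : ℕ) {ε : ℝ} (hε : 0 < ε) :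
    ∃ (q : ℕ) (η : ℝ), 0 < η ∧ ∀ x y : invLim s, |x.1 q - y.1 q| ≤ η → |(e x).1 p - (e y).1 p| < ε := by
  by_contra hc
  push Not at hc
  have hs0 : 0 < s := by linarith
  have hq : ∀ q : ℕ, ∃ z : invLim s × invLim s, |z.1.1 q - z.2.1 q| ≤ 1 / (s ^ q) ^ 2 ∧
      ε ≤ |(e z.1).1 p - (e z.2).1 p| := by
    intro q
    obtain ⟨x, y, h1, h2⟩ := hc q (1 / (s ^ q) ^ 2) (by positivity)
    exact ⟨(x, y), h1, h2⟩
  choose z hz1 hz2 using hq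
  obtain ⟨w, -, φ, hφ, hw⟩ := (isCompact_univ (X := invLim s × invLim s)).tendsto_subseq
    (x := z) (fun n => mem_univ _)
  have hw1 : Tendsto (fun n => (z (φ n)).1) atTop (𝓝 w.1) := (continuous_fst.tendsto w).comp hw
  have hw2 : Tendsto (fun n => (z (φ n)).2) atTop (𝓝 w.2) := (continuous_snd.tendsto w).comp hw
  have heq : w.1 = w.2 := by
    apply K_ext
    intro i
    refine ⟨i, le_rfl, ?_⟩
    have l1 := ((K_coord_cont i).tendsto w.1).comp hw1
    have l2 := ((K_coord_cont i).tendsto w.2).comp hw2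
    have l3 := (l1.sub l2).abs
    have l4 : Tendsto (fun n => |((fun x : invLim s => x.1 i) ∘ fun n => (z (φ n)).1) n -
        ((fun x : invLim s => x.1 i) ∘ fun n => (z (φ n)).2) n|) atTop (𝓝 0) := by
      have lt : Tendsto (fun n => 1 / s ^ (φ n)) atTop (𝓝 0) := by
        have := (tendsto_pow_atTop_nhds_zero_of_lt_one (by positivity : 0 ≤ 1 / s)
          (by rw [div_lt_one hs0]; exact hs)).comp hφ.tendsto_atTop
        refine this.congr (fun n => ?_)
        simp [comp]
      refine tendsto_of_tendsto_of_tendsto_of_le_of_le' tendsto_const_nhds lt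
        (Eventually.of_forall fun n => abs_nonneg _) ?_
      filter_upwards [eventually_ge_atTop i] with n hn
      have hin : i ≤ φ n := le_trans hn hφ.le_apply
      simp only [comp]
      obtain ⟨k, hk⟩ := Nat.exists_eq_add_of_le hin
      rw [K_iter (z (φ n)).1 i k, K_iter (z (φ n)).2 i k, ← hk]
      have h1 := tent_iter_lip hs k ((z (φ n)).1.1 (φ n)) ((z (φ n)).2.1 (φ n))
      have h2 := hz1 (φ n)
      have h3 : s ^ k ≤ s ^ (φ n) := pow_le_pow_right₀ hs.le (by omega)
      have h4 : 0 < s ^ (φ n) := by positivity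
      calc _ ≤ s ^ k * _ := h1
        _ ≤ s ^ (φ n) * (1 / (s ^ (φ n)) ^ 2) := by gcongr
        _ = _ := by field_simp
    have := tendsto_nhds_unique l3 l4
    have := abs_eq_zero.mp this
    linarith
  have l1 := (((K_coord_cont p).comp he).tendsto w.1).comp hw1
  have l2 := (((K_coord_cont p).comp he).tendsto w.2).comp hw2
  have l3 := ge_of_tendsto' (l1.sub l2).abs (fun n => hz2 (φ n))
  rw [heq, sub_self, abs_zero] at l3
  linarith

end Paths
section Build
variable {s : ℝ}

lemma exists_NR (hs : 1 < s) (hnr : (1 : ℝ) / 2 ∉ omegaSet (tent s) (1 / 2)) : ∃ δ, NR s δ := by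
  have hper : ∀ k : ℕ, 1 ≤ k → (tent s)^[k] (1 / 2) ≠ 1 / 2 := by
    intro k hk h
    refine hnr ⟨fun n => k * n, fun a b hab => Nat.mul_lt_mul_of_pos_left hab (by omega), ?_⟩
    have : ∀ n : ℕ, (tent s)^[k * n] (1 / 2) = 1 / 2 := by
      intro n
      rw [iterate_mul]
      exact iterate_fixed h n
    simp only [this]
    exact tendsto_const_nhds
  have hcl : ∃ ε > 0, ∃ N : ℕ, ∀ k, N ≤ k → ε ≤ |(tent s)^[k] (1 / 2) - 1 / 2| := by
    by_contra hc
    push Not at hc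
    have : MapClusterPt (1 / 2 : ℝ) atTop (fun k : ℕ => (tent s)^[k] (1 / 2)) := by
      rw [Metric.nhds_basis_ball.mapClusterPt_iff_frequently]
      intro ε hε
      rw [frequently_atTop]
      intro N
      obtain ⟨k, hk, hk'⟩ := hc ε hε N
      exact ⟨k, hk, by rw [Metric.mem_ball, Real.dist_eq]; exact hk'⟩
    obtain ⟨ψ, h1, h2⟩ := TopologicalSpace.FirstCountableTopology.tendsto_subseq this
    exact hnr ⟨ψ, h1, h2⟩
  obtain ⟨ε, hε, N, hN⟩ := hcl
  have hfin : ∀ M : ℕ, ∃ δ > 0, ∀ k, 1 ≤ k → k < M → δ ≤ |(tent s)^[k] (1 / 2) - 1 / 2| := by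
    intro M
    induction M with
    | zero => exact ⟨1, one_pos, fun k _ h => absurd h (by omega)⟩
    | succ M ih =>
      obtain ⟨δ, hδ, h⟩ := ih
      by_cases hM : 1 ≤ M
      · refine ⟨min δ |(tent s)^[M] (1 / 2) - 1 / 2|, lt_min hδ
          (abs_pos.mpr (sub_ne_zero.mpr (hper M hM))), fun k h1 h2 => ?_⟩
        by_cases hk : k = M
        · rw [hk]; exact min_le_right _ _
        · exact (min_le_left _ _).trans (h k h1 (by omega))
      · exact ⟨δ, hδ, fun k h1 h2 => absurd h2 (by omega)⟩
  obtain ⟨δ, hδ, h⟩ := hfin N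
  refine ⟨min (min δ ε) (1 / 4), lt_min (lt_min hδ hε) (by norm_num), min_le_right _ _, ?_⟩
  intro k hk
  refine (min_le_left _ _).trans ?_
  by_cases hkN : k < N
  · exact (min_le_left _ _).trans (h k hk hkN)
  · exact (min_le_right _ _).trans (hN k (by omega))

/-- uniform continuity of the induced map, one sided -/
lemma U1 {δ : ℝ} (hs : 1 < s) (hs2 : s < 2) (hN : NR s δ) (e : invLim s ≃ₜ invLim s) {ε : ℝ}
    (hε : 0 < ε) : ∃ η > 0, ∀ t t', 0 ≤ t → t ≤ t' → t' - t ≤ η →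
      HH hs hs2 e t' - HH hs hs2 e t ≤ ε := by
  set ε' := min ε δ / 8 with he
  have hε' : 0 < ε' := by have := lt_min hε hN.pos; positivity
  have h1 : 8 * ε' ≤ ε := by have := min_le_left ε δ; linarith
  have h2 : 8 * ε' ≤ δ := by have := min_le_right ε δ; linarith
  obtain ⟨q, η, hη, hq⟩ := UC hs e e.continuous 0 hε'
  refine ⟨η, hη, fun t t' ht htt hd => ?_⟩
  by_contra hc
  push Not at hc
  set x := HH hs hs2 e t with hx
  have hx0 : 0 ≤ x := HH_nonneg hs hs2 e ht
  have key : ∀ v, 0 ≤ v → v ≤ 4 * ε' → |ff s (x + v) - ff s x| < ε' := by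
    intro v hv0 hv
    obtain ⟨u, hu, hue⟩ := intermediate_value_Icc htt (HH_cont hs hs2 e).continuousOn
      (show x + v ∈ Icc _ _ from ⟨by linarith, by linarith⟩)
    have hu0 : 0 ≤ u := ht.trans hu.1
    have h3 := hq (gam hs hs2 u) (gam hs hs2 t) (by
      rw [gam_coord hs hs2 hu0, gam_coord hs hs2 ht]
      refine (ff_lip hs _ _).trans ?_
      have hp1 : 1 ≤ s ^ q := one_le_pow₀ hs.le
      rw [← sub_div, abs_div, abs_of_pos (by linarith : 0 < s ^ q), abs_of_nonneg (by linarith [hu.1])]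
      rw [div_le_iff₀ (by linarith)]
      nlinarith [hu.1, hu.2])
    rw [← gam_HH hs hs2 e hu0, ← gam_HH hs hs2 e ht, hue, gam_coord hs hs2 (by linarith),
      gam_coord hs hs2 hx0, pow_zero, div_one, div_one] at h3
    exact h3
  obtain ⟨t0, e0, σ, hσ, ht0, hf, -⟩ := form hs hN x (x + 4 * ε') (by linarith) (by linarith)
  have k1 := key (4 * ε') (by linarith) le_rfl
  have k2 := key (t0 - x) (by linarith [ht0.1]) (by linarith [ht0.2])
  rw [add_sub_cancel] at k2
  rw [hf t0 ht0, hf x ⟨le_rfl, by linarith⟩, sub_self, abs_zero] at k2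
  rw [hf _ ⟨by linarith, le_rfl⟩, hf x ⟨le_rfl, by linarith⟩] at k1
  rw [abs_of_nonpos (by linarith [ht0.1] : x - t0 ≤ 0)] at k1 k2
  rw [abs_of_nonneg (by linarith [ht0.2] : 0 ≤ x + 4 * ε' - t0)] at k1
  rw [abs_lt] at k1 k2
  rcases hσ with rfl | rfl <;> linarith [k1.1, k1.2, k2.1, k2.2]

lemma U2 {δ : ℝ} (hs : 1 < s) (hs2 : s < 2) (hN : NR s δ) (e : invLim s ≃ₜ invLim s) {ε : ℝ}
    (hε : 0 < ε) : ∃ η > 0, ∀ t t', 0 ≤ t → 0 ≤ t' → |t - t'| ≤ η →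
      |HH hs hs2 e t - HH hs hs2 e t'| ≤ ε := by
  obtain ⟨η, hη, h⟩ := U1 hs hs2 hN e hε
  refine ⟨η, hη, fun t t' ht ht' hd => ?_⟩
  rcases le_total t t' with h1 | h1
  · have h2 := (HH_mono hs hs2 e).monotone h1
    rw [abs_sub_comm, abs_of_nonneg (by linarith)] at hd ⊢
    exact h t t' ht h1 hd
  · have h2 := (HH_mono hs hs2 e).monotone h1
    rw [abs_of_nonneg (by linarith)] at hd ⊢
    exact h t' t ht' h1 hd

lemma coarse {δ : ℝ} (hs : 1 < s) (hs2 : s < 2) (hN : NR s δ) (e : invLim s ≃ₜ invLim s) :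
    ∃ L > 0, ∀ t t', 0 ≤ t → 0 ≤ t' → |HH hs hs2 e t - HH hs hs2 e t'| ≤ L * (|t - t'| + 1) := by
  obtain ⟨η, hη, h⟩ := U1 hs hs2 hN e one_pos
  have hn : ∀ n : ℕ, ∀ t t', 0 ≤ t → t ≤ t' → t' - t ≤ n * η →
      HH hs hs2 e t' - HH hs hs2 e t ≤ n := by
    intro n
    induction n with
    | zero =>
      intro t t' h0 h1 h2
      have : t = t' := by simp at h2; linarith
      simp [this]
    | succ n ih =>
      intro t t' h0 h1 h2
      push_cast at h2 ⊢
      by_cases hc : t' - t ≤ η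
      · have := h t t' h0 h1 hc
        have : (0 : ℝ) ≤ n := n.cast_nonneg
        linarith
      · push Not at hc
        have h3 := h t (t + η) h0 (by linarith) (by linarith)
        have h4 := ih (t + η) t' (by linarith) (by linarith) (by linarith)
        linarith
  have hL : ∀ t t', 0 ≤ t → t ≤ t' → HH hs hs2 e t' - HH hs hs2 e t ≤ (1 / η + 1) * (t' - t + 1) := by
    intro t t' h0 h1
    have h2 := hn ⌈(t' - t) / η⌉₊ t t' h0 h1 (by
      rw [← div_le_iff₀ hη]; exact Nat.le_ceil _)
    have h3 := (Nat.ceil_lt_add_one (div_nonneg (by linarith : 0 ≤ t' - t) hη.le)).le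
    have h4 : (1 / η + 1) * (t' - t + 1) = (t' - t) / η + 1 + (1 / η + (t' - t)) := by ring
    have : 0 < 1 / η := by positivity
    linarith
  refine ⟨1 / η + 1, by positivity, fun t t' ht ht' => ?_⟩
  rcases le_total t t' with h1 | h1
  · have h2 := (HH_mono hs hs2 e).monotone h1
    rw [abs_sub_comm, abs_of_nonneg (by linarith), abs_sub_comm, abs_of_nonneg (by linarith)]
    exact hL t t' ht h1
  · have h2 := (HH_mono hs hs2 e).monotone h1
    rw [abs_of_nonneg (by linarith), abs_of_nonneg (by linarith)]
    exact hL t' t ht' h1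

lemma HH_symm' (hs : 1 < s) (hs2 : s < 2) (e : invLim s ≃ₜ invLim s) {t : ℝ} (ht : 0 ≤ t) :
    HH hs hs2 e (HH hs hs2 e.symm t) = t := HH_symm hs hs2 e.symm ht

lemma build {δ : ℝ} (hs : 1 < s) (hs2 : s < 2) (hN : NR s δ) (h : invLim s ≃ₜ invLim s) :
    ∃ (p : ℕ) (κ L : ℝ), MD s δ κ L (fun t => HH hs hs2 h t / s ^ p) := by
  have hδ := hN.pos
  obtain ⟨η1, hη1, hU1⟩ := U2 hs hs2 hN h (half_pos hδ)
  obtain ⟨η2, hη2, hU2⟩ := U2 hs hs2 hN h.symm (show 0 < δ / 8 by positivity)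
  set ε1 := min (δ / 16) (η1 / 2) with he1
  have hε1 : 0 < ε1 := lt_min (by positivity) (by positivity)
  have he2 : ε1 ≤ δ / 16 := min_le_left _ _
  have he3 : ε1 ≤ η1 / 2 := min_le_right _ _
  obtain ⟨p, η3, hη3, hp⟩ := UC hs h.symm h.symm.continuous 0 hε1
  obtain ⟨L, hL, hLip⟩ := coarse hs hs2 hN h
  have hsp : 0 < s ^ p := by positivity
  have hsp1 : 1 ≤ s ^ p := one_le_pow₀ hs.le
  have hG := fun {t : ℝ} (ht : 0 ≤ t) => HH_symm hs hs2 h ht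
  have hG' := fun {t : ℝ} (ht : 0 ≤ t) => HH_symm' hs hs2 h ht
  have hGm := HH_mono hs hs2 h.symm
  have hdiv : ∀ a b : ℝ, |a / s ^ p - b / s ^ p| = |a - b| / s ^ p := by
    intro a b; rw [← sub_div, abs_div, abs_of_pos hsp]
  refine ⟨p, η2 / s ^ p, L, ?_, ?_, ?_, ?_, by positivity, ?_, ?_, ?_, hL, ?_⟩
  · intro a b hab
    exact div_lt_div_of_pos_right (HH_mono hs hs2 h hab) hsp
  · exact (HH_cont hs hs2 h).div_const _
  · simp only [HH_neg hs hs2 h le_rfl, zero_div]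
  · intro z hz
    have hz' : 0 ≤ s ^ p * z := by positivity
    refine ⟨HH hs hs2 h.symm (s ^ p * z), HH_nonneg hs hs2 _ hz', ?_⟩
    simp only [hG' hz']
    field_simp
  · intro t t' ht ht' hd
    rw [hdiv, div_le_div_iff_of_pos_right hsp] at hd
    have := hU2 _ _ (HH_nonneg hs hs2 h ht) (HH_nonneg hs hs2 h ht') hd
    rw [hG ht, hG ht'] at this
    linarith
  · intro t m ht hm hTP
    set y := HH hs hs2 h t / s ^ p with hy
    have hyt : s ^ p * y = HH hs hs2 h t := by rw [hy]; field_simp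
    have hylow : 1 / 2 ≤ y := by
      have := hTP.lower hs
      have := one_le_pow₀ hs.le (n := m)
      linarith
    have hδ4 := hN.le
    have hG0 : HH hs hs2 h.symm (s ^ p * y) = t := by rw [hyt, hG ht]
    have hGc := HH_cont hs hs2 h.symm
    obtain ⟨t0, ht0, m', hm', hT⟩ := step1 hs hN (ε := ε1) (U := δ / 2) (x := t) hε1 (by linarith)
      (by linarith) (a := fun v => HH hs hs2 h.symm (s ^ p * (y + v)))
      (b := fun v => HH hs hs2 h.symm (s ^ p * (y - v)))
      (hGc.comp (by fun_prop)).continuousOn (hGc.comp (by fun_prop)).continuousOn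
      (by simp only [add_zero, hG0]) (by simp only [sub_zero, hG0])
      (by
        intro u hu
        rw [← hG0]
        exact hGm.monotone (mul_le_mul_of_nonneg_left (by linarith [hu.1]) hsp.le))
      (by
        intro u hu
        rw [← hG0]
        exact hGm.monotone (mul_le_mul_of_nonneg_left (by linarith [hu.1]) hsp.le))
      (by
        intro u hu
        have p1 : 0 ≤ s ^ p * (y + u) := mul_nonneg hsp.le (by linarith [hu.1])
        have p2 : 0 ≤ s ^ p * (y - u) := mul_nonneg hsp.le (by linarith [hu.2])
        have := hp (gam hs hs2 (s ^ p * (y + u))) (gam hs hs2 (s ^ p * (y - u))) (by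
          rw [gam_coord hs hs2 p1, gam_coord hs hs2 p2, mul_div_cancel_left₀ _ hsp.ne',
            mul_div_cancel_left₀ _ hsp.ne',
            hTP.fold hs hN hm (by rw [abs_of_nonneg hu.1]; exact hu.2), sub_self, abs_zero]
          exact hη3.le)
        rw [← gam_HH hs hs2 h.symm p1, ← gam_HH hs hs2 h.symm p2,
          gam_coord hs hs2 (HH_nonneg hs hs2 _ p1), gam_coord hs hs2 (HH_nonneg hs hs2 _ p2),
          pow_zero, div_one, div_one] at this
        exact this.le)
      (by
        by_contra hc
        push Not at hc
        have p1 : 0 ≤ s ^ p * (y + δ / 2) := mul_nonneg hsp.le (by linarith)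
        have p2 : 0 ≤ s ^ p * (y - δ / 2) := mul_nonneg hsp.le (by linarith)
        have hm1 : HH hs hs2 h.symm (s ^ p * (y - δ / 2)) ≤ HH hs hs2 h.symm (s ^ p * (y + δ / 2)) :=
          hGm.monotone (mul_le_mul_of_nonneg_left (by linarith) hsp.le)
        have := hU1 _ _ (HH_nonneg hs hs2 h.symm p1) (HH_nonneg hs hs2 h.symm p2) (by
          rw [abs_of_nonneg (by linarith)]; linarith)
        rw [hG' p1, hG' p2] at this
        have h5 := (le_abs_self _).trans this
        nlinarith)
    refine ⟨t0, m', hm', hT, ?_⟩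
    rw [abs_sub_comm]; linarith
  · intro ε hε
    obtain ⟨q, η, hη, hq⟩ := UC hs h h.continuous p hε
    refine ⟨q, fun t t' ht ht' hf => ?_⟩
    have := hq (gam hs hs2 t) (gam hs hs2 t') (by
      rw [gam_coord hs hs2 ht, gam_coord hs hs2 ht', hf, sub_self, abs_zero]; exact hη.le)
    rw [← gam_HH hs hs2 h ht, ← gam_HH hs hs2 h ht', gam_coord hs hs2 (HH_nonneg hs hs2 _ ht),
      gam_coord hs hs2 (HH_nonneg hs hs2 _ ht')] at this
    exact this.le
  · intro t t' ht ht'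
    rw [hdiv]
    exact (div_le_self (abs_nonneg _) hsp1).trans (hLip t t' ht ht')

end Build
section Fin
variable {s : ℝ}

lemma arc_sub (hs : 1 < s) {Γ : ℝ → invLim s} {a b : ℝ} (hab : a ≤ b)
    (hc : ContinuousOn Γ (Icc a b)) {m : ℕ} {e σ w : ℝ} (hσ : σ = 1 ∨ σ = -1)
    (hf : ∀ u ∈ Icc a b, (Γ u).1 m = e + σ * |u - w| / s ^ m) (hw : w ≤ a ∨ b ≤ w) :
    IsArcOrPoint (Γ '' Icc a b) ∧ InjOn (proj s m) (Γ '' Icc a b) ∧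
      s ^ m * Metric.diam (proj s m '' (Γ '' Icc a b)) ≤ b - a := by
  have hp : 0 < s ^ m := by positivity
  have hdist : ∀ u ∈ Icc a b, ∀ v ∈ Icc a b, |(Γ u).1 m - (Γ v).1 m| = |u - v| / s ^ m := by
    intro u hu v hv
    rw [hf u hu, hf v hv]
    have h1 : e + σ * |u - w| / s ^ m - (e + σ * |v - w| / s ^ m) = σ * (|u - w| - |v - w|) / s ^ m := by
      ring
    have h2 : |σ| = 1 := by rcases hσ with rfl | rfl <;> simp
    rw [h1, abs_div, abs_mul, h2, one_mul, abs_of_pos hp]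
    congr 1
    rcases hw with hw | hw
    · rw [abs_of_nonneg (by linarith [hu.1] : 0 ≤ u - w), abs_of_nonneg (by linarith [hv.1] : 0 ≤ v - w)]
      congr 1; ring
    · rw [abs_of_nonpos (by linarith [hu.2] : u - w ≤ 0), abs_of_nonpos (by linarith [hv.2] : v - w ≤ 0),
        abs_sub_comm u v]
      congr 1; ring
  have hinj : ∀ u ∈ Icc a b, ∀ v ∈ Icc a b, (Γ u).1 m = (Γ v).1 m → u = v := by
    intro u hu v hv h
    have h1 := hdist u hu v hv
    rw [h, sub_self, abs_zero] at h1
    have h2 : |u - v| = 0 := by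
      rw [eq_comm, div_eq_zero_iff] at h1
      exact h1.resolve_right hp.ne'
    linarith [abs_eq_zero.mp h2]
  refine ⟨?_, ?_, ?_⟩
  · rcases hab.eq_or_lt with h | h
    · right
      exact ⟨Γ a, by rw [← h, Icc_self, image_singleton]⟩
    · left
      set f : unitInterval → invLim s := fun τ => Γ (a + τ.1 * (b - a)) with hfd
      have hmem : ∀ τ : unitInterval, a + τ.1 * (b - a) ∈ Icc a b := by
        intro τ
        have h1 := τ.2.1
        have h2 := τ.2.2
        constructor <;> nlinarith
      have hfc : Continuous f :=
        hc.comp_continuous (by fun_prop) hmem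
      have hfi : Injective f := by
        intro τ τ' hh
        have := hinj _ (hmem τ) _ (hmem τ') (by rw [show Γ (a + τ.1 * (b - a)) = Γ (a + τ'.1 * (b - a)) from hh])
        apply Subtype.ext
        have h3 : (τ.1 - τ'.1) * (b - a) = 0 := by linarith
        rcases mul_eq_zero.mp h3 with h4 | h4 <;> linarith
      refine ⟨_, _, f, (hfc.isClosedEmbedding hfi).isEmbedding, ?_, rfl, rfl⟩
      apply Subset.antisymm
      · rintro _ ⟨τ, rfl⟩
        exact ⟨_, hmem τ, rfl⟩
      · rintro _ ⟨u, hu, rfl⟩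
        refine ⟨⟨(u - a) / (b - a), div_nonneg (by linarith [hu.1]) (by linarith),
          (div_le_one (by linarith)).mpr (by linarith [hu.2])⟩, ?_⟩
        simp only [hfd]
        congr 1
        have : b - a ≠ 0 := by linarith
        field_simp
        ring
  · rintro _ ⟨u, hu, rfl⟩ _ ⟨v, hv, rfl⟩ h
    rw [hinj u hu v hv h]
  · have : Metric.diam (proj s m '' (Γ '' Icc a b)) ≤ (b - a) / s ^ m := by
      apply Metric.diam_le_of_forall_dist_le (div_nonneg (by linarith) hp.le)
      rintro _ ⟨_, ⟨u, hu, rfl⟩, rfl⟩ _ ⟨_, ⟨v, hv, rfl⟩, rfl⟩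
      rw [Real.dist_eq]
      have h1 := hdist u hu v hv
      unfold proj
      rw [h1]
      gcongr
      rw [abs_le]
      constructor <;> linarith [hu.1, hu.2, hv.1, hv.2]
    rw [le_div_iff₀ hp] at this
    linarith

lemma arc_all (hs : 1 < s) {Γ : ℝ → invLim s} {M ℓ : ℝ} {m0 : ℕ} (hℓ0 : 0 ≤ ℓ) (hℓ : ℓ ≤ M)
    (hform : ∀ m, m0 ≤ m → ∃ e σ w : ℝ, (σ = 1 ∨ σ = -1) ∧ ∀ u ∈ Icc 0 M,
      (Γ u).1 m = e + σ * |u - w| / s ^ m) :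
    ∃ A : Set (invLim s), IsArcOrPoint A ∧ Γ 0 ∈ A ∧ Γ ℓ ∈ A ∧ ∃ m : ℕ, InjOn (proj s m) A ∧
      s ^ m * Metric.diam (proj s m '' A) ≤ M := by
  have hc : ContinuousOn Γ (Icc 0 M) := by
    intro u hu
    apply K_tendsto
    intro i
    obtain ⟨k, hk⟩ : ∃ k, m0 ≤ i + k := ⟨m0, by omega⟩
    obtain ⟨e, σ, w, -, hf⟩ := hform (i + k) hk
    have h1 : ContinuousOn (fun u => (tent s)^[k] (e + σ * |u - w| / s ^ (i + k))) (Icc 0 M) :=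
      ((tent_cont.iterate k).comp (by fun_prop)).continuousOn
    have h2 : ContinuousOn (fun u => (Γ u).1 i) (Icc 0 M) := h1.congr (fun v hv => by
      simp only []
      rw [K_iter (Γ v) i k, hf v hv])
    exact h2 u hu
  choose! e σ w hσ hf using hform
  have main : ∀ a b, 0 ≤ a → a ≤ b → b ≤ M → ∀ m, m0 ≤ m → (w m ≤ a ∨ b ≤ w m) →
      Γ 0 ∈ Γ '' Icc a b → Γ ℓ ∈ Γ '' Icc a b →
      ∃ A : Set (invLim s), IsArcOrPoint A ∧ Γ 0 ∈ A ∧ Γ ℓ ∈ A ∧ ∃ m : ℕ, InjOn (proj s m) A ∧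
      s ^ m * Metric.diam (proj s m '' A) ≤ M := by
    intro a b h0 hab hb m hm hw h1 h2
    have hsub : Icc a b ⊆ Icc 0 M := Icc_subset_Icc h0 hb
    obtain ⟨h3, h4, h5⟩ := arc_sub hs hab (hc.mono hsub) (hσ m hm) (fun u hu => hf m hm u (hsub hu)) hw
    exact ⟨_, h3, h1, h2, m, h4, by linarith⟩
  by_cases hex : ∃ m, m0 ≤ m ∧ (w m ≤ 0 ∨ ℓ ≤ w m)
  · obtain ⟨m, hm, hw⟩ := hex
    exact main 0 ℓ le_rfl hℓ0 hℓ m hm hw ⟨0, ⟨le_rfl, hℓ0⟩, rfl⟩ ⟨ℓ, ⟨hℓ0, le_rfl⟩, rfl⟩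
  · push Not at hex
    obtain ⟨hw0, hwl⟩ := hex m0 le_rfl
    have hp : ∀ m, 0 < s ^ m := fun m => by positivity
    have heq : ∀ m, m0 ≤ m → w m = w m0 := by
      intro m hm
      obtain ⟨h1, h2⟩ := hex m hm
      set r := min (w m) (M - w m) with hr
      have hr0 : 0 < r := lt_min h1 (by linarith)
      have hr1 : r ≤ w m := min_le_left _ _
      have hr2 : r ≤ M - w m := min_le_right _ _
      have i1 : w m - r ∈ Icc 0 M := ⟨by linarith, by linarith⟩
      have i2 : w m + r ∈ Icc 0 M := ⟨by linarith, by linarith⟩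
      have h3 : (Γ (w m - r)).1 m = (Γ (w m + r)).1 m := by
        rw [hf m hm _ i1, hf m hm _ i2]
        rw [show w m - r - w m = -r by ring, show w m + r - w m = r by ring, abs_neg]
      have h4 := K_agree h3 hm
      rw [hf m0 le_rfl _ i1, hf m0 le_rfl _ i2] at h4
      have h5 : |w m - r - w m0| = |w m + r - w m0| := by
        have h6 := add_left_cancel h4
        rw [div_left_inj' (hp m0).ne'] at h6
        have h7 : σ m0 ≠ 0 := by rcases hσ m0 le_rfl with h | h <;> rw [h] <;> norm_num
        exact mul_left_cancel₀ h7 h6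
      rcases abs_eq_abs.mp h5 with h6 | h6 <;> linarith
    have hsym : ∀ u, u ∈ Icc 0 M → 2 * w m0 - u ∈ Icc 0 M → Γ u = Γ (2 * w m0 - u) := by
      intro u h1 h2
      apply K_ext
      intro N
      refine ⟨max N m0, le_max_left _ _, ?_⟩
      have hm : m0 ≤ max N m0 := le_max_right _ _
      rw [hf _ hm _ h1, hf _ hm _ h2, heq _ hm]
      rw [show 2 * w m0 - u - w m0 = -(u - w m0) by ring, abs_neg]
    by_cases hcase : 2 * w m0 ≤ ℓ
    · refine main (w m0) ℓ hw0.le hwl.le hℓ m0 le_rfl (Or.inl le_rfl) ?_ ⟨ℓ, ⟨hwl.le, le_rfl⟩, rfl⟩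
      refine ⟨2 * w m0 - 0, ⟨by linarith, by linarith⟩, ?_⟩
      exact (hsym 0 ⟨le_rfl, by linarith⟩ ⟨by linarith, by linarith⟩).symm
    · push Not at hcase
      refine main 0 (w m0) le_rfl hw0.le (by linarith) m0 le_rfl (Or.inr le_rfl)
        ⟨0, ⟨le_rfl, hw0.le⟩, rfl⟩ ?_
      refine ⟨2 * w m0 - ℓ, ⟨by linarith, by linarith⟩, ?_⟩
      exact (hsym ℓ ⟨by linarith, by linarith⟩ ⟨by linarith, by linarith⟩).symm

lemma ulim_real (l : Ultrafilter ℕ) {f : ℕ → ℝ} {a b : ℝ} (h : ∀ n, f n ∈ Icc a b) :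
    ∃ x ∈ Icc a b, Tendsto f l (𝓝 x) := by
  have := isCompact_Icc (a := a) (b := b) |>.ultrafilter_le_nhds (l.map f) (by
    rw [le_principal_iff, Ultrafilter.coe_map, mem_map]
    exact Filter.mem_of_superset univ_mem (fun n _ => h n))
  exact this

lemma ulim_K (l : Ultrafilter ℕ) (f : ℕ → invLim s) : ∃ x, Tendsto f l (𝓝 x) :=
  ⟨_, (l.map f).le_nhds_lim⟩

lemma arcs {δ : ℝ} (hs : 1 < s) (hs2 : s < 2) (hN : NR s δ) (g : invLim s ≃ₜ invLim s) {M : ℝ}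
    (hM : ∀ t, 0 ≤ t → |HH hs hs2 g t - t| ≤ M) (z : invLim s) :
    ∃ A : Set (invLim s), IsArcOrPoint A ∧ z ∈ A ∧ g z ∈ A ∧ ∃ m : ℕ, InjOn (proj s m) A ∧
      s ^ m * Metric.diam (proj s m '' A) ≤ M := by
  obtain ⟨t, ht0, htz⟩ := approx_all hs hs2 z
  have hM0 : 0 ≤ M := (abs_nonneg _).trans (hM 0 le_rfl)
  set G := HH hs hs2 g with hG
  set p : ℕ → ℝ := fun N => min (t N) (G (t N)) with hp
  have hp0 : ∀ N, 0 ≤ p N := fun N => le_min (ht0 N) (HH_nonneg hs hs2 g (ht0 N))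
  set l : Ultrafilter ℕ := hyperfilter ℕ with hl
  have hle : (l : Filter ℕ) ≤ atTop := by rw [← Nat.cofinite_eq_atTop]; exact hyperfilter_le_cofinite
  have hz := htz.mono_left hle
  have hgz : Tendsto (fun N => gam hs hs2 (G (t N))) l (𝓝 (g z)) := by
    refine ((g.continuous.tendsto z).comp hz).congr (fun N => ?_)
    exact (gam_HH hs hs2 g (ht0 N)).symm
  have hex : ∀ u : ℝ, ∃ x, Tendsto (fun N => gam hs hs2 (p N + u)) l (𝓝 x) := fun u => ulim_K l _
  choose Γ hΓ using hex
  obtain ⟨ℓ, hℓ, hℓt⟩ := ulim_real l (f := fun N => |G (t N) - t N|) (a := 0) (b := M)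
    (fun N => ⟨abs_nonneg _, hM _ (ht0 N)⟩)
  obtain ⟨m0, hm0⟩ : ∃ m0 : ℕ, M ≤ s ^ m0 * δ := by
    obtain ⟨n, hn⟩ := pow_unbounded_of_one_lt (M / δ) hs
    exact ⟨n, by rw [div_lt_iff₀ hN.pos] at hn; exact hn.le⟩
  have hform : ∀ m, m0 ≤ m → ∃ e σ w : ℝ, (σ = 1 ∨ σ = -1) ∧ ∀ u ∈ Icc 0 M,
      (Γ u).1 m = e + σ * |u - w| / s ^ m := by
    intro m hm
    have hsm : 0 < s ^ m := by positivity
    have hmM : M ≤ s ^ m * δ := hm0.trans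
      (mul_le_mul_of_nonneg_right (pow_le_pow_right₀ hs.le hm) hN.pos.le)
    have h1 : ∀ N, ∃ e σ w : ℝ, e ∈ Icc (0 : ℝ) 1 ∧ (σ = 1 ∨ σ = -1) ∧ w ∈ Icc 0 M ∧
        ∀ u ∈ Icc 0 M, (gam hs hs2 (p N + u)).1 m = e + σ * |u - w| / s ^ m := by
      intro N
      obtain ⟨t0, e, σ, hσ, ht0', hf, -⟩ := form hs hN (p N / s ^ m) ((p N + M) / s ^ m)
        (div_le_div_of_nonneg_right (by linarith) hsm.le)
        (by rw [← sub_div, div_le_iff₀ hsm]; linarith)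
      have hw1 : p N ≤ t0 * s ^ m := by rw [← div_le_iff₀ hsm]; exact ht0'.1
      have hw2 : t0 * s ^ m ≤ p N + M := by rw [← le_div_iff₀ hsm]; exact ht0'.2
      have hff : ∀ u ∈ Icc 0 M, (gam hs hs2 (p N + u)).1 m =
          e + σ * |u - (t0 * s ^ m - p N)| / s ^ m := by
        intro u hu
        rw [gam_coord hs hs2 (by linarith [hp0 N, hu.1]), hf _ ⟨by
          apply div_le_div_of_nonneg_right _ hsm.le; linarith [hu.1], by
          apply div_le_div_of_nonneg_right _ hsm.le; linarith [hu.2]⟩]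
        have : (p N + u) / s ^ m - t0 = (u - (t0 * s ^ m - p N)) / s ^ m := by
          field_simp; ring
        rw [this, abs_div, abs_of_pos hsm, mul_div_assoc]
      refine ⟨e, σ, t0 * s ^ m - p N, ?_, hσ, ⟨by linarith, by linarith⟩, hff⟩
      have h2 := hff (t0 * s ^ m - p N) ⟨by linarith, by linarith⟩
      rw [sub_self, abs_zero, mul_zero, zero_div, add_zero] at h2
      rw [← h2]
      exact ⟨K_nonneg _ _, K_le_one _ _⟩
    choose e σ w he hσ hw hf using h1
    obtain ⟨e', -, he'⟩ := ulim_real l he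
    obtain ⟨w', -, hw'⟩ := ulim_real l hw
    obtain ⟨σ', -, hσ'⟩ := ulim_real l (f := σ) (a := -1) (b := 1)
      (fun N => by rcases hσ N with h | h <;> rw [h] <;> constructor <;> norm_num)
    refine ⟨e', σ', w', ?_, ?_⟩
    · have h2 : Tendsto (fun N => σ N * σ N) l (𝓝 1) := by
        refine tendsto_const_nhds.congr (fun N => ?_)
        rcases hσ N with h | h <;> rw [h] <;> norm_num
      have h3 := tendsto_nhds_unique (hσ'.mul hσ') h2
      exact mul_self_eq_one_iff.mp h3
    · intro u hu
      have h2 := ((K_coord_cont m).tendsto (Γ u)).comp (hΓ u)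
      have h3 : Tendsto (fun N => e N + σ N * |u - w N| / s ^ m) l
          (𝓝 (e' + σ' * |u - w'| / s ^ m)) :=
        he'.add ((hσ'.mul (tendsto_const_nhds.sub hw').abs).div_const _)
      exact tendsto_nhds_unique h2 (h3.congr (fun N => (hf N u hu).symm))
  -- endpoints
  have hlip : ∀ a b : ℝ, 0 ≤ a → 0 ≤ b → ∀ i, |(gam hs hs2 a).1 i - (gam hs hs2 b).1 i| ≤ |a - b| := by
    intro a b ha hb i
    rw [gam_coord hs hs2 ha, gam_coord hs hs2 hb]
    refine (ff_lip hs _ _).trans ?_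
    rw [← sub_div, abs_div, abs_of_pos (by positivity : 0 < s ^ i)]
    exact div_le_self (abs_nonneg _) (one_le_pow₀ hs.le)
  have hΓ0 : Tendsto (fun N => gam hs hs2 (p N)) l (𝓝 (Γ 0)) := by
    simpa using hΓ 0
  have hΓℓ : Tendsto (fun N => gam hs hs2 (p N + |G (t N) - t N|)) l (𝓝 (Γ ℓ)) := by
    apply K_tendsto
    intro i
    have h2 := ((K_coord_cont i).tendsto (Γ ℓ)).comp (hΓ ℓ)
    have h3 : Tendsto (fun N => (gam hs hs2 (p N + |G (t N) - t N|)).1 i - (gam hs hs2 (p N + ℓ)).1 i) l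
        (𝓝 0) := by
      rw [tendsto_zero_iff_abs_tendsto_zero]
      have h4 : Tendsto (fun N => |(|G (t N) - t N|) - ℓ|) l (𝓝 0) := by
        have := (hℓt.sub_const ℓ).abs
        simpa using this
      refine tendsto_of_tendsto_of_tendsto_of_le_of_le tendsto_const_nhds h4
        (fun N => abs_nonneg _) (fun N => ?_)
      refine (hlip _ _ (by have := hp0 N; positivity) (by have := hp0 N; linarith [hℓ.1]) i).trans ?_
      rw [add_sub_add_left_eq_sub]
    have h5 := h3.add h2
    rw [zero_add] at h5
    refine h5.congr (fun N => ?_)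
    simp [comp]
  obtain ⟨A, hA, hA0, hAℓ, hAm⟩ := arc_all hs hℓ.1 hℓ.2 hform
  rcases l.mem_or_compl_mem {N | t N ≤ G (t N)} with h | h
  · have e1 : Γ 0 = z := by
      refine tendsto_nhds_unique hΓ0 (hz.congr' ?_)
      filter_upwards [h] with N hN'
      simp only [hp, min_eq_left hN']
    have e2 : Γ ℓ = g z := by
      refine tendsto_nhds_unique hΓℓ (hgz.congr' ?_)
      filter_upwards [h] with N hN'
      simp only [hp, min_eq_left hN', abs_of_nonneg (sub_nonneg.mpr hN'), add_sub_cancel]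
    rw [e1] at hA0; rw [e2] at hAℓ
    exact ⟨A, hA, hA0, hAℓ, hAm⟩
  · have e1 : Γ 0 = g z := by
      refine tendsto_nhds_unique hΓ0 (hgz.congr' ?_)
      filter_upwards [h] with N hN'
      have hN' : G (t N) ≤ t N := by
        by_contra hc
        exact hN' (not_le.mp hc).le
      simp only [hp, min_eq_right hN']
    have e2 : Γ ℓ = z := by
      refine tendsto_nhds_unique hΓℓ (hz.congr' ?_)
      filter_upwards [h] with N hN'
      have hN' : G (t N) ≤ t N := by
        by_contra hc
        exact hN' (not_le.mp hc).le
      simp only [hp, min_eq_right hN', abs_of_nonpos (sub_nonpos.mpr hN')]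
      congr 1; ring
    rw [e1] at hA0; rw [e2] at hAℓ
    exact ⟨A, hA, hAℓ, hA0, hAm⟩

lemma folding (hs : 1 < s) (hs2 : s < 2) (g : invLim s ≃ₜ invLim s)
    (hg : ∀ ε > 0, ∃ n : ℕ, ∀ k, n ≤ k → |HH hs hs2 g (sk s k) - sk s k| ≤ ε)
    {x : invLim s} (hx : x ∈ foldingPts s) : g x = x := by
  have hs0 : 0 < s := by linarith
  have hk : ∀ n : ℕ, ∃ k : ℕ, |(tent s)^[k] (1 / 2) - x.1 n| < 1 / (s ^ n) ^ 2 := by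
    intro n
    obtain ⟨φ, -, hφ⟩ := hx n
    have := (Metric.tendsto_nhds.mp hφ (1 / (s ^ n) ^ 2) (by positivity)).exists
    obtain ⟨j, hj⟩ := this
    exact ⟨φ j, by rw [Real.dist_eq] at hj; exact hj⟩
  choose k hk using hk
  have hinv : Tendsto (fun n : ℕ => 1 / s ^ n) atTop (𝓝 0) := by
    have := (tendsto_pow_atTop_nhds_zero_of_lt_one (by positivity : 0 ≤ 1 / s)
      (by rw [div_lt_one hs0]; exact hs))
    exact this.congr (fun n => by simp)
  have hpos : ∀ n, 0 ≤ sk s (n + k n) := fun n => (sk_pos hs _).le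
  have hl1 : Tendsto (fun n => gam hs hs2 (sk s (n + k n))) atTop (𝓝 x) := by
    apply K_tendsto
    intro i
    rw [tendsto_iff_dist_tendsto_zero]
    refine tendsto_of_tendsto_of_tendsto_of_le_of_le' tendsto_const_nhds hinv
      (Eventually.of_forall fun n => dist_nonneg) ?_
    filter_upwards [eventually_ge_atTop i] with n hn
    obtain ⟨j, rfl⟩ := Nat.exists_eq_add_of_le hn
    rw [Real.dist_eq, K_iter x i j, K_iter (gam hs hs2 _) i j, gam_coord hs hs2 (hpos _),
      (sk_TP hs _).val hs (Nat.le_add_right _ _), Nat.add_sub_cancel_left]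
    have h1 := tent_iter_lip hs j ((tent s)^[k (i + j)] (1 / 2)) (x.1 (i + j))
    have h3 : s ^ j ≤ s ^ (i + j) := pow_le_pow_right₀ hs.le (by omega)
    have h4 : 0 < s ^ (i + j) := by positivity
    calc _ ≤ s ^ j * _ := h1
      _ ≤ s ^ (i + j) * (1 / (s ^ (i + j)) ^ 2) := by
          apply mul_le_mul h3 (hk _).le (abs_nonneg _) h4.le
      _ = _ := by field_simp
  have hl2 := (g.continuous.tendsto x).comp hl1
  have hl3 : Tendsto (g ∘ fun n => gam hs hs2 (sk s (n + k n))) atTop (𝓝 x) := by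
    apply K_tendsto
    intro i
    have h2 := ((K_coord_cont i).tendsto x).comp hl1
    have h3 : Tendsto (fun n => (g (gam hs hs2 (sk s (n + k n)))).1 i -
        (gam hs hs2 (sk s (n + k n))).1 i) atTop (𝓝 0) := by
      rw [Metric.tendsto_atTop]
      intro ε hε
      obtain ⟨n0, hn0⟩ := hg (ε / 2) (by positivity)
      refine ⟨n0, fun n hn => ?_⟩
      rw [Real.dist_eq, sub_zero, ← gam_HH hs hs2 g (hpos n),
        gam_coord hs hs2 (HH_nonneg hs hs2 g (hpos n)), gam_coord hs hs2 (hpos n)]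
      refine lt_of_le_of_lt (ff_lip hs _ _) ?_
      rw [← sub_div, abs_div, abs_of_pos (by positivity : 0 < s ^ i)]
      refine lt_of_le_of_lt (div_le_self (abs_nonneg _) (one_le_pow₀ hs.le)) ?_
      linarith [hn0 (n + k n) (by omega)]
    have h5 := h3.add h2
    rw [zero_add] at h5
    refine h5.congr (fun N => ?_)
    simp [comp]
  exact tendsto_nhds_unique hl2 hl3

/-- the shift as a homeomorphism -/
def shiftH (s : ℝ) (hs1 : Real.sqrt 2 < s) (hs2 : s < 2) : invLim s ≃ₜ invLim s where
  toFun := shiftFwdFun s hs1 hs2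
  invFun := shiftInvFun s
  left_inv := fun x => Subtype.ext (funext fun n => rfl)
  right_inv := fun x => Subtype.ext (funext fun n => by
    cases n with
    | zero => exact (x.2.2 0).symm
    | succ k => rfl)
  continuous_toFun := by
    rw [continuous_iff_continuousAt]
    intro x
    apply K_tendsto
    intro n
    cases n with
    | zero => exact (tent_cont.comp (K_coord_cont 0)).tendsto x
    | succ k => exact (K_coord_cont k).tendsto x
  continuous_invFun := by
    rw [continuous_iff_continuousAt]
    intro x
    apply K_tendsto
    intro n
    exact (K_coord_cont (n + 1)).tendsto x

lemma iter_homeo {X : Type*} [TopologicalSpace X] (e : X ≃ₜ X) (n : ℕ) :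
    ∃ E : X ≃ₜ X, ∀ x, E x = e^[n] x := by
  induction n with
  | zero => exact ⟨Homeomorph.refl X, fun x => rfl⟩
  | succ n ih =>
    obtain ⟨E, hE⟩ := ih
    exact ⟨e.trans E, fun x => by rw [iterate_succ_apply, ← hE]; rfl⟩

lemma shiftZ_homeo (hs1 : Real.sqrt 2 < s) (hs2 : s < 2) (b : ℤ) :
    ∃ E : invLim s ≃ₜ invLim s, ∀ x, E x = shiftZ s hs1 hs2 b x := by
  unfold shiftZ
  split_ifs
  · exact iter_homeo (shiftH s hs1 hs2) _
  · exact iter_homeo (shiftH s hs1 hs2).symm _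

lemma shift_gam (hs : 1 < s) (hs1 : Real.sqrt 2 < s) (hs2 : s < 2) {t : ℝ} (ht : 0 ≤ t) :
    shiftFwdFun s hs1 hs2 (gam hs hs2 t) = gam hs hs2 (s * t) := by
  apply Subtype.ext
  funext n
  have hst : 0 ≤ s * t := mul_nonneg (by linarith) ht
  rw [gam_coord hs hs2 hst]
  cases n with
  | zero =>
    change tent s ((gam hs hs2 t).1 0) = _
    rw [gam_coord hs hs2 ht, pow_zero, div_one, div_one, ff_mul hs]
  | succ k =>
    change (gam hs hs2 t).1 k = _
    rw [gam_coord hs hs2 ht]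
    congr 1
    rw [pow_succ]; field_simp

lemma shiftInv_gam (hs : 1 < s) (hs2 : s < 2) {t : ℝ} (ht : 0 ≤ t) :
    shiftInvFun s (gam hs hs2 t) = gam hs hs2 (t / s) := by
  apply Subtype.ext
  funext n
  have hst : 0 ≤ t / s := div_nonneg ht (by linarith)
  rw [gam_coord hs hs2 hst]
  change (gam hs hs2 t).1 (n + 1) = _
  rw [gam_coord hs hs2 ht]
  congr 1
  rw [pow_succ]; field_simp

lemma shiftZ_gam (hs : 1 < s) (hs1 : Real.sqrt 2 < s) (hs2 : s < 2) (b : ℤ) {t : ℝ} (ht : 0 ≤ t) :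
    shiftZ s hs1 hs2 b (gam hs hs2 t) = gam hs hs2 (s ^ b * t) := by
  have hs0 : 0 < s := by linarith
  have h1 : ∀ n : ℕ, (shiftFwdFun s hs1 hs2)^[n] (gam hs hs2 t) = gam hs hs2 (s ^ n * t) := by
    intro n
    induction n with
    | zero => simp
    | succ n ih =>
      rw [iterate_succ_apply', ih, shift_gam hs hs1 hs2 (by positivity)]
      congr 1; ring
  have h2 : ∀ n : ℕ, (shiftInvFun s)^[n] (gam hs hs2 t) = gam hs hs2 (t / s ^ n) := by
    intro n
    induction n with
    | zero => simp
    | succ n ih =>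
      rw [iterate_succ_apply', ih, shiftInv_gam hs hs2 (by positivity)]
      congr 1; rw [pow_succ]; field_simp
  unfold shiftZ
  split_ifs with hb
  · rw [h1]
    congr 2
    rw [← zpow_natCast, Int.toNat_of_nonneg hb]
  · rw [h2]
    congr 1
    push Not at hb
    rw [← zpow_natCast, Int.toNat_of_nonneg (by omega), zpow_neg, div_inv_eq_mul, mul_comm]

lemma final (s : ℝ) (hs1 : Real.sqrt 2 < s) (hs2 : s < 2)
    (hnr : (1 : ℝ) / 2 ∉ omegaSet (tent s) (1 / 2))
    (h : invLim s ≃ₜ invLim s) :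
    ∃ b : ℤ,
      (∀ x ∈ foldingPts s, shiftZ s hs1 hs2 b (h x) = x) ∧
      (∀ x : invLim s, (fun z => shiftZ s hs1 hs2 b (h z)) '' composant x = composant x) ∧
      PreservesCompOrder (fun z => shiftZ s hs1 hs2 b (h z)) ∧
      ∃ M : ℝ, 0 < M ∧ ∀ z : invLim s, ∃ A : Set (invLim s),
        IsArcOrPoint A ∧ z ∈ A ∧ shiftZ s hs1 hs2 b (h z) ∈ A ∧
        ∃ m : ℕ, InjOn (proj s m) A ∧ s ^ m * Metric.diam (proj s m '' A) ≤ M := by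
  have hs : 1 < s := lt_of_le_of_lt (by rw [Real.one_le_sqrt]; norm_num) hs1
  have hs0 : 0 < s := by linarith
  obtain ⟨δ, hN⟩ := exists_NR hs hnr
  obtain ⟨p, κ, L, hMD⟩ := build hs hs2 hN h
  obtain ⟨R, ⟨M, hM⟩, hk⟩ := hMD.main hs hs2 hN
  set b : ℤ := -(R + p) with hb
  obtain ⟨E, hE⟩ := shiftZ_homeo hs1 hs2 b
  set g : invLim s ≃ₜ invLim s := h.trans E with hg
  have hge : (fun z => shiftZ s hs1 hs2 b (h z)) = g := by
    funext z; rw [← hE]; rfl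
  have hge' : ∀ z, shiftZ s hs1 hs2 b (h z) = g z := fun z => congrFun hge z
  have hR : 0 < s ^ (-R) := zpow_pos hs0 _
  have hHH : ∀ t, 0 ≤ t → HH hs hs2 g t - t = s ^ (-R) * (HH hs hs2 h t / s ^ p - s ^ R * t) := by
    intro t ht
    have h1 : HH hs hs2 g t = s ^ b * HH hs hs2 h t := by
      apply gam_inj hs hs2 (HH_nonneg hs hs2 g ht)
        (mul_nonneg (zpow_pos hs0 _).le (HH_nonneg hs hs2 h ht))
      rw [gam_HH hs hs2 g ht, ← shiftZ_gam hs hs1 hs2 b (HH_nonneg hs hs2 h ht), gam_HH hs hs2 h ht,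
        hge']
    rw [h1, hb, neg_add, zpow_add₀ hs0.ne', zpow_neg s (p : ℤ), zpow_natCast, mul_sub, ← mul_assoc,
      ← zpow_add₀ hs0.ne', neg_add_cancel, zpow_zero, one_mul]
    ring
  refine ⟨b, ?_, ?_, ?_, s ^ (-R) * (|M| + 1), by positivity, ?_⟩
  · intro x hx
    rw [hge']
    refine folding hs hs2 g ?_ hx
    intro ε hε
    obtain ⟨n, hn⟩ := hk (ε / s ^ (-R)) (by positivity)
    refine ⟨n, fun k hkn => ?_⟩
    rw [hHH _ (sk_pos hs k).le, abs_mul, abs_of_pos hR]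
    have := hn k hkn
    rw [le_div_iff₀ hR] at this
    linarith
  · intro x
    rw [hge]
    exact homeo_comp hs hs2 g x
  · rw [hge]
    exact pco hs hs2 g
  · intro z
    simp only [hge']
    refine arcs hs hs2 hN g ?_ z
    intro t ht
    rw [hHH t ht, abs_mul, abs_of_pos hR]
    apply mul_le_mul_of_nonneg_left _ hR.le
    linarith [hM t ht, le_abs_self M]

end Fin

/-- there is `b : ℤ` such that `g = σ̂^{b} ∘ h` fixes every folding point, maps
every composant onto itself, preserves the order along composants, and stays at uniformly
bounded `d̄`-distance from the identity. -/
theorem statement16 (s : ℝ) (hs1 : Real.sqrt 2 < s) (hs2 : s < 2)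
    (hnr : (1 : ℝ) / 2 ∉ omegaSet (tent s) (1 / 2))
    (h : invLim s ≃ₜ invLim s) :
    ∃ b : ℤ,
      (∀ x ∈ foldingPts s, shiftZ s hs1 hs2 b (h x) = x) ∧
      (∀ x : invLim s, (fun z => shiftZ s hs1 hs2 b (h z)) '' composant x = composant x) ∧
      PreservesCompOrder (fun z => shiftZ s hs1 hs2 b (h z)) ∧
      ∃ M : ℝ, 0 < M ∧ ∀ z : invLim s, ∃ A : Set (invLim s),
        IsArcOrPoint A ∧ z ∈ A ∧ shiftZ s hs1 hs2 b (h z) ∈ A ∧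
        ∃ m : ℕ, InjOn (proj s m) A ∧ s ^ m * Metric.diam (proj s m '' A) ≤ M := by
  exact final s hs1 hs2 hnr h
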